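/- arXiv:0807.1652 — 5 statements merged into one kernel-verified Lean document; each statement's English description precedes it below -/
import Mathlib

section
/- Let G be a finite connected simple graph. For every spanning tree T of G there exist β(G) − ξ(G) distinct edges e₁, e₂, …, e_{β(G)−ξ(G)} ∈ E(G) \ E(T) such that the fundamental cycles C_T(e_{2i−1}) and C_T(e_{2i}) share a vertex for every i with 1 ≤ i ≤ (β(G) − ξ(G))/2. -/
open SimpleGraph

/-- `T` is a spanning tree of the graph `G` (on the same vertex set). -/
def IsSpanningTree {V : Type*} (G T : SimpleGraph V) : Prop :=
  T ≤ G ∧ T.IsTree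

/-- The Betti number `β(G) = |E(G)| - |V(G)| + 1` of a (finite) graph `G`. -/
noncomputable def betti {V : Type*} (G : SimpleGraph V) : ℕ :=
  G.edgeSet.ncard + 1 - Nat.card V

/-- The number of edges of `D` lying in the connected component `c` of `D`. -/
noncomputable def compEdgeCount {V : Type*} (D : SimpleGraph V)
    (c : D.ConnectedComponent) : ℕ :=
  Set.ncard {e ∈ D.edgeSet | ∀ v ∈ e, D.connectedComponentMk v = c}

/-- The number of connected components of `D` containing an odd number of edges. -/
noncomputable def oddComps {V : Type*} (D : SimpleGraph V) : ℕ :=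
  Set.ncard {c : D.ConnectedComponent | Odd (compEdgeCount D c)}

/-- `ξ(G,T)`: the number of connected components of the spanning subgraph of `G`
with edge set `E(G) \ E(T)` that contain an odd number of edges. -/
noncomputable def xiT {V : Type*} (G T : SimpleGraph V) : ℕ :=
  oddComps (SimpleGraph.fromEdgeSet (G.edgeSet \ T.edgeSet))

/-- The Betti deficiency `ξ(G) = min_T ξ(G,T)` over all spanning trees `T` of `G`. -/
noncomputable def xi {V : Type*} (G : SimpleGraph V) : ℕ :=
  sInf {n | ∃ T, IsSpanningTree G T ∧ xiT G T = n}

/-- The fundamental cycles `C_T(e)` and `C_T(f)` (w.r.t. the spanning tree `T`)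
share a vertex: writing `e = s(u₁,v₁)` and `f = s(u₂,v₂)`, the unique `T`-path
from `u₁` to `v₁` and the unique `T`-path from `u₂` to `v₂` have a common vertex. -/
def FundCyclesMeet {V : Type*} (T : SimpleGraph V) (e f : Sym2 V) : Prop :=
  ∃ (u₁ v₁ u₂ v₂ : V), e = s(u₁, v₁) ∧ f = s(u₂, v₂) ∧
    ∃ (p : T.Walk u₁ v₁) (q : T.Walk u₂ v₂), p.IsPath ∧ q.IsPath ∧
      ∃ x, x ∈ p.support ∧ x ∈ q.support

/-- There are `2g` distinct non-tree edges `e₁, …, e_{2g}` of `G` (w.r.t. the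
spanning tree `T`) such that the fundamental cycles `C_T(e_{2i-1})` and
`C_T(e_{2i})` share a vertex for every `1 ≤ i ≤ g`. -/
def HasPairs {V : Type*} (G T : SimpleGraph V) (g : ℕ) : Prop :=
  ∃ es : Fin (2 * g) → Sym2 V, Function.Injective es ∧
    (∀ i, es i ∈ G.edgeSet \ T.edgeSet) ∧
    ∀ i : Fin g, FundCyclesMeet T
      (es ⟨2 * i.val, by have := i.2; omega⟩)
      (es ⟨2 * i.val + 1, by have := i.2; omega⟩)

open scoped Matrix in
/-- The index set of an invertible alternating matrix has a perfect matching along its nonzero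
entries. -/
theorem exists_pairing_of_isUnit {K n : Type*} [Field K] [Fintype n] [DecidableEq n] (g : ℕ)
    (hn : Fintype.card n = 2 * g) (C : Matrix n n K) (hC : IsUnit (C - Cᵀ)) :
    ∃ f : Fin g × Bool → n, Function.Injective f ∧
      ∀ i, (C - Cᵀ) (f (i, false)) (f (i, true)) ≠ 0 := by
  classical
  induction g generalizing n with
  | zero => exact ⟨fun x => x.1.elim0, fun x => x.1.elim0, fun i => i.elim0⟩
  | succ g ih =>
    obtain ⟨a⟩ : Nonempty n := Fintype.card_pos_iff.1 (by omega)
    set A := C - Cᵀ with hA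
    have hdet : IsUnit A.det := (Matrix.isUnit_iff_isUnit_det A).1 hC
    set B := A⁻¹
    have hAB : A * B = 1 := Matrix.mul_nonsing_inv A hdet
    have hBA : B * A = 1 := Matrix.nonsing_inv_mul A hdet
    have hAT : Aᵀ = -A := by simp [hA]
    have hBT : Bᵀ = -B := by
      have h : (A * B)ᵀ = 1 := by rw [hAB, Matrix.transpose_one]
      rw [Matrix.transpose_mul, hAT, Matrix.mul_neg] at h
      calc Bᵀ = Bᵀ * (A * B) := by rw [hAB, Matrix.mul_one]
        _ = -(-(Bᵀ * A) * B) := by rw [← Matrix.mul_assoc, Matrix.neg_mul, neg_neg]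
        _ = -B := by rw [h, Matrix.one_mul]
    have hBD : B = (B * C * B) - (B * C * B)ᵀ := by
      have : (B * C * B)ᵀ = B * Cᵀ * B := by
        simp [Matrix.transpose_mul, hBT, Matrix.mul_assoc]
      rw [this, ← Matrix.sub_mul, ← Matrix.mul_sub, ← hA, hBA, Matrix.one_mul]
    have hBd (x : n) : B x x = 0 := by
      rw [hBD, Matrix.sub_apply, Matrix.transpose_apply, sub_self]
    have hBs (x y : n) : B x y = -B y x := by
      have := congrFun (congrFun hBT y) x
      simpa using this
    obtain ⟨j, hAj, hBj⟩ : ∃ j, A a j ≠ 0 ∧ B j a ≠ 0 := by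
      by_contra! h
      have h1 := congrFun (congrFun hAB a) a
      rw [Matrix.mul_apply, Finset.sum_eq_zero] at h1
      · simp at h1
      · intro j _
        by_cases hj : A a j = 0
        · simp [hj]
        · simp [h j hj]
    have hja : j ≠ a := by
      rintro rfl
      simp [hA] at hAj
    let m := {x : n // x ≠ a ∧ x ≠ j}
    have hcard : Fintype.card m = 2 * g := by
      have h1 : Fintype.card m = (Finset.univ \ {a, j} : Finset n).card := by
        rw [Fintype.card_subtype]
        congr 1
        ext x
        simp
      rw [h1, Finset.card_sdiff_of_subset (Finset.subset_univ _), Finset.card_pair hja.symm,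
        Finset.card_univ, hn]
      omega
    have hunit : IsUnit (C.submatrix Subtype.val Subtype.val -
        (C.submatrix Subtype.val Subtype.val)ᵀ : Matrix m m K) := by
      have hsub : (C.submatrix Subtype.val Subtype.val -
        (C.submatrix Subtype.val Subtype.val)ᵀ : Matrix m m K) =
          A.submatrix Subtype.val Subtype.val := by ext; simp [hA]
      rw [hsub, Matrix.isUnit_iff_isUnit_det, isUnit_iff_ne_zero]
      intro h0
      obtain ⟨v, hv, hv0⟩ := Matrix.exists_mulVec_eq_zero_iff.2 h0
      set v' : n → K := fun x => if h : x ≠ a ∧ x ≠ j then v ⟨x, h⟩ else 0 with hv'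
      have hAv (x : n) (hx : x ≠ a ∧ x ≠ j) : (A.mulVec v') x = 0 := by
        have h1 := congrFun hv0 ⟨x, hx⟩
        simp only [Matrix.mulVec, dotProduct, Matrix.submatrix_apply, Pi.zero_apply] at h1 ⊢
        rw [← h1]
        symm
        refine Finset.sum_of_injOn Subtype.val Subtype.val_injective.injOn (by simp) ?_ ?_
        · intro y _ hy
          have : ¬(y ≠ a ∧ y ≠ j) := fun h => hy ⟨⟨y, h⟩, by simp, rfl⟩
          simp only [hv', dif_neg this, mul_zero]
        · rintro ⟨y, hy⟩ _
          simp only [hv', dif_pos hy]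
      set w := A.mulVec v' with hw
      have hBw : B.mulVec w = v' := by
        rw [hw, Matrix.mulVec_mulVec, hBA, Matrix.one_mulVec]
      have hexp (x : n) : v' x = B x a * w a + B x j * w j := by
        rw [← hBw, Matrix.mulVec, dotProduct,
          ← Finset.sum_pair hja.symm (f := fun y => B x y * w y)]
        symm
        apply Finset.sum_subset (Finset.subset_univ _)
        intro y _ hy
        rw [hAv y (by simpa using hy), mul_zero]
      have hwj : w j = 0 := by
        have := hexp a
        rw [hBd, hBs a j] at this
        simpa [hv', hBj] using this
      have hwa : w a = 0 := by
        have := hexp j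
        rw [hBd] at this
        simpa [hv', hBj] using this
      apply hv
      ext ⟨x, hx⟩
      have := hexp x
      simpa [hv', hx, hwa, hwj] using this
    obtain ⟨f, hf, hfA⟩ := ih hcard _ hunit
    refine ⟨fun p => Fin.cases (motive := fun _ => n) (if p.2 then j else a)
      (fun i => (f (i, p.2)).1) p.1, ?_, ?_⟩
    · rintro ⟨i, b⟩ ⟨i', b'⟩ h
      induction i using Fin.cases with
      | zero =>
        induction i' using Fin.cases with
        | zero =>
          cases b <;> cases b'
          · rfl
          · exact absurd h.symm hja
          · exact absurd h hja
          · rfl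
        | succ i' =>
          cases b
          · exact absurd h.symm (f (i', b')).2.1
          · exact absurd h.symm (f (i', b')).2.2
      | succ i =>
        induction i' using Fin.cases with
        | zero =>
          cases b'
          · exact absurd h (f (i, b)).2.1
          · exact absurd h (f (i, b)).2.2
        | succ i' =>
          have hp : (i, b) = (i', b') := hf (Subtype.ext h)
          rw [Prod.mk.injEq] at hp
          rw [hp.1, hp.2]
    · intro i
      induction i using Fin.cases with
      | zero => exact hAj
      | succ i => exact hfA i

open Classical in
/-- The edges of `D` assigned to the vertex `v` by `h`. -/
noncomputable def assignedEdges {V : Type*} [Fintype V] (D : SimpleGraph V) (h : Sym2 V → V)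
    (v : V) : Finset (Sym2 V) :=
  {e ∈ D.edgeFinset | h e = v}

open Classical in
theorem cast_card_assignedEdges {V : Type*} [Fintype V] (D : SimpleGraph V) (h : Sym2 V → V) :
    (fun v => ((assignedEdges D h v).card : ZMod 2)) =
      ∑ e ∈ D.edgeFinset, Pi.single (h e) (1 : ZMod 2) := by
  ext v
  simp [assignedEdges, Finset.sum_apply, Pi.single_apply, Finset.sum_boole, eq_comm]

open Classical in
theorem exists_assignment_add_of_adj {V : Type*} [Fintype V] {D : SimpleGraph V} {u v : V}
    (huv : D.Adj u v) (h : Sym2 V → V) (hh : ∀ e, h e ∈ e) :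
    ∃ h' : Sym2 V → V, (∀ e, h' e ∈ e) ∧
      (∑ e ∈ D.edgeFinset, Pi.single (h' e) 1 : V → ZMod 2) =
        ∑ e ∈ D.edgeFinset, Pi.single (h e) (1 : ZMod 2) + Pi.single u 1 + Pi.single v 1 := by
  have hmem : s(u, v) ∈ D.edgeFinset := by simpa using huv
  have key (x y : V) (hx : h s(u, v) = x) :
      (∑ e ∈ D.edgeFinset, Pi.single (Function.update h s(u, v) y e) 1 : V → ZMod 2) =
        ∑ e ∈ D.edgeFinset, Pi.single (h e) (1 : ZMod 2) + Pi.single x 1 + Pi.single y 1 := by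
    rw [← Finset.add_sum_erase _ _ hmem,
      ← Finset.add_sum_erase _ (fun e => (Pi.single (h e) 1 : V → ZMod 2)) hmem,
      Finset.sum_congr rfl (g := fun e => (Pi.single (h e) 1 : V → ZMod 2)), hx,
      Function.update_self]
    · rw [add_right_comm _ _ (Pi.single x 1), ZModModule.add_self, zero_add, add_comm]
    · intro e he
      rw [Function.update_of_ne (Finset.ne_of_mem_erase he)]
  have hok (y : V) (hy : y ∈ s(u, v)) (e : Sym2 V) : Function.update h s(u, v) y e ∈ e := by
    by_cases he : e = s(u, v)
    · subst he; simpa using hy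
    · rw [Function.update_of_ne he]; exact hh e
  rcases Sym2.mem_iff.1 (hh s(u, v)) with hx | hx
  · exact ⟨_, hok v (by simp), key u v hx⟩
  · refine ⟨_, hok u (by simp), ?_⟩
    rw [key v u hx]
    abel

open Classical in
theorem exists_assignment_add_of_walk {V : Type*} [Fintype V] {D : SimpleGraph V} {u v : V}
    (p : D.Walk u v) (h : Sym2 V → V) (hh : ∀ e, h e ∈ e) :
    ∃ h' : Sym2 V → V, (∀ e, h' e ∈ e) ∧
      (∑ e ∈ D.edgeFinset, Pi.single (h' e) 1 : V → ZMod 2) =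
        ∑ e ∈ D.edgeFinset, Pi.single (h e) (1 : ZMod 2) + Pi.single u 1 + Pi.single v 1 := by
  induction p generalizing h with
  | nil => exact ⟨h, hh, by rw [add_assoc, ZModModule.add_self, add_zero]⟩
  | @cons u w v huw p ih =>
    obtain ⟨h₁, hh₁, e₁⟩ := exists_assignment_add_of_adj huw h hh
    obtain ⟨h₂, hh₂, e₂⟩ := ih h₁ hh₁
    refine ⟨h₂, hh₂, ?_⟩
    rw [e₂, e₁, add_assoc _ (Pi.single w 1) (Pi.single w 1), ZModModule.add_self, add_zero]

/-- Edges can be assigned to endpoints so that at most one vertex of each component is assigned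
an odd number of edges. -/
theorem exists_assignment_even {V : Type*} [Fintype V] (D : SimpleGraph V) :
    ∃ h : Sym2 V → V, (∀ e, h e ∈ e) ∧
      ∀ v, v ≠ (D.connectedComponentMk v).out → Even (assignedEdges D h v).card := by
  classical
  have key (s : Finset V) : ∃ h : Sym2 V → V, (∀ e, h e ∈ e) ∧
      ∀ v ∈ s, v ≠ (D.connectedComponentMk v).out →
        (∑ e ∈ D.edgeFinset, Pi.single (h e) (1 : ZMod 2) : V → ZMod 2) v = 0 := by
    induction s using Finset.induction_on with
    | empty => exact ⟨fun e => e.out.1, fun e => e.out_fst_mem, by simp⟩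
    | insert v s hv ih =>
      obtain ⟨h, hh, h0⟩ := ih
      by_cases hc : v ≠ (D.connectedComponentMk v).out →
        (∑ e ∈ D.edgeFinset, Pi.single (h e) (1 : ZMod 2) : V → ZMod 2) v = 0
      · refine ⟨h, hh, fun w hw => ?_⟩
        rcases Finset.mem_insert.1 hw with rfl | hw
        · exact hc
        · exact h0 w hw
      · push Not at hc
        obtain ⟨hvr, hv1⟩ := hc
        have hreach : D.Reachable v (D.connectedComponentMk v).out :=
          ConnectedComponent.exact (Quot.out_eq (D.connectedComponentMk v)).symm
        obtain ⟨p⟩ := hreach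
        obtain ⟨h', hh', e'⟩ := exists_assignment_add_of_walk p h hh
        refine ⟨h', hh', fun w hw hwr => ?_⟩
        have hwv : w ≠ (D.connectedComponentMk v).out := by
          intro hwv
          apply hwr
          have : D.connectedComponentMk w = D.connectedComponentMk v := by
            rw [hwv]; exact Quot.out_eq (D.connectedComponentMk v)
          rw [this]; exact hwv
        rw [e', Pi.add_apply, Pi.add_apply, Pi.single_eq_of_ne hwv, add_zero]
        rcases Finset.mem_insert.1 hw with rfl | hw
        · rw [Pi.single_eq_same, Fin.eq_one_of_ne_zero _ hv1]
          exact ZModModule.add_self _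
        · rw [h0 w hw hwr, Pi.single_eq_of_ne (ne_of_mem_of_not_mem hw hv), add_zero]
  obtain ⟨h, hh, h0⟩ := key Finset.univ
  refine ⟨h, hh, fun v hv => ?_⟩
  have := h0 v (Finset.mem_univ v) hv
  rw [← cast_card_assignedEdges] at this
  exact (ZMod.natCast_eq_zero_iff_even).1 this

theorem compEdgeCount_eq_sum {V : Type*} [Fintype V] [DecidableEq V] (D : SimpleGraph V)
    [DecidableEq D.ConnectedComponent]
    {h : Sym2 V → V} (hh : ∀ e, h e ∈ e) (c : D.ConnectedComponent) :
    compEdgeCount D c =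
      ∑ v with D.connectedComponentMk v = c, (assignedEdges D h v).card := by
  classical
  have hset : {e ∈ D.edgeSet | ∀ v ∈ e, D.connectedComponentMk v = c} =
      ({e ∈ D.edgeFinset | D.connectedComponentMk (h e) = c} : Finset (Sym2 V)) := by
    ext e
    simp only [Set.mem_ofPred_eq, Finset.coe_filter, mem_edgeFinset]
    refine and_congr_right fun he => ⟨fun H => H _ (hh e), fun H v hv => ?_⟩
    rw [← H]
    by_cases hve : v = h e
    · rw [hve]
    · apply ConnectedComponent.sound
      have : e = s(v, h e) := (Sym2.mem_and_mem_iff hve).1 ⟨hv, hh e⟩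
      rw [this] at he
      exact Adj.reachable he
  rw [compEdgeCount, hset, Set.ncard_coe_finset,
    Finset.card_eq_sum_card_fiberwise (f := h)
      (t := Finset.univ.filter fun v => D.connectedComponentMk v = c)]
  · refine Finset.sum_congr rfl fun v hv => ?_
    congr 1
    ext e
    simp only [assignedEdges, Finset.mem_filter]
    have := (Finset.mem_filter.1 hv).2
    constructor
    · rintro ⟨⟨a, b⟩, c⟩; exact ⟨a, c⟩
    · rintro ⟨a, c⟩; exact ⟨⟨a, by rw [c]; exact this⟩, c⟩
  · intro e he
    simpa using (Finset.mem_filter.1 he).2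

theorem odd_compEdgeCount_iff {V : Type*} [Fintype V] (D : SimpleGraph V)
    {h : Sym2 V → V} (hh : ∀ e, h e ∈ e)
    (heven : ∀ v, v ≠ (D.connectedComponentMk v).out → Even (assignedEdges D h v).card)
    (c : D.ConnectedComponent) :
    Odd (compEdgeCount D c) ↔ Odd (assignedEdges D h c.out).card := by
  classical
  have hout : D.connectedComponentMk c.out = c := Quot.out_eq c
  rw [compEdgeCount_eq_sum D hh,
    ← Finset.add_sum_erase _ _ (by simpa using hout : c.out ∈ Finset.univ.filter _),
    Nat.odd_add]
  have : Even (∑ v ∈ (Finset.univ.filter fun v => D.connectedComponentMk v = c).erase c.out,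
      (assignedEdges D h v).card) := by
    refine Finset.even_sum _ fun v hv => heven v ?_
    rw [Finset.mem_erase, Finset.mem_filter] at hv
    rw [hv.2.2]
    exact hv.1
  simp [this]

theorem two_mul_sum_half_add_oddComps {V : Type*} [Fintype V] (D : SimpleGraph V)
    {h : Sym2 V → V} (hh : ∀ e, h e ∈ e)
    (heven : ∀ v, v ≠ (D.connectedComponentMk v).out → Even (assignedEdges D h v).card) :
    2 * ∑ v, (assignedEdges D h v).card / 2 + oddComps D = D.edgeSet.ncard := by
  classical
  have hodd : oddComps D = ∑ v, (assignedEdges D h v).card % 2 := by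
    have himg : ((fun c : D.ConnectedComponent => c.out) '' {c | Odd (compEdgeCount D c)}) =
        ((Finset.univ.filter fun v => Odd (assignedEdges D h v).card : Finset V) : Set V) := by
      ext v
      simp only [Set.mem_image, Set.mem_ofPred_eq, Finset.coe_filter, Finset.mem_univ, true_and]
      constructor
      · rintro ⟨c, hc, rfl⟩
        exact (odd_compEdgeCount_iff D hh heven c).1 hc
      · intro hv
        have hvo : v = (D.connectedComponentMk v).out := by
          by_contra hne
          exact Nat.not_even_iff_odd.2 hv (heven v hne)
        exact ⟨_, (odd_compEdgeCount_iff D hh heven _).2 (hvo ▸ hv), hvo.symm⟩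
    have hinj : Function.Injective (fun c : D.ConnectedComponent => c.out) :=
      Function.LeftInverse.injective Quot.out_eq
    have hcard := Set.ncard_image_of_injective {c | Odd (compEdgeCount D c)} hinj
    rw [oddComps, ← hcard, himg, Set.ncard_coe_finset, Finset.card_filter]
    refine Finset.sum_congr rfl fun v _ => ?_
    split_ifs with ho
    · exact (Nat.odd_iff.1 ho).symm
    · exact (Nat.even_iff.1 (Nat.not_odd_iff_even.1 ho)).symm
  have hsum : D.edgeSet.ncard = ∑ v, (assignedEdges D h v).card := by
    rw [← coe_edgeFinset, Set.ncard_coe_finset,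
      Finset.card_eq_sum_card_fiberwise (f := h) (t := Finset.univ) (by simp)]
    rfl
  rw [hodd, hsum, Finset.mul_sum, ← Finset.sum_add_distrib]
  exact Finset.sum_congr rfl fun v _ => Nat.div_add_mod _ 2

/-- All edges of `D` but one for each odd component can be grouped into disjoint pairs of adjacent
edges. -/
theorem exists_adjacent_edge_pairs {V : Type*} [Finite V] (D : SimpleGraph V) :
    ∃ (g : ℕ) (ε : Fin g × Bool → Sym2 V), 2 * g + oddComps D = D.edgeSet.ncard ∧
      Function.Injective ε ∧ (∀ k, ε k ∈ D.edgeSet) ∧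
      ∀ i, ∃ w, w ∈ ε (i, false) ∧ w ∈ ε (i, true) := by
  classical
  have := Fintype.ofFinite V
  obtain ⟨h, hh, heven⟩ := exists_assignment_even D
  let κ := Σ v : V, Fin ((assignedEdges D h v).card / 2)
  let idx (k : κ) (b : Bool) : Fin (assignedEdges D h k.1).card :=
    ⟨2 * k.2.1 + b.toNat, by have := k.2.2; have := Bool.toNat_le b; omega⟩
  let pick (k : κ) (b : Bool) : Sym2 V := ((assignedEdges D h k.1).equivFin.symm (idx k b)).1
  have hpick (k : κ) (b : Bool) : pick k b ∈ assignedEdges D h k.1 :=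
    ((assignedEdges D h k.1).equivFin.symm (idx k b)).2
  have hpick2 (k : κ) (b : Bool) : h (pick k b) = k.1 := (Finset.mem_filter.1 (hpick k b)).2
  have hcard : Fintype.card κ = ∑ v, (assignedEdges D h v).card / 2 := by
    simp [κ, Fintype.card_sigma]
  refine ⟨Fintype.card κ, fun k => pick ((Fintype.equivFin κ).symm k.1) k.2, ?_, ?_, ?_, ?_⟩
  · rw [hcard]
    exact two_mul_sum_half_add_oddComps D hh heven
  · rintro ⟨i, b⟩ ⟨i', b'⟩ hk
    obtain ⟨k, rfl⟩ := (Fintype.equivFin κ).surjective i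
    obtain ⟨k', rfl⟩ := (Fintype.equivFin κ).surjective i'
    simp only [Equiv.symm_apply_apply] at hk
    obtain ⟨v, a⟩ := k
    obtain ⟨v', a'⟩ := k'
    have hv : v = v' := by
      have := congrArg h hk
      rwa [hpick2, hpick2] at this
    subst hv
    have h1 := congrArg Fin.val
      ((assignedEdges D h v).equivFin.symm.injective (Subtype.ext hk))
    simp only [idx] at h1
    have hb : b = b' := by cases b <;> cases b' <;> simp at h1 ⊢ <;> omega
    subst hb
    have ha : a = a' := Fin.ext (by omega)
    rw [ha]
  · intro k
    exact mem_edgeFinset.1 (Finset.mem_filter.1 (hpick _ _)).1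
  · intro i
    refine ⟨((Fintype.equivFin κ).symm i).1, ?_, ?_⟩
    · nth_rw 1 [← hpick2 ((Fintype.equivFin κ).symm i) false]; exact hh _
    · nth_rw 1 [← hpick2 ((Fintype.equivFin κ).symm i) true]; exact hh _

/-- The parity vector of the edges traversed by a walk. -/
noncomputable def walkVec {V : Type*} [DecidableEq V] {G : SimpleGraph V} {u v : V}
    (p : G.Walk u v) : Sym2 V → ZMod 2 :=
  (p.edges.map fun e => Pi.single e 1).sum

theorem walkVec_apply_eq_zero {V : Type*} [DecidableEq V] {G : SimpleGraph V} {u v : V}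
    (p : G.Walk u v) {e : Sym2 V} (he : e ∉ p.edges) : walkVec p e = 0 := by
  have key (l : List (Sym2 V)) (hl : e ∉ l) :
      (l.map fun e => Pi.single e 1 : List (Sym2 V → ZMod 2)).sum e = 0 := by
    induction l with
    | nil => simp
    | cons a l ih =>
      rw [List.mem_cons, not_or] at hl
      rw [List.map_cons, List.sum_cons, Pi.add_apply, ih hl.2, Pi.single_eq_of_ne hl.1, add_zero]
  exact key _ he

theorem map_walkVec {V M : Type*} [DecidableEq V] [AddCommGroup M] [Module (ZMod 2) M]
    {G : SimpleGraph V} (L : (Sym2 V → ZMod 2) →ₗ[ZMod 2] M) (φ : V → M)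
    (hL : ∀ u v, L (Pi.single s(u, v) 1) = φ u + φ v) {u v : V} (p : G.Walk u v) :
    L (walkVec p) = φ u + φ v := by
  induction p with
  | nil => simp [walkVec, ZModModule.add_self]
  | @cons u w v h p ih =>
    have : walkVec (Walk.cons h p) = Pi.single s(u, w) 1 + walkVec p := by simp [walkVec]
    rw [this, map_add, hL, ih, add_assoc, ← add_assoc (φ w), ZModModule.add_self, zero_add]

/-- The edge-parity vector of the tree path from `u` to `v`. -/
noncomputable def treeVec {V : Type*} [DecidableEq V] {T : SimpleGraph V} (hT : T.IsTree)
    (u v : V) : Sym2 V → ZMod 2 :=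
  walkVec (hT.existsUnique_path u v).choose

theorem treeVec_eq {V : Type*} [DecidableEq V] {T : SimpleGraph V} (hT : T.IsTree)
    {u v : V} {p : T.Walk u v} (hp : p.IsPath) : treeVec hT u v = walkVec p := by
  rw [treeVec, ← (hT.existsUnique_path u v).choose_spec.2 p hp]

theorem treeVec_add_of_adj {V : Type*} [DecidableEq V] {T : SimpleGraph V} (hT : T.IsTree)
    (r : V) {a b : V} (hab : T.Adj a b) :
    treeVec hT r a + treeVec hT r b = Pi.single s(a, b) 1 := by
  have key (a b : V) (hab : T.Adj a b) (p : T.Walk r a) (hp : p.IsPath) (hb : b ∉ p.support) :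
      treeVec hT r a + treeVec hT r b = Pi.single s(a, b) 1 := by
    have : walkVec (p.concat hab) = walkVec p + Pi.single s(a, b) 1 := by
      simp [walkVec, Walk.edges_concat]
    rw [treeVec_eq hT hp, treeVec_eq hT (hp.concat hb hab), this, ← add_assoc,
      ZModModule.add_self, zero_add]
  obtain ⟨p, hp, -⟩ := hT.existsUnique_path r a
  by_cases hb : b ∈ p.support
  · rw [add_comm, Sym2.eq_swap]
    refine key b a hab.symm (p.takeUntil b hb) (hp.takeUntil hb) ?_
    intro ha
    exact Walk.endpoint_notMem_support_takeUntil hp hb hab.ne ha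
  · exact key a b hab p hp hb

/-- The edge-parity vector of the fundamental cycle of `e` with respect to the tree `T`,
with tree paths measured through the root `r`. -/
noncomputable def fundVec {V : Type*} [DecidableEq V] {T : SimpleGraph V} (hT : T.IsTree)
    (r : V) : Sym2 V → Sym2 V → ZMod 2 :=
  fun e => Pi.single e 1 + Sym2.lift ⟨fun u v => treeVec hT r u + treeVec hT r v,
    fun _ _ => add_comm _ _⟩ e

theorem fundVec_of_mem {V : Type*} [DecidableEq V] {T : SimpleGraph V} (hT : T.IsTree)
    (r : V) {e : Sym2 V} (he : e ∈ T.edgeSet) : fundVec hT r e = 0 := by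
  induction e with
  | h u v =>
    simp only [fundVec, Sym2.lift_mk, treeVec_add_of_adj hT r he]
    exact ZModModule.add_self _

theorem fundVec_eq_walkVec {V : Type*} [Finite V] [DecidableEq V] {T : SimpleGraph V}
    (hT : T.IsTree) (r : V) {u v : V} (p : T.Walk u v) :
    fundVec hT r s(u, v) = Pi.single s(u, v) 1 + walkVec p := by
  have := Fintype.ofFinite V
  let L : (Sym2 V → ZMod 2) →ₗ[ZMod 2] (Sym2 V → ZMod 2) :=
    LinearMap.id + Fintype.linearCombination (ZMod 2) (fundVec hT r)
  have hL (u v : V) : L (Pi.single s(u, v) 1) = treeVec hT r u + treeVec hT r v := by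
    simp only [L, LinearMap.add_apply, LinearMap.id_apply,
      Fintype.linearCombination_apply_single, one_smul, fundVec, Sym2.lift_mk, ← add_assoc]
    rw [ZModModule.add_self, zero_add]
  have hz : Fintype.linearCombination (ZMod 2) (fundVec hT r) (walkVec p) = 0 := by
    rw [Fintype.linearCombination_apply]
    refine Finset.sum_eq_zero fun e _ => ?_
    by_cases he : e ∈ p.edges
    · rw [fundVec_of_mem hT r (p.edges_subset_edgeSet he), smul_zero]
    · rw [walkVec_apply_eq_zero p he, zero_smul]
  have := map_walkVec L _ hL p
  rw [LinearMap.add_apply, LinearMap.id_apply, hz, add_zero] at this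
  rw [this]
  rfl

/-- Fundamental cycles of one tree expand in the fundamental cycles of another. -/
theorem fundVec_eq_sum {V : Type*} [Fintype V] [DecidableEq V] {T T₀ : SimpleGraph V}
    (hT : T.IsTree) (hT₀ : T₀.IsTree) (r : V) (k : Sym2 V) :
    fundVec hT₀ r k = ∑ e, fundVec hT₀ r k e • fundVec hT r e := by
  induction k with
  | h u v =>
    obtain ⟨p, -⟩ := hT₀.existsUnique_path u v
    let L : (Sym2 V → ZMod 2) →ₗ[ZMod 2] (Sym2 V → ZMod 2) :=
      LinearMap.id + Fintype.linearCombination (ZMod 2) (fundVec hT r)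
    have hL (u v : V) : L (Pi.single s(u, v) 1) = treeVec hT r u + treeVec hT r v := by
      simp only [L, LinearMap.add_apply, LinearMap.id_apply,
        Fintype.linearCombination_apply_single, one_smul, fundVec, Sym2.lift_mk, ← add_assoc]
      rw [ZModModule.add_self, zero_add]
    have h := map_walkVec L _ hL p
    rw [← hL] at h
    rw [← Fintype.linearCombination_apply (ZMod 2), fundVec_eq_walkVec hT₀ r p,
      ← sub_eq_zero, ZModModule.sub_eq_add]
    change L (Pi.single s(u, v) 1 + walkVec p) = 0
    rw [map_add, h, ZModModule.add_self]

theorem exists_mem_support_of_fundVec_ne_zero {V : Type*} [Finite V] [DecidableEq V]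
    {T : SimpleGraph V} (hT : T.IsTree) (r : V) {u v w : V} {p : T.Walk u v} {e : Sym2 V}
    (he : fundVec hT r s(u, v) e ≠ 0) (hw : w ∈ e) : w ∈ p.support := by
  rw [fundVec_eq_walkVec hT r p, Pi.add_apply] at he
  by_cases hes : e = s(u, v)
  · rw [hes, Sym2.mem_iff] at hw
    rcases hw with rfl | rfl
    · exact p.start_mem_support
    · exact p.end_mem_support
  · rw [Pi.single_eq_of_ne hes, zero_add] at he
    have hep : e ∈ p.edges := by
      by_contra h
      exact he (walkVec_apply_eq_zero p h)
    exact Walk.mem_support_of_mem_edges hep hw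

theorem fundCyclesMeet_of_fundVec_ne_zero {V : Type*} [Finite V] [DecidableEq V]
    {T : SimpleGraph V} (hT : T.IsTree) (r : V) {a b e f : Sym2 V} {w : V}
    (hae : fundVec hT r a e ≠ 0) (hbf : fundVec hT r b f ≠ 0) (hwe : w ∈ e) (hwf : w ∈ f) :
    FundCyclesMeet T a b := by
  induction a with
  | h u₁ v₁ =>
    induction b with
    | h u₂ v₂ =>
      obtain ⟨p, hp, -⟩ := hT.existsUnique_path u₁ v₁
      obtain ⟨q, hq, -⟩ := hT.existsUnique_path u₂ v₂
      exact ⟨u₁, v₁, u₂, v₂, rfl, rfl, p, q, hp, hq, w,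
        exists_mem_support_of_fundVec_ne_zero hT r hae hwe,
        exists_mem_support_of_fundVec_ne_zero hT r hbf hwf⟩

/-- A spanning family of vectors in `ι → K` contains the rows of an invertible matrix. -/
theorem exists_isUnit_of_span_eq_top {K ι α : Type*} [Field K] [Fintype ι] [DecidableEq ι]
    (v : α → ι → K) (hv : Submodule.span K (Set.range v) = ⊤) :
    ∃ η : ι → α, Function.Injective η ∧ IsUnit (Matrix.of fun i j => v (η i) j) := by
  obtain ⟨κ, a, ha, hspan, hli⟩ := exists_linearIndependent' K v
  let b := Module.Basis.mk hli (by rw [hspan, hv])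
  let e : ι ≃ κ := (Pi.basisFun K ι).indexEquiv b
  refine ⟨a ∘ e, ha.comp e.injective, Matrix.linearIndependent_rows_iff_isUnit.1 ?_⟩
  exact hli.comp e e.injective

theorem span_fundVec_eq_top {V ι : Type*} [Finite V] [DecidableEq V] [Finite ι]
    {G T T₀ : SimpleGraph V} (hT : T.IsTree) (hT₀ : T₀.IsTree) (hT₀G : T₀ ≤ G) (r : V)
    (ε : ι → Sym2 V) (hε : Function.Injective ε) (hεG : ∀ k, ε k ∈ G.edgeSet \ T₀.edgeSet) :
    Submodule.span (ZMod 2) (Set.range fun (e : ↥(G.edgeSet \ T.edgeSet)) k =>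
      fundVec hT r e.1 (ε k)) = ⊤ := by
  classical
  have := Fintype.ofFinite V
  have := Fintype.ofFinite ι
  rw [eq_top_iff, ← (Pi.basisFun (ZMod 2) ι).span_eq, Submodule.span_le]
  rintro _ ⟨k, rfl⟩
  have hexp : (Pi.basisFun (ZMod 2) ι k) =
      ∑ e, fundVec hT₀ r (ε k) e • fun k' => fundVec hT r e (ε k') := by
    ext k'
    have h := congrFun (fundVec_eq_sum hT hT₀ r (ε k)) (ε k')
    rw [Finset.sum_apply] at h
    rw [Finset.sum_apply]
    simp only [Pi.smul_apply] at h ⊢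
    rw [← h]
    generalize hx : ε k = x
    induction x with
    | h u v =>
      obtain ⟨p, -⟩ := hT₀.existsUnique_path u v
      rw [fundVec_eq_walkVec hT₀ r p, Pi.add_apply,
        walkVec_apply_eq_zero p fun h => (hεG k').2 (p.edges_subset_edgeSet h), add_zero, ← hx,
        Pi.basisFun_apply]
      simp [Pi.single_apply, hε.eq_iff]
  rw [hexp]
  refine Submodule.sum_mem _ fun e _ => ?_
  by_cases heG : e ∈ G.edgeSet
  · by_cases heT : e ∈ T.edgeSet
    · rw [fundVec_of_mem hT r heT]
      exact Submodule.smul_mem _ _ (Submodule.zero_mem _)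
    · exact Submodule.smul_mem _ _ (Submodule.subset_span ⟨⟨e, heG, heT⟩, rfl⟩)
  · have : fundVec hT₀ r (ε k) e = 0 := by
      generalize hx : ε k = x
      induction x with
      | h u v =>
        obtain ⟨p, -⟩ := hT₀.existsUnique_path u v
        rw [fundVec_eq_walkVec hT₀ r p, Pi.add_apply, walkVec_apply_eq_zero p fun h =>
          heG (edgeSet_subset_edgeSet.2 hT₀G (p.edges_subset_edgeSet h)), add_zero, ← hx,
          Pi.single_eq_of_ne]
        rintro rfl
        exact heG (hεG k).1
    rw [this, zero_smul]
    exact Submodule.zero_mem _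

open scoped Matrix in
/-- Disjoint pairs of adjacent edges off one spanning tree yield as many disjoint pairs of edges
with intersecting fundamental cycles off any other spanning tree. -/
theorem exists_fundCyclesMeet_pairs {V : Type*} [Finite V] {G T T₀ : SimpleGraph V}
    (hT : T.IsTree) (hT₀ : T₀.IsTree) (hT₀G : T₀ ≤ G) {g : ℕ} (ε : Fin g × Bool → Sym2 V)
    (hε : Function.Injective ε) (hεG : ∀ k, ε k ∈ G.edgeSet \ T₀.edgeSet)
    (hadj : ∀ i, ∃ w, w ∈ ε (i, false) ∧ w ∈ ε (i, true)) :
    ∃ φ : Fin g × Bool → Sym2 V, Function.Injective φ ∧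
      (∀ k, φ k ∈ G.edgeSet \ T.edgeSet) ∧
      ∀ i, FundCyclesMeet T (φ (i, false)) (φ (i, true)) := by
  classical
  obtain ⟨r⟩ := hT.connected.nonempty
  obtain ⟨η, hη, hN⟩ := exists_isUnit_of_span_eq_top _
    (span_fundVec_eq_top hT hT₀ hT₀G r ε hε hεG)
  set N : Matrix (Fin g × Bool) (Fin g × Bool) (ZMod 2) :=
    Matrix.of fun i j => fundVec hT r (η i).1 (ε j)
  let J : Matrix (Fin g × Bool) (Fin g × Bool) (ZMod 2) :=
    Matrix.of fun i j => if i.1 = j.1 ∧ i.2 = false ∧ j.2 = true then 1 else 0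
  have hJapply (i j) : (J - Jᵀ) i j = if j = (i.1, !i.2) then 1 else 0 := by
    obtain ⟨i, b⟩ := i
    obtain ⟨j, c⟩ := j
    by_cases h : i = j
    · subst h
      cases b <;> cases c <;> simp [J]
    · cases b <;> cases c <;> simp [J, h, Ne.symm h]
  have hJJ : (J - Jᵀ) * (J - Jᵀ) = 1 := by
    ext i k
    rw [Matrix.mul_apply, Finset.sum_eq_single (i.1, !i.2)]
    · simp [hJapply, Matrix.one_apply, eq_comm]
    · intro j _ hj
      rw [hJapply, if_neg hj, zero_mul]
    · simp
  have hJ : IsUnit (J - Jᵀ) := ⟨⟨_, _, hJJ, hJJ⟩, rfl⟩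
  have hA : N * J * Nᵀ - (N * J * Nᵀ)ᵀ = N * (J - Jᵀ) * Nᵀ := by
    simp [Matrix.transpose_mul, Matrix.mul_sub, Matrix.sub_mul, Matrix.mul_assoc]
  have hAu : IsUnit (N * J * Nᵀ - (N * J * Nᵀ)ᵀ) := by
    rw [hA]
    exact (hN.mul hJ).mul ((Matrix.isUnit_transpose _).2 hN)
  obtain ⟨f, hf, hfA⟩ := exists_pairing_of_isUnit g (by simp [mul_comm]) _ hAu
  refine ⟨fun k => (η (f k)).1, Subtype.val_injective.comp (hη.comp hf), fun k => (η (f k)).2,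
    fun i => ?_⟩
  have h := hfA i
  rw [hA, Matrix.mul_apply] at h
  obtain ⟨k, -, hk⟩ := Finset.exists_ne_zero_of_sum_ne_zero h
  rw [Matrix.mul_apply] at hk
  obtain ⟨l, -, hl⟩ := Finset.exists_ne_zero_of_sum_ne_zero (left_ne_zero_of_mul hk)
  have hkl : k = (l.1, !l.2) := by
    by_contra hne
    exact right_ne_zero_of_mul hl (by rw [hJapply, if_neg hne])
  obtain ⟨w, hw₀, hw₁⟩ := hadj l.1
  have hmem (b : Bool) : w ∈ ε (l.1, b) := by cases b <;> assumption
  exact fundCyclesMeet_of_fundVec_ne_zero hT r (left_ne_zero_of_mul hl)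
    (right_ne_zero_of_mul hk) (hmem l.2) (hkl ▸ hmem _)

theorem ncard_edgeSet_diff_eq_betti {V : Type*} [Finite V] {G T : SimpleGraph V}
    (hT : IsSpanningTree G T) : (G.edgeSet \ T.edgeSet).ncard = betti G := by
  classical
  have := Fintype.ofFinite V
  have hcard := hT.2.card_edgeFinset
  rw [betti, Set.ncard_sdiff (edgeSet_subset_edgeSet.2 hT.1), Nat.card_eq_fintype_card,
    ← hcard, ← coe_edgeFinset T, Set.ncard_coe_finset]
  omega

/-- For every spanning tree `T` of a connected graph `G` there exist
`β(G) - ξ(G)` distinct non-tree edges whose fundamental cycles, taken in consecutive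
pairs, share a vertex. -/
theorem exists_adjacent_fundamental_cycle_pairs {V : Type*} [Finite V]
    (G : SimpleGraph V) (hG : G.Connected)
    (T : SimpleGraph V) (hT : IsSpanningTree G T) :
    ∃ es : Fin (betti G - xi G) → Sym2 V, Function.Injective es ∧
      (∀ i, es i ∈ G.edgeSet \ T.edgeSet) ∧
      ∀ i : Fin ((betti G - xi G) / 2), FundCyclesMeet T
        (es ⟨2 * i.val, by have := i.2; omega⟩)
        (es ⟨2 * i.val + 1, by have := i.2; omega⟩) := by
  obtain ⟨T₀, hT₀, hxi⟩ := Nat.sInf_mem (s := {n | ∃ T, IsSpanningTree G T ∧ xiT G T = n})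
    ⟨_, T, hT, rfl⟩
  change xiT G T₀ = xi G at hxi
  have hD : (fromEdgeSet (G.edgeSet \ T₀.edgeSet)).edgeSet = G.edgeSet \ T₀.edgeSet := by
    rw [edgeSet_fromEdgeSet, sdiff_eq_left, Set.disjoint_left]
    exact fun e he => G.not_isDiag_of_mem_edgeSet he.1
  obtain ⟨g, ε, hg, hε, hεD, hadj⟩ :=
    exists_adjacent_edge_pairs (fromEdgeSet (G.edgeSet \ T₀.edgeSet))
  rw [hD, ncard_edgeSet_diff_eq_betti hT₀] at hg
  change 2 * g + xiT G T₀ = betti G at hg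
  obtain ⟨φ, hφ, hφG, hmeet⟩ :=
    exists_fundCyclesMeet_pairs hT.2 hT₀.2 hT₀.1 ε hε (fun k => hD ▸ hεD k) hadj
  have hn : betti G - xi G = 2 * g := by omega
  refine ⟨fun i => φ (⟨i / 2, by have := i.2; omega⟩, decide (i.1 % 2 = 1)), ?_,
    fun i => hφG _, fun i => ?_⟩
  · intro i j hij
    have h := hφ hij
    simp only [Prod.mk.injEq, Fin.mk.injEq, decide_eq_decide] at h
    ext
    omega
  · have hi : i.1 < g := by have := i.2; omega
    have h := hmeet ⟨i, hi⟩
    have h₁ : (2 * i.1 + 1) / 2 = i.1 := by omega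
    have h₂ : (2 * i.1 + 1) % 2 = 1 := by omega
    simpa [h₁, h₂] using h
end

section
/- Let G be a finite connected simple graph. If G has a spanning tree T such that any two fundamental cycles of T share a vertex (i.e., for all distinct e, f ∈ E(G) \ E(T), C_T(e) and C_T(f) have a common vertex), then ξ(G) ≤ 1; equivalently, G is upper-embeddable. -/
open SimpleGraph

namespace SimpleGraph

variable {V : Type*} {G T : SimpleGraph V} {a b r u v x y z : V}

/-! ### Reachability after deleting or adding edges -/

lemma Walk.reachable_deleteIncidenceSet (p : G.Walk a b) (hr : r ∉ p.support) :
    (G.deleteIncidenceSet r).Reachable a b := by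
  induction p with
  | nil => rfl
  | @cons c d e h p ih =>
    rw [Walk.support_cons, List.mem_cons, not_or] at hr
    have hd : d ≠ r := fun hd ↦ hr.2 (hd ▸ p.start_mem_support)
    exact (Adj.reachable (deleteIncidenceSet_adj.2 ⟨h, Ne.symm hr.1, hd⟩)).trans (ih hr.2)

lemma Reachable.deleteIncidenceSet_of_not_reachable (h : G.Reachable a b)
    (hr : ¬ G.Reachable a r) : (G.deleteIncidenceSet r).Reachable a b := by
  classical
  obtain ⟨p⟩ := h
  exact p.reachable_deleteIncidenceSet fun hp ↦ hr (p.takeUntil r hp).reachable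

lemma Reachable.ne_left_of_deleteIncidenceSet (h : (G.deleteIncidenceSet r).Reachable a b)
    (hab : a ≠ b) : a ≠ r := by
  obtain ⟨p⟩ := h
  cases p with
  | nil => exact absurd rfl hab
  | cons h _ => exact (deleteIncidenceSet_adj.1 h).2.1

lemma Reachable.exists_isPath_notMem_support (h : (G.deleteIncidenceSet r).Reachable a b)
    (hab : a ≠ b) : ∃ p : G.Walk a b, p.IsPath ∧ r ∉ p.support := by
  classical
  obtain ⟨p, hp⟩ := h.exists_isPath
  refine ⟨p.mapLe (deleteIncidenceSet_le _ _), hp.mapLe _, fun hr ↦ ?_⟩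
  replace hr : r ∈ p.support := by simpa using hr
  by_cases har : a = r
  · exact h.ne_left_of_deleteIncidenceSet hab har
  · exact (p.takeUntil r hr).reachable.symm.ne_left_of_deleteIncidenceSet (Ne.symm har) rfl

lemma reachable_deleteIncidenceSet_mono {H : SimpleGraph V} (hle : H ≤ G)
    (h : (H.deleteIncidenceSet r).Reachable a b) : (G.deleteIncidenceSet r).Reachable a b := by
  refine h.mono fun c d hcd ↦ ?_
  rw [deleteIncidenceSet_adj] at hcd ⊢
  exact ⟨hle hcd.1, hcd.2⟩

lemma Reachable.of_sup_edge (h : (G ⊔ edge u v).Reachable a b) :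
    G.Reachable a b ∨ (G.Reachable a u ∧ G.Reachable v b) ∨
      (G.Reachable a v ∧ G.Reachable u b) := by
  rw [reachable_iff_reflTransGen] at h
  induction h with
  | refl => exact .inl .rfl
  | @tail c d _ hcd ih =>
    rw [sup_adj, edge_adj] at hcd
    rcases hcd with hcd | ⟨⟨rfl, rfl⟩ | ⟨rfl, rfl⟩, -⟩
    · exact ih.imp (·.trans hcd.reachable)
        (Or.imp (And.imp_right (·.trans hcd.reachable)) (And.imp_right (·.trans hcd.reachable)))
    · rcases ih with h | h | h
      · exact .inr (.inl ⟨h, .rfl⟩)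
      · exact .inr (.inl ⟨h.1, .rfl⟩)
      · exact .inl h.1
    · rcases ih with h | h | h
      · exact .inr (.inr ⟨h, .rfl⟩)
      · exact .inl h.1
      · exact .inr (.inr ⟨h.1, .rfl⟩)

lemma deleteEdges_sup_edge (h : G.Adj x y) : G.deleteEdges {s(x, y)} ⊔ edge x y = G := by
  ext c d
  simp only [sup_adj, deleteEdges_adj, Set.mem_singleton_iff, adj_edge]
  constructor
  · rintro (h' | ⟨h', -⟩)
    · exact h'.1
    · rwa [← mem_edgeSet, ← h', mem_edgeSet]
  · intro h'
    by_cases hs : s(c, d) = s(x, y)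
    · exact .inr ⟨hs.symm, h'.ne⟩
    · exact .inl ⟨h', hs⟩

lemma sup_edge_deleteIncidenceSet (hu : u ≠ r) (hv : v ≠ r) :
    (G ⊔ edge u v).deleteIncidenceSet r = G.deleteIncidenceSet r ⊔ edge u v := by
  ext c d
  simp only [deleteIncidenceSet_adj, sup_adj, edge_adj]
  grind

lemma deleteIncidenceSet_le_deleteEdges :
    G.deleteIncidenceSet r ≤ G.deleteEdges {s(r, x)} := by
  intro c d
  simp only [deleteIncidenceSet_adj, deleteEdges_adj, Set.mem_singleton_iff]
  grind

lemma IsAcyclic.not_reachable_deleteEdges (hT : T.IsAcyclic) (h : T.Adj x y) :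
    ¬ (T.deleteEdges {s(x, y)}).Reachable x y :=
  isBridge_iff.1 (isAcyclic_iff_forall_adj_isBridge.1 hT h)

/-- The last step of the path from `r` to `y` in a connected graph. -/
lemma Connected.exists_adj_reachable_deleteIncidenceSet (hT : T.Connected) (h : y ≠ r) :
    ∃ x, T.Adj x y ∧ (T.deleteIncidenceSet y).Reachable x r := by
  obtain ⟨p, hp⟩ := (hT y r).exists_isPath
  cases p with
  | nil => exact absurd rfl h
  | cons hadj q =>
    rw [Walk.cons_isPath_iff] at hp
    exact ⟨_, hadj.symm, q.reachable_deleteIncidenceSet hp.2⟩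

/-! ### A vertex common to all fundamental cycles -/

/-- For a tree `T ≤ G`, the vertex `r` lies on every fundamental cycle of `T`. -/
def OnAllFundCycles (G T : SimpleGraph V) (r : V) : Prop :=
  ∀ ⦃a b⦄, (G \ T).Adj a b → ¬ (T.deleteIncidenceSet r).Reachable a b

lemma Reachable.left_of_separating (h : (T.deleteIncidenceSet r).Reachable a b) (hab : a ≠ b)
    (hx : ¬ (T.deleteIncidenceSet x).Reachable a b) :
    (T.deleteIncidenceSet r).Reachable a x := by
  classical
  obtain ⟨p, -, hr⟩ := h.exists_isPath_notMem_support hab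
  have hxp : x ∈ p.support := by
    by_contra hxp
    exact hx (p.reachable_deleteIncidenceSet hxp)
  exact (p.takeUntil x hxp).reachable_deleteIncidenceSet
    fun h ↦ hr (p.support_takeUntil_subset_support hxp h)

lemma IsAcyclic.not_reachable_deleteIncidenceSet (hT : T.IsAcyclic) (hab : a ≠ b)
    {p : T.Walk a b} (hp : p.IsPath) (hx : x ∈ p.support) :
    ¬ (T.deleteIncidenceSet x).Reachable a b := by
  intro h
  obtain ⟨q, hq, hxq⟩ := h.exists_isPath_notMem_support hab
  have hpq : p = q := congrArg Subtype.val ((hT.subsingleton_path a b).elim ⟨p, hp⟩ ⟨q, hq⟩)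
  exact hxq (hpq ▸ hx)

/-- A Helly property for the fundamental cycles of a spanning tree. -/
theorem exists_onAllFundCycles [Finite V] (hT : T.IsTree)
    (h : ∀ a b c d, (G \ T).Adj a b → (G \ T).Adj c d →
      ∃ x, ¬ (T.deleteIncidenceSet x).Reachable a b ∧ ¬ (T.deleteIncidenceSet x).Reachable c d) :
    ∃ r, OnAllFundCycles G T r := by
  by_contra! hno
  have key : ∀ n : ℕ, ∀ r a b, (G \ T).Adj a b → (T.deleteIncidenceSet r).Reachable a b →
      {z | (T.deleteIncidenceSet r).Reachable a z}.ncard = n → False := by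
    intro n
    induction n using Nat.strong_induction_on with
    | _ n ih =>
    intro r a b hab hr hn
    have har := hr.ne_left_of_deleteIncidenceSet hab.ne
    obtain ⟨p, hp⟩ := (hT.connected r a).exists_isPath
    cases p with
    | nil => exact har rfl
    | @cons _ s _ hrs q =>
      rw [Walk.cons_isPath_iff] at hp
      have hsa := q.reachable_deleteIncidenceSet hp.2
      have hs := hno s
      simp only [OnAllFundCycles, not_forall, not_not] at hs
      obtain ⟨c, d, hcd, hs⟩ := hs
      have hcs := hs.ne_left_of_deleteIncidenceSet hcd.ne
      obtain ⟨x, hxab, hxcd⟩ := h a b c d hab hcd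
      have hax := hr.left_of_separating hab.ne hxab
      have hcx := hs.left_of_separating hcd.ne hxcd
      have hcr : ¬ (T.deleteIncidenceSet s).Reachable c r := by
        intro hcr
        refine hT.isAcyclic.not_reachable_deleteEdges hrs ?_
        refine ((hcr.symm.trans hcx).mono ?_).trans
          ((hsa.trans hax).symm.mono deleteIncidenceSet_le_deleteEdges)
        rw [Sym2.eq_swap]
        exact deleteIncidenceSet_le_deleteEdges
      refine ih _ ?_ s c d hcd hs rfl
      rw [← hn]
      refine Set.ncard_lt_ncard (Set.ssubset_iff_of_subset ?_ |>.2 ⟨s, hsa.symm, ?_⟩)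
      · intro z hz
        have hxz := ((hcx.symm.trans hz).deleteIncidenceSet_of_not_reachable
          fun h ↦ hcr (hcx.trans h))
        exact hax.trans (reachable_deleteIncidenceSet_mono (deleteIncidenceSet_le _ _) hxz)
      · exact fun h ↦ (h.symm.ne_left_of_deleteIncidenceSet hcs.symm) rfl
  have := hT.connected.nonempty
  obtain ⟨r⟩ := this
  have hr := hno r
  simp only [OnAllFundCycles, not_forall, not_not] at hr
  obtain ⟨a, b, hab, hr⟩ := hr
  exact key _ r a b hab hr rfl

/-! ### Exchanging a tree edge with a cotree edge -/

lemma sdiff_exchange_adj (hle : T ≤ G) (hxy : T.Adj x y) (huv : (G \ T).Adj u v) :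
    (G \ (T.deleteEdges {s(x, y)} ⊔ edge u v)).Adj a b ↔
      s(a, b) = s(x, y) ∨ ((G \ T).Adj a b ∧ s(a, b) ≠ s(u, v)) := by
  simp only [sdiff_adj, sup_adj, deleteEdges_adj, Set.mem_singleton_iff, adj_edge] at huv ⊢
  have hT : s(a, b) = s(x, y) → T.Adj a b := fun h ↦ by rwa [← mem_edgeSet, h, mem_edgeSet]
  have hG : T.Adj a b → G.Adj a b := fun h ↦ hle h
  have hTuv : s(u, v) = s(a, b) → ¬ T.Adj a b := fun h ↦ by
    rw [← mem_edgeSet, ← h, mem_edgeSet]; exact huv.2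
  have hne : G.Adj a b → a ≠ b := Adj.ne
  rw [eq_comm (a := s(u, v))] at hTuv ⊢
  tauto

lemma reachable_deleteIncidenceSet_of_deleteEdges
    (hyr : ¬ (T.deleteEdges {s(x, y)}).Reachable y r)
    (h : (T.deleteEdges {s(x, y)}).Reachable y z) : (T.deleteIncidenceSet r).Reachable y z :=
  reachable_deleteIncidenceSet_mono (deleteEdges_le _) (h.deleteIncidenceSet_of_not_reachable hyr)

lemma isTree_exchange (hT : T.IsTree) (hxy : T.Adj x y)
    (hu : (T.deleteEdges {s(x, y)}).Reachable y u)
    (hv : ¬ (T.deleteEdges {s(x, y)}).Reachable y v) (huv : u ≠ v) :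
    (T.deleteEdges {s(x, y)} ⊔ edge u v).IsTree := by
  set H := T.deleteEdges {s(x, y)} with hH
  have hle : H ≤ H ⊔ edge u v := le_sup_left
  have hsplit : ∀ z, H.Reachable y z ∨ H.Reachable x z := by
    intro z
    have h := hT.connected y z
    rw [← deleteEdges_sup_edge hxy] at h
    rcases h.of_sup_edge with h | h | h
    exacts [.inl h, .inl h.2, .inr h.2]
  have hyx : (H ⊔ edge u v).Reachable y x := by
    refine (hu.mono hle).trans (Reachable.trans (Adj.reachable ?_)
      (((hsplit v).resolve_left hv).symm.mono hle))
    exact .inr ((edge_adj ..).2 ⟨.inl ⟨rfl, rfl⟩, huv⟩)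
  have hy : ∀ z, (H ⊔ edge u v).Reachable y z := fun z ↦
    (hsplit z).elim (·.mono hle) fun h ↦ hyx.trans (h.mono hle)
  exact ⟨connected_iff_exists_forall_reachable _ |>.2 ⟨y, hy⟩,
    .sup_edge_of_not_reachable (fun h ↦ hv (hu.trans h)) (hT.isAcyclic.anti (deleteEdges_le _))⟩

/-- Let `S` be the side of the tree edge `xy` that does not contain `r`. Replacing `xy` by a
cotree edge `uv` keeps `r` on all fundamental cycles, if `uv` is the only cotree edge between `S`
and the branch at `r` containing `v`. -/
lemma OnAllFundCycles.exchange (hr : OnAllFundCycles G T r) (hT : T.IsTree)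
    (hle : T ≤ G) (hxy : T.Adj x y) (hyr : ¬ (T.deleteEdges {s(x, y)}).Reachable y r)
    (hu : (T.deleteEdges {s(x, y)}).Reachable y u)
    (hv : ¬ (T.deleteEdges {s(x, y)}).Reachable y v) (hvr : v ≠ r) (huv : (G \ T).Adj u v)
    (huniq : ∀ c d, (G \ T).Adj c d → (T.deleteEdges {s(x, y)}).Reachable y c →
      (T.deleteIncidenceSet r).Reachable v d → s(c, d) = s(u, v)) :
    OnAllFundCycles G (T.deleteEdges {s(x, y)} ⊔ edge u v) r := by
  have hur : u ≠ r := fun h ↦ hyr (h ▸ hu)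
  intro c d hcd hreach
  rw [sdiff_exchange_adj hle hxy huv] at hcd
  have huF := reachable_deleteIncidenceSet_of_deleteEdges hyr hu
  have hmono {a b} (h : ((T.deleteEdges {s(x, y)}).deleteIncidenceSet r).Reachable a b) :
      (T.deleteIncidenceSet r).Reachable a b :=
    reachable_deleteIncidenceSet_mono (deleteEdges_le _) h
  have hmono' {a b} (h : ((T.deleteEdges {s(x, y)}).deleteIncidenceSet r).Reachable a b) :
      (T.deleteEdges {s(x, y)}).Reachable a b := h.mono (deleteIncidenceSet_le _ _)
  have hxy_not : ¬ ((T.deleteEdges {s(x, y)} ⊔ edge u v).deleteIncidenceSet r).Reachable x y := by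
    intro h
    rw [sup_edge_deleteIncidenceSet hur hvr] at h
    rcases h.of_sup_edge with h | h | h
    · exact hT.isAcyclic.not_reachable_deleteEdges hxy (hmono' h)
    · exact hv (hmono' h.2).symm
    · by_cases hxv : x = v
      · subst hxv
        refine hr huv (huF.symm.trans (Adj.reachable ?_))
        exact deleteIncidenceSet_adj.2 ⟨hxy.symm, fun h ↦ hyr (h ▸ .rfl), hvr⟩
      · have hxr := h.1.ne_left_of_deleteIncidenceSet hxv
        refine hr huv (huF.symm.trans (Reachable.trans (Adj.reachable ?_) (hmono h.1)))
        exact deleteIncidenceSet_adj.2 ⟨hxy.symm, fun h ↦ hyr (h ▸ .rfl), hxr⟩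
  rcases hcd with hcd | ⟨hcd, hne⟩
  · rcases Sym2.eq_iff.1 hcd with ⟨rfl, rfl⟩ | ⟨rfl, rfl⟩
    · exact hxy_not hreach
    · exact hxy_not hreach.symm
  · rw [sup_edge_deleteIncidenceSet hur hvr] at hreach
    rcases hreach.of_sup_edge with h | h | h
    · exact hr hcd (hmono h)
    · exact hne (huniq c d hcd (hu.trans (hmono' h.1).symm) (hmono h.2))
    · exact hne (Sym2.eq_swap.trans
        (huniq d c hcd.symm (hu.trans (hmono' h.2)) (hmono h.1).symm))

/-- A cotree edge that is the only one between its two branches at `r` can be exchanged with a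
tree edge at `r`. -/
lemma OnAllFundCycles.exists_exchange_at (hr : OnAllFundCycles G T r) (hT : T.IsTree)
    (hle : T ≤ G) (huv : (G \ T).Adj u v) (hur : u ≠ r) (hvr : v ≠ r)
    (huniq : ∀ c d, (G \ T).Adj c d → (T.deleteIncidenceSet r).Reachable u c →
      (T.deleteIncidenceSet r).Reachable v d → s(c, d) = s(u, v)) :
    ∃ T' b, T'.IsTree ∧ T' ≤ G ∧ OnAllFundCycles G T' r ∧ T.Adj r b ∧ (G \ T').Adj r b ∧
      ∀ c d, (G \ T).Adj c d → s(c, d) ≠ s(u, v) → (G \ T').Adj c d := by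
  obtain ⟨p, hp⟩ := (hT.connected r u).exists_isPath
  cases p with
  | nil => exact absurd rfl hur
  | @cons _ b _ hrb q =>
    rw [Walk.cons_isPath_iff] at hp
    have hbu := q.reachable_deleteIncidenceSet hp.2
    have hbr : ¬ (T.deleteEdges {s(r, b)}).Reachable b r :=
      fun h ↦ hT.isAcyclic.not_reachable_deleteEdges hrb h.symm
    have hF {z} := reachable_deleteIncidenceSet_of_deleteEdges (z := z) hbr
    have hu := hbu.mono (deleteIncidenceSet_le_deleteEdges (x := b))
    have hv : ¬ (T.deleteEdges {s(r, b)}).Reachable b v :=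
      fun h ↦ hr huv (hbu.symm.trans (hF h))
    refine ⟨T.deleteEdges {s(r, b)} ⊔ edge u v, b, isTree_exchange hT hrb hu hv huv.ne,
      sup_le ((deleteEdges_le _).trans hle) ((edge_le_iff _).2 (.inr huv.1)),
      hr.exchange hT hle hrb hbr hu hv hvr huv
        fun c d hcd hc hd ↦ huniq c d hcd (hbu.symm.trans (hF hc)) hd,
      hrb, (sdiff_exchange_adj hle hrb huv).2 (.inl rfl),
      fun c d hcd hne ↦ (sdiff_exchange_adj hle hrb huv).2 (.inr ⟨hcd, hne⟩)⟩

/-- Some two distinct edges of `D` share a vertex. -/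
def HasIncidentEdges (D : SimpleGraph V) : Prop :=
  ∃ w a b, a ≠ b ∧ D.Adj w a ∧ D.Adj w b

lemma eq_of_not_hasIncidentEdges {D : SimpleGraph V} (hD : ¬ D.HasIncidentEdges) {w : V}
    (ha : D.Adj w a) (hb : D.Adj w b) : a = b := by
  by_contra hab
  exact hD ⟨w, a, b, hab, ha, hb⟩

lemma IsTree.dist_lt_dist_of_reachable (hT : T.IsTree)
    (hyr : ¬ (T.deleteEdges {s(x, y)}).Reachable y r)
    (h : (T.deleteEdges {s(x, y)}).Reachable y z) (hzy : z ≠ y) : T.dist r y < T.dist r z := by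
  classical
  obtain ⟨p, hp⟩ := hT.connected.exists_walk_length_eq_dist r z
  have hy : y ∈ p.support := by
    by_contra hy
    refine hyr (h.trans ((p.reachable_deleteIncidenceSet hy).symm.mono ?_))
    rw [Sym2.eq_swap]
    exact deleteIncidenceSet_le_deleteEdges
  rw [← hp]
  exact (dist_le _).trans_lt (p.length_takeUntil_lt_length hy hzy.symm)

/-- If two cotree edges join the same two branches at `r`, then exchanges lead to a tree with two
incident cotree edges. -/
lemma OnAllFundCycles.exists_hasIncidentEdges_of_parallel [Finite V]
    (hr : OnAllFundCycles G T r) (hT : T.IsTree) (hle : T ≤ G) {u' v' : V}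
    (huv : (G \ T).Adj u v) (huv' : (G \ T).Adj u' v') (hne : s(u, v) ≠ s(u', v'))
    (hu : (T.deleteIncidenceSet r).Reachable u u')
    (hv : (T.deleteIncidenceSet r).Reachable v v') :
    ∃ T', T'.IsTree ∧ T' ≤ G ∧ OnAllFundCycles G T' r ∧ (G \ T').HasIncidentEdges := by
  induction hn : {z | (T.deleteIncidenceSet r).Reachable u z}.ncard
    using Nat.strong_induction_on generalizing T u v u' v' with
  | _ n ih =>
  by_cases hI : (G \ T).HasIncidentEdges
  · exact ⟨T, hT, hle, hr, hI⟩
  have huu' : u ≠ u' := by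
    rintro rfl
    exact hne (by rw [eq_of_not_hasIncidentEdges hI huv huv'])
  have hv_ne : v ≠ v' := by
    rintro rfl
    exact hne (by rw [eq_of_not_hasIncidentEdges hI huv.symm huv'.symm])
  have hvr := hv.ne_left_of_deleteIncidenceSet hv_ne
  -- an end farthest from `r` among the cotree edges between the two branches
  obtain ⟨y, ⟨huy, v₀, hv₀, hyv₀⟩, hmax⟩ := Set.exists_max_image
    {y | (T.deleteIncidenceSet r).Reachable u y ∧
      ∃ w, (T.deleteIncidenceSet r).Reachable v w ∧ (G \ T).Adj y w} (T.dist r)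
    (Set.toFinite _) ⟨u, .rfl, v, .rfl, huv⟩
  obtain ⟨y₂, v₂, hy₂, huy₂, hv₂, hyv₂⟩ : ∃ y₂ v₂, y₂ ≠ y ∧
      (T.deleteIncidenceSet r).Reachable u y₂ ∧ (T.deleteIncidenceSet r).Reachable v v₂ ∧
      (G \ T).Adj y₂ v₂ := by
    by_cases hyu : u = y
    · exact ⟨u', v', hyu ▸ huu'.symm, hu, hv, huv'⟩
    · exact ⟨u, v, hyu, .rfl, .rfl, huv⟩
  have hyr : y ≠ r := (huy.symm.trans huy₂).ne_left_of_deleteIncidenceSet hy₂.symm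
  have hv₀r : v₀ ≠ r := by
    rintro rfl
    exact hv₀.symm.ne_left_of_deleteIncidenceSet hvr.symm rfl
  have hyv : ¬ (T.deleteIncidenceSet r).Reachable y v :=
    fun h ↦ hr hyv₀ (h.trans hv₀)
  obtain ⟨x, hxy, hxr⟩ := hT.connected.exists_adj_reachable_deleteIncidenceSet hyr
  have hnxy := hT.isAcyclic.not_reachable_deleteEdges hxy
  have hS : ¬ (T.deleteEdges {s(x, y)}).Reachable y r := by
    refine fun h ↦ hnxy (Reachable.trans (hxr.mono ?_) h.symm)
    rw [Sym2.eq_swap]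
    exact deleteIncidenceSet_le_deleteEdges
  have hF {z} := reachable_deleteIncidenceSet_of_deleteEdges (z := z) hS
  have hfar : ∀ c d, (G \ T).Adj c d → (T.deleteEdges {s(x, y)}).Reachable y c →
      (T.deleteIncidenceSet r).Reachable v d → c = y := by
    intro c d hcd hc hd
    by_contra hcy
    exact (hT.dist_lt_dist_of_reachable hS hc hcy).not_ge
      (hmax c ⟨huy.trans (hF hc), d, hd, hcd⟩)
  have hv₀S : ¬ (T.deleteEdges {s(x, y)}).Reachable y v₀ := fun h ↦ hr hyv₀ (hF h)
  have hy₂S : ¬ (T.deleteEdges {s(x, y)}).Reachable y y₂ :=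
    fun h ↦ hy₂ (hfar y₂ v₂ hyv₂ h hv₂)
  have hxr' : x ≠ r := by
    rintro rfl
    refine hy₂S ((huy.symm.trans huy₂).mono deleteIncidenceSet_le_deleteEdges)
  have hsplit {c d} (h : (T.deleteIncidenceSet r).Reachable c d) :
      (((T.deleteEdges {s(x, y)}).deleteIncidenceSet r) ⊔ edge x y).Reachable c d := by
    rwa [← sup_edge_deleteIncidenceSet hxr' hyr, deleteEdges_sup_edge hxy]
  have hmono {a b} (h : ((T.deleteEdges {s(x, y)}).deleteIncidenceSet r).Reachable a b) :
      (T.deleteIncidenceSet r).Reachable a b :=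
    reachable_deleteIncidenceSet_mono (deleteEdges_le _) h
  have hmono' {a b} (h : ((T.deleteEdges {s(x, y)}).deleteIncidenceSet r).Reachable a b) :
      (T.deleteEdges {s(x, y)}).Reachable a b := h.mono (deleteIncidenceSet_le _ _)
  have hFxy : (T.deleteIncidenceSet r).Reachable x y :=
    Adj.reachable (deleteIncidenceSet_adj.2 ⟨hxy, hxr', hyr⟩)
  have hsup : ((T.deleteEdges {s(x, y)} ⊔ edge y v₀).deleteIncidenceSet r) =
      (T.deleteEdges {s(x, y)}).deleteIncidenceSet r ⊔ edge y v₀ :=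
    sup_edge_deleteIncidenceSet hyr hv₀r
  have hadj {c d} := sdiff_exchange_adj (a := c) (b := d) hle hxy hyv₀
  have hyv₂_ne : s(y₂, v₂) ≠ s(y, v₀) := by
    intro h
    rcases Sym2.eq_iff.1 h with h | h
    · exact hy₂ h.1
    · exact hyv (h.2 ▸ hv₂.symm)
  refine ih _ ?_ (hr.exchange hT hle hxy hS .rfl hv₀S hv₀r hyv₀ ?_)
    (isTree_exchange hT hxy .rfl hv₀S hyv₀.ne)
    (sup_le ((deleteEdges_le _).trans hle) ((edge_le_iff _).2 (.inr hyv₀.1)))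
    (hadj.2 (.inl rfl)) (hadj.2 (.inr ⟨hyv₂, hyv₂_ne⟩)) ?_ ?_ ?_ rfl
  · rw [← hn, hsup]
    refine Set.ncard_lt_ncard ((Set.ssubset_iff_of_subset fun z hz ↦ ?_).2 ⟨y, huy, fun h ↦ ?_⟩)
    · rcases Reachable.of_sup_edge hz with h | h | h
      · exact huy.trans (hFxy.symm.trans (hmono h))
      · exact absurd (hmono' h.1) hnxy
      · exact absurd (hFxy.symm.trans (hmono h.1)) (hr hyv₀)
    · rcases Reachable.of_sup_edge h with h | h | h
      · exact hnxy (hmono' h)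
      · exact hnxy (hmono' h.1)
      · exact hr hyv₀ (hFxy.symm.trans (hmono h.1))
  · intro c d hcd hc hd
    obtain rfl := hfar c d hcd hc (hv₀.trans hd)
    rw [eq_of_not_hasIncidentEdges hI hcd hyv₀]
  · intro h
    rw [← mem_edgeSet, ← h] at hyv₂
    exact hyv₂.2 hxy
  · rw [hsup]
    rcases (hsplit (huy.symm.trans huy₂)).of_sup_edge with h | h | h
    · exact absurd (hmono' h) hy₂S
    · exact absurd (hmono' h.1).symm hnxy
    · exact h.2.mono le_sup_left
  · rw [hsup]
    refine Reachable.trans (Adj.reachable (.inr ((edge_adj ..).2 ⟨.inl ⟨rfl, rfl⟩, hyv₀.ne⟩))) ?_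
    rcases (hsplit (hv₀.symm.trans hv₂)).of_sup_edge with h | h | h
    · exact h.mono le_sup_left
    · exact absurd ((hmono h.2).trans hv₂.symm) hyv
    · exact absurd ((hmono h.1).symm.trans hv₀.symm) hyv

lemma OnAllFundCycles.exists_hasIncidentEdges_of_adj [Finite V]
    (hr : OnAllFundCycles G T r) (hT : T.IsTree) (hle : T ≤ G) {w : V}
    (hw : (G \ T).Adj r w) (huv : (G \ T).Adj u v) (hne : s(u, v) ≠ s(r, w)) :
    ∃ T', T'.IsTree ∧ T' ≤ G ∧ OnAllFundCycles G T' r ∧ (G \ T').HasIncidentEdges := by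
  by_cases hI : (G \ T).HasIncidentEdges
  · exact ⟨T, hT, hle, hr, hI⟩
  have hur : u ≠ r := by
    rintro rfl
    exact hne (by rw [eq_of_not_hasIncidentEdges hI hw huv])
  have hvr : v ≠ r := by
    rintro rfl
    exact hne (by rw [eq_of_not_hasIncidentEdges hI hw huv.symm, Sym2.eq_swap])
  by_cases hP : ∀ c d, (G \ T).Adj c d → (T.deleteIncidenceSet r).Reachable u c →
      (T.deleteIncidenceSet r).Reachable v d → s(c, d) = s(u, v)
  · obtain ⟨T', b, hT', hle', hr', hb, hb', hpres⟩ :=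
      hr.exists_exchange_at hT hle huv hur hvr hP
    refine ⟨T', hT', hle', hr', r, b, w, ?_, hb', hpres _ _ hw hne.symm⟩
    rintro rfl
    exact hw.2 hb
  · push Not at hP
    obtain ⟨c, d, hcd, hc, hd, hne'⟩ := hP
    exact hr.exists_hasIncidentEdges_of_parallel hT hle huv hcd hne'.symm hc hd

/-- If all fundamental cycles of a spanning tree contain `r` and there are at least two of them,
then there is a spanning tree with the same property and with two incident cotree edges. -/
lemma OnAllFundCycles.exists_hasIncidentEdges [Finite V]
    (hr : OnAllFundCycles G T r) (hT : T.IsTree) (hle : T ≤ G)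
    (hab : (G \ T).Adj a b) (huv : (G \ T).Adj u v) (hne : s(a, b) ≠ s(u, v)) :
    ∃ T', T'.IsTree ∧ T' ≤ G ∧ OnAllFundCycles G T' r ∧ (G \ T').HasIncidentEdges := by
  by_cases hur : u = r
  · subst hur
    exact hr.exists_hasIncidentEdges_of_adj hT hle huv hab hne
  by_cases hvr : v = r
  · subst hvr
    exact hr.exists_hasIncidentEdges_of_adj hT hle huv.symm hab (by rwa [Sym2.eq_swap (a := v)])
  by_cases hP : ∀ c d, (G \ T).Adj c d → (T.deleteIncidenceSet r).Reachable u c →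
      (T.deleteIncidenceSet r).Reachable v d → s(c, d) = s(u, v)
  · obtain ⟨T', w, hT', hle', hr', hw, hw', hpres⟩ :=
      hr.exists_exchange_at hT hle huv hur hvr hP
    refine hr'.exists_hasIncidentEdges_of_adj hT' hle' hw' (hpres _ _ hab hne) fun h ↦ ?_
    rw [← mem_edgeSet, h] at hab
    exact hab.2 hw
  · push Not at hP
    obtain ⟨c, d, hcd, hc, hd, hne'⟩ := hP
    exact hr.exists_hasIncidentEdges_of_parallel hT hle huv hcd hne'.symm hc hd

/-! ### Pairing up the cotree edges -/

/-- All elements of `S`, except for at most one, can be grouped into pairs of edges sharing a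
vertex. -/
inductive PairedUp : Set (Sym2 V) → Prop
  | empty : PairedUp ∅
  | singleton (e : Sym2 V) : PairedUp {e}
  | insert_insert {S : Set (Sym2 V)} {e f : Sym2 V} {w : V} (hS : PairedUp S) (he : e ∉ S)
      (hf : f ∉ S) (hef : e ≠ f) (hwe : w ∈ e) (hwf : w ∈ f) : PairedUp (insert e (insert f S))

theorem OnAllFundCycles.exists_pairedUp [Finite V] (hr : OnAllFundCycles G T r) (hT : T.IsTree)
    (hle : T ≤ G) : ∃ T', T'.IsTree ∧ T' ≤ G ∧ PairedUp (G.edgeSet \ T'.edgeSet) := by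
  induction hn : G.edgeSet.ncard using Nat.strong_induction_on generalizing G T with
  | _ n ih =>
  by_cases hsub : (G.edgeSet \ T.edgeSet).Subsingleton
  · refine ⟨T, hT, hle, ?_⟩
    rcases hsub.eq_empty_or_singleton with h | ⟨e, h⟩ <;> rw [h]
    exacts [.empty, .singleton e]
  · rw [← edgeSet_sdiff, Set.not_subsingleton_iff] at hsub
    obtain ⟨⟨a, b⟩, hab, ⟨c, d⟩, hcd, hne⟩ := hsub
    obtain ⟨T₁, hT₁, hle₁, hr₁, w, x, y, hxy, hwx, hwy⟩ :=
      hr.exists_hasIncidentEdges hT hle hab hcd hne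
    have hle₁' : T₁ ≤ G.deleteEdges {s(w, x), s(w, y)} := by
      intro p q hpq
      refine deleteEdges_adj.2 ⟨hle₁ hpq, ?_⟩
      rintro (h | h)
      · exact hwx.2 (by rwa [← mem_edgeSet, ← h])
      · exact hwy.2 (by rwa [← mem_edgeSet, ← Set.mem_singleton_iff.1 h])
    obtain ⟨T', hT', hle', hpair⟩ := ih _ (by
      rw [← hn, edgeSet_deleteEdges]
      exact Set.ncard_lt_ncard ⟨Set.sdiff_subset, fun h ↦ (h hwx.1).2 (.inl rfl)⟩)
      (fun p q hpq ↦ hr₁ ⟨deleteEdges_le _ hpq.1, hpq.2⟩) hT₁ hle₁' rfl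
    refine ⟨T', hT', hle'.trans (deleteEdges_le _), ?_⟩
    have hS : G.edgeSet \ T'.edgeSet = insert s(w, x) (insert s(w, y)
        ((G.deleteEdges {s(w, x), s(w, y)}).edgeSet \ T'.edgeSet)) := by
      have hT'x : s(w, x) ∉ T'.edgeSet := fun h ↦ (deleteEdges_adj.1 (hle' h)).2 (.inl rfl)
      have hT'y : s(w, y) ∉ T'.edgeSet := fun h ↦ (deleteEdges_adj.1 (hle' h)).2 (.inr rfl)
      have hGx : s(w, x) ∈ G.edgeSet := hwx.1
      have hGy : s(w, y) ∈ G.edgeSet := hwy.1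
      rw [edgeSet_deleteEdges]
      grind
    rw [hS]
    refine hpair.insert_insert (w := w) ?_ ?_ ?_ (Sym2.mem_mk_left _ _) (Sym2.mem_mk_left _ _)
    · rw [edgeSet_deleteEdges]; grind
    · rw [edgeSet_deleteEdges]; grind
    · exact fun h ↦ hxy (Sym2.congr_right.1 h)

lemma PairedUp.subsingleton_odd [Finite V] {ι : Type*} {S : Set (Sym2 V)} (hS : PairedUp S)
    (P : ι → Set (Sym2 V))
    (hdisj : ∀ e ∈ S, ∀ i j, e ∈ P i → e ∈ P j → i = j)
    (hinc : ∀ e ∈ S, ∀ f ∈ S, ∀ w, w ∈ e → w ∈ f → ∀ i, e ∈ P i → f ∈ P i) :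
    {i | Odd (S ∩ P i).ncard}.Subsingleton := by
  induction hS with
  | empty => intro i hi; simp at hi
  | singleton e =>
    have h : ∀ i, Odd (({e} : Set (Sym2 V)) ∩ P i).ncard → e ∈ P i := by
      intro i hi
      by_contra he
      rw [Set.singleton_inter_eq_empty.2 he, Set.ncard_empty] at hi
      exact absurd hi (by decide)
    exact fun i hi j hj ↦ hdisj e rfl i j (h i hi) (h j hj)
  | @insert_insert S e f w hS he hf hef hwe hwf ih =>
    have h : ∀ i, Odd (insert e (insert f S) ∩ P i).ncard → Odd (S ∩ P i).ncard := by
      intro i hi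
      have heS : e ∈ insert e (insert f S) := .inl rfl
      have hfS : f ∈ insert e (insert f S) := .inr (.inl rfl)
      by_cases hei : e ∈ P i
      · have hfi := hinc e heS f hfS w hwe hwf i hei
        rw [Set.insert_inter_of_mem hei, Set.insert_inter_of_mem hfi,
          Set.ncard_insert_of_notMem (by grind), Set.ncard_insert_of_notMem (by grind)] at hi
        grind
      · have hfi : f ∉ P i := fun hfi ↦ hei (hinc f hfS e heS w hwf hwe i hfi)
        rwa [Set.insert_inter_of_notMem hei, Set.insert_inter_of_notMem hfi] at hi
    refine (ih ?_ ?_).anti h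
    · exact fun e he ↦ hdisj e (.inr (.inr he))
    · exact fun e he f hf ↦ hinc e (.inr (.inr he)) f (.inr (.inr hf))

lemma PairedUp.oddComps_le_one [Finite V] {D : SimpleGraph V} (hD : PairedUp D.edgeSet) :
    oddComps D ≤ 1 := by
  have h : ({c : D.ConnectedComponent | Odd (compEdgeCount D c)}).Subsingleton := by
    refine hD.subsingleton_odd (fun c ↦ {e | ∀ v ∈ e, D.connectedComponentMk v = c}) ?_ ?_
    · rintro ⟨a, b⟩ - i j hi hj
      exact (hi a (Sym2.mem_mk_left _ _)).symm.trans (hj a (Sym2.mem_mk_left _ _))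
    · rintro e - ⟨a, b⟩ hab w hwe hwf c he
      have hw := he w hwe
      have hadj : D.connectedComponentMk a = D.connectedComponentMk b :=
        ConnectedComponent.eq.2 (Adj.reachable hab)
      change ∀ v ∈ s(a, b), _
      change w ∈ s(a, b) at hwf
      simp only [Sym2.mem_iff] at hwf ⊢
      grind
  exact Set.ncard_le_one_iff_subsingleton.2 h

end SimpleGraph

lemma FundCyclesMeet.exists_separating {V : Type*} {T : SimpleGraph V} (hT : T.IsAcyclic)
    {a b c d : V} (hab : a ≠ b) (hcd : c ≠ d) (h : FundCyclesMeet T s(a, b) s(c, d)) :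
    ∃ x, ¬ (T.deleteIncidenceSet x).Reachable a b ∧ ¬ (T.deleteIncidenceSet x).Reachable c d := by
  obtain ⟨u₁, v₁, u₂, v₂, h₁, h₂, p, q, hp, hq, x, hxp, hxq⟩ := h
  refine ⟨x, ?_, ?_⟩
  · rcases Sym2.eq_iff.1 h₁ with ⟨rfl, rfl⟩ | ⟨rfl, rfl⟩
    · exact hT.not_reachable_deleteIncidenceSet hab hp hxp
    · exact fun h ↦ hT.not_reachable_deleteIncidenceSet hab.symm hp hxp h.symm
  · rcases Sym2.eq_iff.1 h₂ with ⟨rfl, rfl⟩ | ⟨rfl, rfl⟩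
    · exact hT.not_reachable_deleteIncidenceSet hcd hq hxq
    · exact fun h ↦ hT.not_reachable_deleteIncidenceSet hcd.symm hq hxq h.symm

/-- If a connected graph `G` has a spanning tree `T` such that any two
distinct fundamental cycles share a vertex, then `ξ(G) ≤ 1`, i.e. `G` is upper-embeddable. -/
theorem upper_embeddable_of_pairwise_meeting_fundamental_cycles {V : Type*} [Finite V]
    (G T : SimpleGraph V) (hG : G.Connected) (hT : IsSpanningTree G T)
    (h : ∀ e ∈ G.edgeSet \ T.edgeSet, ∀ f ∈ G.edgeSet \ T.edgeSet,
      e ≠ f → FundCyclesMeet T e f) :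
    xi G ≤ 1 := by
  obtain ⟨hle, hT⟩ := hT
  obtain ⟨r, hr⟩ : ∃ r, OnAllFundCycles G T r := by
    refine exists_onAllFundCycles hT fun a b c d hab hcd ↦ ?_
    by_cases hne : s(a, b) = s(c, d)
    · have hx : ¬ (T.deleteIncidenceSet a).Reachable a b :=
        fun h ↦ h.ne_left_of_deleteIncidenceSet hab.ne rfl
      rcases Sym2.eq_iff.1 hne with ⟨rfl, rfl⟩ | ⟨rfl, rfl⟩
      exacts [⟨a, hx, hx⟩, ⟨a, hx, fun h ↦ hx h.symm⟩]
    · exact (h _ hab _ hcd hne).exists_separating hT.isAcyclic hab.ne hcd.ne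
  obtain ⟨T', hT', hle', hpair⟩ := hr.exists_pairedUp hT hle
  have hxi : xi G ≤ xiT G T' := Nat.sInf_le ⟨T', ⟨hle', hT'⟩, rfl⟩
  refine hxi.trans (PairedUp.oddComps_le_one ?_)
  rwa [← edgeSet_sdiff, fromEdgeSet_edgeSet, edgeSet_sdiff]
end

section
/- Let G be a finite connected simple graph and let A ⊆ E(G) be an edge-cut of G such that G − A has exactly two connected components G₁ and G₂. If ξ(G₁) ≤ 1 and ξ(G₂) ≤ 1 (i.e., both G₁ and G₂ are upper-embeddable), then β(G) − ξ(G) ≥ 2(⌊β(G)/2⌋ − 1); equivalently, by Xuong's theorem, γ_M(G) ≥ ⌊β(G)/2⌋ − 1. -/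
open SimpleGraph

/-- A set of edges that splits into disjoint pairs of distinct edges sharing a vertex. -/
inductive Pairable {V : Type*} : Set (Sym2 V) → Prop
  | empty : Pairable ∅
  | insert_pair {e f : Sym2 V} {X : Set (Sym2 V)} {v : V} (he : v ∈ e) (hf : v ∈ f)
      (hne : e ≠ f) (heX : e ∉ X) (hfX : f ∉ X) (hX : Pairable X) :
      Pairable (insert e (insert f X))

namespace Pairable

variable {V : Type*} {X Y : Set (Sym2 V)}

theorem finite (hX : Pairable X) : X.Finite := by
  induction hX with
  | empty => exact Set.finite_empty
  | insert_pair _ _ _ _ _ _ ih => exact (ih.insert _).insert _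

theorem ncard_insert_pair (hX : Pairable X) {e f : Sym2 V} (hne : e ≠ f) (heX : e ∉ X)
    (hfX : f ∉ X) : (insert e (insert f X)).ncard = X.ncard + 2 := by
  rw [Set.ncard_insert_of_notMem (by simp [hne, heX]) (hX.finite.insert _),
    Set.ncard_insert_of_notMem hfX hX.finite]

theorem union (hX : Pairable X) (hY : Pairable Y) (hd : Disjoint X Y) : Pairable (X ∪ Y) := by
  induction hX with
  | empty => simpa using hY
  | @insert_pair e f X v he hf hne heX hfX hX ih =>
    simp only [Set.disjoint_insert_left] at hd
    rw [Set.insert_union, Set.insert_union]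
    exact insert_pair he hf hne (by simp [heX, hd.1]) (by simp [hfX, hd.2.1]) (ih hd.2.2)

theorem image {W : Type*} (hX : Pairable X) {φ : V → W} (hφ : Function.Injective φ) :
    Pairable (Sym2.map φ '' X) := by
  induction hX with
  | empty => simpa using empty
  | @insert_pair e f X v he hf hne heX hfX hX ih =>
    have hinj := Sym2.map.injective hφ
    rw [Set.image_insert_eq, Set.image_insert_eq]
    exact insert_pair (Sym2.mem_map.2 ⟨v, he, rfl⟩) (Sym2.mem_map.2 ⟨v, hf, rfl⟩)
      (hinj.ne hne) (by rwa [hinj.mem_set_image]) (by rwa [hinj.mem_set_image]) ih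

/-- A predicate that does not separate adjacent edges holds for an even number of edges. -/
theorem even_ncard_sep (hX : Pairable X) (p : Sym2 V → Prop)
    (hp : ∀ e ∈ X, ∀ f ∈ X, ∀ v, v ∈ e → v ∈ f → p e → p f) :
    Even {e ∈ X | p e}.ncard := by
  induction hX with
  | empty => simp
  | @insert_pair e f X v he hf hne heX hfX hX ih =>
    specialize ih fun a ha b hb => hp a (by simp [ha]) b (by simp [hb])
    have hef := hp e (by simp) f (by simp) v he hf
    have hfe := hp f (by simp) e (by simp) v hf he
    by_cases hpe : p e
    · have : {a ∈ insert e (insert f X) | p a} = insert e (insert f {a ∈ X | p a}) := by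
        ext a
        simp only [Set.mem_ofPred_eq, Set.mem_insert_iff]
        have := hef hpe
        constructor
        · tauto
        · rintro (rfl | rfl | h) <;> tauto
      have hfin : {a ∈ X | p a}.Finite := hX.finite.subset (Set.sep_subset _ _)
      rw [this, Set.ncard_insert_of_notMem (by simp [hne, heX]) (hfin.insert _),
        Set.ncard_insert_of_notMem (by simp [hfX]) hfin]
      exact ih.add (by decide : Even 2)
    · have : {a ∈ insert e (insert f X) | p a} = {a ∈ X | p a} := by
        ext a
        simp only [Set.mem_ofPred_eq, Set.mem_insert_iff]
        constructor
        · rintro ⟨rfl | rfl | h, h'⟩ <;> tauto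
        · tauto
      rwa [this]

theorem even_ncard (hX : Pairable X) : Even X.ncard := by
  simpa using hX.even_ncard_sep (fun _ => True) (by simp)

theorem exists_partner (hX : Pairable X) {h : Sym2 V} (hh : h ∈ X) :
    ∃ k ∈ X, k ≠ h ∧ (∃ v ∈ h, v ∈ k) ∧ Pairable (X \ {h, k}) := by
  induction hX with
  | empty => simp at hh
  | @insert_pair e f X v he hf hne heX hfX hX ih =>
    rcases hh with rfl | rfl | hh
    · refine ⟨f, by simp, hne.symm, ⟨v, he, hf⟩, ?_⟩
      convert hX using 1
      ext a
      simp only [Set.mem_sdiff, Set.mem_insert_iff, Set.mem_singleton_iff]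
      constructor
      · tauto
      · intro ha
        refine ⟨by tauto, ?_⟩
        rintro (rfl | rfl) <;> tauto
    · refine ⟨e, by simp, hne, ⟨v, hf, he⟩, ?_⟩
      convert hX using 1
      ext a
      simp only [Set.mem_sdiff, Set.mem_insert_iff, Set.mem_singleton_iff]
      constructor
      · tauto
      · intro ha
        refine ⟨by tauto, ?_⟩
        rintro (rfl | rfl) <;> tauto
    · obtain ⟨k, hk, hkh, hv, hP⟩ := ih hh
      refine ⟨k, by simp [hk], hkh, hv, ?_⟩
      have := insert_pair he hf hne (fun h => heX h.1) (fun h => hfX h.1) hP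
      convert this using 1
      ext a
      simp only [Set.mem_sdiff, Set.mem_insert_iff, Set.mem_singleton_iff]
      constructor
      · tauto
      · rintro (rfl | rfl | ha)
        · refine ⟨by tauto, ?_⟩
          rintro (rfl | rfl) <;> tauto
        · refine ⟨by tauto, ?_⟩
          rintro (rfl | rfl) <;> tauto
        · tauto

end Pairable

/-- In a pairable edge set of maximum size, two unpaired edges cannot be joined by a walk. -/
theorem not_reachable_of_maximal_pairable {V : Type*} {D : SimpleGraph V} {b c : V}
    (w : D.Walk b c) {X : Set (Sym2 V)} {n : ℕ} (hX : Pairable X) (hXD : X ⊆ D.edgeSet)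
    (hn : X.ncard = n) (hmax : ∀ Y, Pairable Y → Y ⊆ D.edgeSet → Y.ncard ≤ n)
    {e f : Sym2 V} (he : e ∈ D.edgeSet) (heX : e ∉ X) (hf : f ∈ D.edgeSet) (hfX : f ∉ X)
    (hne : e ≠ f) (hb : b ∈ e) (hc : c ∈ f) : False := by
  have key : ∀ {X : Set (Sym2 V)} {e f : Sym2 V} {v : V}, Pairable X → X ⊆ D.edgeSet →
      X.ncard = n → e ∈ D.edgeSet → e ∉ X → f ∈ D.edgeSet → f ∉ X → e ≠ f → v ∈ e → v ∈ f →
      False := by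
    intro X e f v hX hXD hn he heX hf hfX hne hve hvf
    have h1 := hmax _ (.insert_pair hve hvf hne heX hfX hX)
      (Set.insert_subset he (Set.insert_subset hf hXD))
    have h2 := hX.ncard_insert_pair hne heX hfX
    omega
  induction w generalizing X e with
  | nil => exact key hX hXD hn he heX hf hfX hne hb hc
  | @cons b d c hbd w ih =>
    set h : Sym2 V := s(b, d) with hh
    have hhD : h ∈ D.edgeSet := hbd
    have hbh : b ∈ h := by simp [hh]
    have hdh : d ∈ h := by simp [hh]
    by_cases hhe : h = e
    · exact ih hX hXD hn he heX hfX hne (hhe ▸ hdh) hc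
    by_cases hhX : h ∈ X
    swap
    · exact key hX hXD hn he heX hhD hhX (Ne.symm hhe) hb hbh
    obtain ⟨k, hkX, hkh, ⟨v, hvh, hvk⟩, hP⟩ := hX.exists_partner hhX
    have hke : k ≠ e := fun h => heX (h ▸ hkX)
    have hkf : k ≠ f := fun h => hfX (h ▸ hkX)
    have hhf : h ≠ f := fun h => hfX (h ▸ hhX)
    have hXeq : X = insert h (insert k (X \ {h, k})) := by
      ext a
      simp only [Set.mem_sdiff, Set.mem_insert_iff, Set.mem_singleton_iff]
      by_cases a = h <;> by_cases a = k <;> simp_all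
    have hcard := hP.ncard_insert_pair hkh.symm (by simp) (by simp)
    rw [← hXeq, hn] at hcard
    have hsub : X \ {h, k} ⊆ D.edgeSet := Set.sdiff_subset.trans hXD
    rcases Sym2.mem_iff.1 hvh with rfl | rfl
    · refine ih (X := insert e (insert k (X \ {h, k}))) (e := h)
        (.insert_pair hb hvk hke.symm (by simp [heX]) (by simp) hP)
        (Set.insert_subset he (Set.insert_subset (hXD hkX) hsub)) ?_ hhD ?_ ?_ hhf hdh hc
      · rw [hP.ncard_insert_pair hke.symm (by simp [heX]) (by simp), hcard]
      · simp [hhe, hkh.symm]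
      · simp [hne.symm, hkf.symm, hfX]
    · refine ih (X := insert e (insert h (X \ {h, k}))) (e := k)
        (.insert_pair hb hbh (Ne.symm hhe) (by simp [heX]) (by simp) hP)
        (Set.insert_subset he (Set.insert_subset hhD hsub)) ?_ (hXD hkX) ?_ ?_ hkf hvk hc
      · rw [hP.ncard_insert_pair (Ne.symm hhe) (by simp [heX]) (by simp), hcard]
      · simp [hkh, hke]
      · simp [hne.symm, hhf.symm, hfX]

theorem connectedComponentMk_eq_of_mem_edge {V : Type*} {D : SimpleGraph V} {e : Sym2 V}
    (he : e ∈ D.edgeSet) {u v : V} (hu : u ∈ e) (hv : v ∈ e) :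
    D.connectedComponentMk u = D.connectedComponentMk v := by
  by_cases h : u = v
  · rw [h]
  · rw [(Sym2.mem_and_mem_iff h).1 ⟨hu, hv⟩] at he
    exact ConnectedComponent.sound (Adj.reachable he)

theorem compEdgeCount_eq_add {V : Type*} [Finite V] {D : SimpleGraph V} {X : Set (Sym2 V)}
    (hXD : X ⊆ D.edgeSet) (c : D.ConnectedComponent) :
    compEdgeCount D c = {e ∈ X | ∀ v ∈ e, D.connectedComponentMk v = c}.ncard +
      {e ∈ D.edgeSet \ X | ∀ v ∈ e, D.connectedComponentMk v = c}.ncard := by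
  rw [compEdgeCount, ← Set.ncard_union_eq]
  · congr 1
    ext e
    have := @hXD e
    simp only [Set.mem_ofPred_eq, Set.mem_union, Set.mem_sdiff]
    tauto
  · rw [Set.disjoint_left]
    rintro e ⟨h, -⟩ ⟨⟨-, h'⟩, -⟩
    exact h' h

theorem Pairable.even_ncard_component {V : Type*} {D : SimpleGraph V} {X : Set (Sym2 V)}
    (hX : Pairable X) (hXD : X ⊆ D.edgeSet) (c : D.ConnectedComponent) :
    Even {e ∈ X | ∀ v ∈ e, D.connectedComponentMk v = c}.ncard :=
  hX.even_ncard_sep _ fun _ _ _ hf v hve hvf h _ hu =>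
    (connectedComponentMk_eq_of_mem_edge (hXD hf) hu hvf).trans (h v hve)

theorem oddComps_le_ncard_unpaired {V : Type*} [Finite V] {D : SimpleGraph V} {X : Set (Sym2 V)}
    (hX : Pairable X) (hXD : X ⊆ D.edgeSet) : oddComps D ≤ (D.edgeSet \ X).ncard := by
  have hex : ∀ c : D.ConnectedComponent, ∃ e : Sym2 V, Odd (compEdgeCount D c) →
      e ∈ D.edgeSet \ X ∧ ∀ v ∈ e, D.connectedComponentMk v = c := by
    intro c
    by_cases hc : Odd (compEdgeCount D c)
    · rw [compEdgeCount_eq_add hXD] at hc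
      have h := hX.even_ncard_component hXD c
      obtain ⟨e, he⟩ : {e ∈ D.edgeSet \ X | ∀ v ∈ e, D.connectedComponentMk v = c}.Nonempty := by
        by_contra hne
        rw [Set.not_nonempty_iff_eq_empty.1 hne] at hc
        simp only [Set.ncard_empty, add_zero] at hc
        exact Nat.not_even_iff_odd.2 hc h
      exact ⟨e, fun _ => he⟩
    · obtain ⟨v⟩ := c
      exact ⟨s(v, v), fun h => absurd h hc⟩
  choose g hg using hex
  refine Set.ncard_le_ncard_of_injOn g (fun c hc => (hg c hc).1) ?_
  intro c hc c' hc' heq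
  have h1 := (hg c hc).2 _ (Sym2.out_fst_mem _)
  have h2 := (hg c' hc').2 _ (Sym2.out_fst_mem _)
  rw [← h1, ← h2, heq]

theorem exists_pairable_ncard_unpaired_le {V : Type*} [Finite V] (D : SimpleGraph V) :
    ∃ X, Pairable X ∧ X ⊆ D.edgeSet ∧ (D.edgeSet \ X).ncard ≤ oddComps D := by
  obtain ⟨X, ⟨hX, hXD⟩, hmax⟩ := Set.exists_max_image
    {X : Set (Sym2 V) | Pairable X ∧ X ⊆ D.edgeSet} Set.ncard (Set.toFinite _)
    ⟨∅, .empty, Set.empty_subset _⟩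
  refine ⟨X, hX, hXD, ?_⟩
  have huniq : ∀ e ∈ D.edgeSet \ X, ∀ f ∈ D.edgeSet \ X, ∀ u ∈ e, ∀ v ∈ f,
      D.connectedComponentMk u = D.connectedComponentMk v → e = f := by
    intro e he f hf u hu v hv huv
    by_contra hne
    obtain ⟨w⟩ := ConnectedComponent.exact huv
    exact not_reachable_of_maximal_pairable w hX hXD rfl (fun Y h h' => hmax Y ⟨h, h'⟩)
      he.1 he.2 hf.1 hf.2 hne hu hv
  refine Set.ncard_le_ncard_of_injOn (fun e => D.connectedComponentMk (Quot.out e).1) ?_ ?_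
  · intro e he
    change Odd (compEdgeCount D _)
    rw [compEdgeCount_eq_add hXD]
    have : {f ∈ D.edgeSet \ X | ∀ v ∈ f, D.connectedComponentMk v =
        D.connectedComponentMk (Quot.out e).1} = {e} := by
      ext f
      simp only [Set.mem_ofPred_eq, Set.mem_singleton_iff]
      constructor
      · rintro ⟨hf, h⟩
        exact huniq f hf e he _ (Sym2.out_fst_mem f) _ (Sym2.out_fst_mem e)
          (h _ (Sym2.out_fst_mem f))
      · rintro rfl
        exact ⟨he, fun v hv =>
          connectedComponentMk_eq_of_mem_edge he.1 hv (Sym2.out_fst_mem f)⟩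
    rw [this, Set.ncard_singleton]
    exact (hX.even_ncard_component hXD _).add_one
  · intro e he f hf h
    exact huniq e he f hf _ (Sym2.out_fst_mem e) _ (Sym2.out_fst_mem f) h

theorem IsSpanningTree.ncard_edgeSet_add_one {V : Type*} [Finite V] {G T : SimpleGraph V}
    (hT : IsSpanningTree G T) : T.edgeSet.ncard + 1 = Nat.card V := by
  classical
  have := Fintype.ofFinite V
  rw [Nat.card_eq_fintype_card, ← hT.2.card_edgeFinset, ← Set.ncard_coe_finset, coe_edgeFinset]

theorem edgeSet_fromEdgeSet_sdiff {V : Type*} (G T : SimpleGraph V) :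
    (SimpleGraph.fromEdgeSet (G.edgeSet \ T.edgeSet)).edgeSet = G.edgeSet \ T.edgeSet := by
  rw [edgeSet_fromEdgeSet, sdiff_eq_left, Set.disjoint_left]
  exact fun e he h => G.not_isDiag_of_mem_edgeSet he.1 h

/-- Deleting adjacent pairs without disconnecting the graph bounds the Betti deficiency. -/
theorem xi_add_ncard_le {V : Type*} [Finite V] {G : SimpleGraph V} {X : Set (Sym2 V)}
    (hX : Pairable X) (hXG : X ⊆ G.edgeSet) (hconn : (G.deleteEdges X).Connected) :
    xi G + X.ncard + Nat.card V ≤ G.edgeSet.ncard + 1 := by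
  obtain ⟨T, hle, hT⟩ := hconn.exists_isTree_le
  have hTG : IsSpanningTree G T := ⟨hle.trans (deleteEdges_le X), hT⟩
  have hcard := hTG.ncard_edgeSet_add_one
  have hsub : X ⊆ (SimpleGraph.fromEdgeSet (G.edgeSet \ T.edgeSet)).edgeSet := by
    rw [edgeSet_fromEdgeSet_sdiff]
    intro e he
    refine ⟨hXG he, fun h => ?_⟩
    have := edgeSet_mono hle h
    rw [edgeSet_deleteEdges] at this
    exact this.2 he
  have h1 : xi G ≤ xiT G T := Nat.sInf_le ⟨T, hTG, rfl⟩
  have h2 := oddComps_le_ncard_unpaired hX hsub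
  have h3 := Set.ncard_sdiff_add_ncard_of_subset hsub
  rw [edgeSet_fromEdgeSet_sdiff] at h2 h3
  have h4 := Set.ncard_sdiff_add_ncard_of_subset (edgeSet_mono hTG.1)
  change _ ≤ oddComps _ at h1
  omega

/-- A connected graph has adjacent pairs, as many as its Betti deficiency predicts, whose
deletion does not disconnect it. -/
theorem exists_pairable_of_connected {V : Type*} [Finite V] {G : SimpleGraph V}
    (hG : G.Connected) : ∃ X, Pairable X ∧ X ⊆ G.edgeSet ∧ (G.deleteEdges X).Connected ∧
      G.edgeSet.ncard + 1 ≤ X.ncard + xi G + Nat.card V := by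
  have hne : {n | ∃ T, IsSpanningTree G T ∧ xiT G T = n}.Nonempty := by
    obtain ⟨T, hle, hT⟩ := hG.exists_isTree_le
    exact ⟨_, T, ⟨hle, hT⟩, rfl⟩
  obtain ⟨T, hT, hxi⟩ := Nat.sInf_mem hne
  change _ = xi G at hxi
  change oddComps _ = _ at hxi
  obtain ⟨X, hX, hXD, hle⟩ :=
    exists_pairable_ncard_unpaired_le (SimpleGraph.fromEdgeSet (G.edgeSet \ T.edgeSet))
  have h3 := Set.ncard_sdiff_add_ncard_of_subset hXD
  rw [edgeSet_fromEdgeSet_sdiff] at hle h3 hXD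
  have hcard := hT.ncard_edgeSet_add_one
  have h4 := Set.ncard_sdiff_add_ncard_of_subset (edgeSet_mono hT.1)
  refine ⟨X, hX, hXD.trans Set.sdiff_subset, hT.2.connected.mono ?_, by omega⟩
  intro u v huv
  exact (deleteEdges_adj).2 ⟨hT.1 huv, fun h => (hXD h).2 huv⟩

/-- The ordered pairs `(u, v) ∈ S × R` with `u` and `v` adjacent. -/
def crossPairs {V : Type*} (H : SimpleGraph V) (S R : Set V) : Set (V × V) :=
  {p | p.1 ∈ S ∧ p.2 ∈ R ∧ H.Adj p.1 p.2}

theorem induce_deleteEdges_connected {V : Type*} {H : SimpleGraph V} {W : Set V}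
    {Y : Set (Sym2 V)} (h : (H.induce W).Connected)
    (hY : ∀ u ∈ W, ∀ v ∈ W, s(u, v) ∉ Y) : ((H.deleteEdges Y).induce W).Connected := by
  refine h.mono ?_
  intro u v huv
  exact (deleteEdges_adj).2 ⟨huv, hY u u.2 v v.2⟩

/-- A connected vertex set with two or more elements has a vertex whose removal leaves it
connected, and that vertex has a neighbour in the set. -/
theorem exists_connected_induce_sdiff_singleton {V : Type*} [Finite V] {H : SimpleGraph V}
    {S : Set V} (hS : (H.induce S).Connected) (hnt : S.Nontrivial) :
    ∃ v ∈ S, (H.induce (S \ {v})).Connected ∧ ∃ u ∈ S \ {v}, H.Adj v u := by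
  have := hnt.coe_sort
  obtain ⟨⟨v, hv⟩, hconn⟩ := hS.exists_connected_induce_compl_singleton_of_finite_nontrivial
  obtain ⟨⟨u, hu⟩, huv⟩ := hS.preconnected.exists_adj_of_nontrivial ⟨v, hv⟩
  have hadj : H.Adj v u := huv
  refine ⟨v, hv, ?_, u, ⟨hu, hadj.ne'⟩, hadj⟩
  let φ : ((H.induce S).induce {⟨v, hv⟩}ᶜ) →g H.induce (S \ {v}) :=
    { toFun := fun x => ⟨x.1.1, x.1.2, fun h => x.2 (Subtype.ext h)⟩
      map_rel' := fun h => h }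
  refine hconn.map φ ?_
  rintro ⟨x, hx, hxv⟩
  exact ⟨⟨⟨x, hx⟩, fun h => hxv (congrArg Subtype.val h)⟩, rfl⟩

/-- Among the edges meeting two disjoint connected vertex sets, all but at most two of as many
edges as join the two sets can be chosen in adjacent pairs so that deleting them leaves the
union of the two sets connected. -/
theorem exists_pairable_of_crossPairs {V : Type*} [Finite V] (n : ℕ) :
    ∀ (H : SimpleGraph V) (S R : Set V), S.ncard + (crossPairs H Set.univ Set.univ).ncard ≤ n →
      Disjoint S R → (H.induce S).Connected → (H.induce R).Connected →
      (crossPairs H S R).Nonempty →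
      ∃ X, Pairable X ∧ X ⊆ H.edgeSet ∧ (∀ e ∈ X, ∀ v ∈ e, v ∈ S ∪ R) ∧
        ((H.deleteEdges X).induce (S ∪ R)).Connected ∧
        (crossPairs H S R).ncard ≤ X.ncard + 2 := by
  induction n with
  | zero =>
    intro H S R hn _ _ _ hne
    obtain ⟨p, hp⟩ := hne
    have : S.ncard ≠ 0 := ((Set.ncard_pos (Set.toFinite S)).2 ⟨_, hp.1⟩).ne'
    omega
  | succ n ih =>
    intro H S R hn hd hS hR hne
    by_cases hsmall : (crossPairs H S R).ncard ≤ 2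
    · obtain ⟨p, hp⟩ := hne
      refine ⟨∅, .empty, Set.empty_subset _, by simp, ?_, by simpa using hsmall⟩
      rw [deleteEdges_empty]
      exact connected_induce_union hS.preconnected hR.preconnected hp.1 hp.2.1 hp.2.2
    by_cases hadj : ∃ u v w, (u, v) ∈ crossPairs H S R ∧ (u, w) ∈ crossPairs H S R ∧ v ≠ w
    · obtain ⟨u, v, w, huv, huw, hvw⟩ := hadj
      have huR : u ∉ R := Set.disjoint_left.1 hd huv.1
      have hvS : v ∉ S := Set.disjoint_right.1 hd huv.2.1
      have hwS : w ∉ S := Set.disjoint_right.1 hd huw.2.1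
      have hne' : s(u, v) ≠ s(u, w) := fun h => hvw (Sym2.congr_right.1 h)
      set Y : Set (Sym2 V) := {s(u, v), s(u, w)} with hY
      have hcard : (crossPairs H S R).ncard ≤ (crossPairs (H.deleteEdges Y) S R).ncard + 2 := by
        have hsub : crossPairs H S R ⊆ crossPairs (H.deleteEdges Y) S R ∪ {(u, v), (u, w)} := by
          rintro ⟨a, b⟩ ⟨ha, hb, hab⟩
          have haR : a ≠ v ∧ a ≠ w := ⟨fun h => hvS (h ▸ ha), fun h => hwS (h ▸ ha)⟩
          by_cases hm : s(a, b) ∈ Y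
          · right
            simp only [hY, Set.mem_insert_iff, Set.mem_singleton_iff, Sym2.eq_iff] at hm
            simp only [Set.mem_insert_iff, Set.mem_singleton_iff, Prod.mk.injEq]
            tauto
          · exact Or.inl ⟨ha, hb, deleteEdges_adj.2 ⟨hab, hm⟩⟩
        have h1 := Set.ncard_le_ncard hsub
        have h2 := Set.ncard_union_le (crossPairs (H.deleteEdges Y) S R) {(u, v), (u, w)}
        have h3 := Set.ncard_pair (a := (u, v)) (b := (u, w)) (by simp [hvw])
        omega
      have hlt : (crossPairs (H.deleteEdges Y) Set.univ Set.univ).ncard <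
          (crossPairs H Set.univ Set.univ).ncard := by
        refine Set.ncard_lt_ncard ⟨?_, fun h => ?_⟩
        · exact fun p hp => ⟨hp.1, hp.2.1, (deleteEdges_adj.1 hp.2.2).1⟩
        · have := @h (u, v) ⟨trivial, trivial, huv.2.2⟩
          exact (deleteEdges_adj.1 this.2.2).2 (by simp [hY])
      obtain ⟨X, hX, hXH, hXv, hconn, hle⟩ := ih (H.deleteEdges Y) S R (by omega) hd
        (induce_deleteEdges_connected hS (by
          intro a ha b hb hm
          simp only [hY, Set.mem_insert_iff, Set.mem_singleton_iff, Sym2.eq_iff] at hm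
          rcases hm with (⟨rfl, rfl⟩ | ⟨rfl, rfl⟩) | (⟨rfl, rfl⟩ | ⟨rfl, rfl⟩) <;> tauto))
        (induce_deleteEdges_connected hR (by
          intro a ha b hb hm
          simp only [hY, Set.mem_insert_iff, Set.mem_singleton_iff, Sym2.eq_iff] at hm
          rcases hm with (⟨rfl, rfl⟩ | ⟨rfl, rfl⟩) | (⟨rfl, rfl⟩ | ⟨rfl, rfl⟩) <;> tauto))
        ((Set.ncard_pos (Set.toFinite _)).1 (by omega))
      rw [edgeSet_deleteEdges] at hXH
      have h1 : s(u, v) ∉ X := fun h => (hXH h).2 (by simp [hY])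
      have h2 : s(u, w) ∉ X := fun h => (hXH h).2 (by simp [hY])
      refine ⟨insert s(u, v) (insert s(u, w) X), .insert_pair (Sym2.mem_mk_left u v)
        (Sym2.mem_mk_left u w) hne' h1 h2 hX, ?_, ?_, ?_, ?_⟩
      · exact Set.insert_subset huv.2.2
          (Set.insert_subset huw.2.2 (hXH.trans Set.sdiff_subset))
      · rintro e (rfl | rfl | he) x hx
        · rcases Sym2.mem_iff.1 hx with rfl | rfl
          exacts [Or.inl huv.1, Or.inr huv.2.1]
        · rcases Sym2.mem_iff.1 hx with rfl | rfl
          exacts [Or.inl huw.1, Or.inr huw.2.1]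
        · exact hXv e he x hx
      · rw [deleteEdges_deleteEdges] at hconn
        convert hconn using 3
        ext e
        simp [hY, or_assoc]
      · rw [hX.ncard_insert_pair hne' h1 h2]
        omega
    push Not at hadj
    have hnt : S.Nontrivial := by
      by_contra hS1
      rw [Set.not_nontrivial_iff] at hS1
      have : (crossPairs H S R).Subsingleton := by
        rintro ⟨a, b⟩ hab ⟨c, d⟩ hcd
        obtain rfl : a = c := hS1 hab.1 hcd.1
        rw [hadj a b d hab hcd]
      have := Set.ncard_le_one_iff_subsingleton.2 this
      omega
    obtain ⟨v, hv, hSv, u, hu, hvu⟩ := exists_connected_induce_sdiff_singleton hS hnt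
    have hlt : (S \ {v}).ncard < S.ncard := Set.ncard_sdiff_singleton_lt_of_mem hv
    have hvR : v ∉ R := Set.disjoint_left.1 hd hv
    by_cases hcross : ∃ w, (v, w) ∈ crossPairs H S R
    · obtain ⟨w, hvw⟩ := hcross
      have hunion : S \ {v} ∪ insert v R = S ∪ R := by
        ext a
        by_cases a = v <;> simp_all
      have hsub : crossPairs H S R ⊆
          insert (v, w) (crossPairs H (S \ {v}) (insert v R) \ {(u, v)}) := by
        rintro ⟨a, b⟩ hab
        by_cases hav : a = v
        · subst hav
          left
          rw [hadj a b w hab hvw]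
        · refine Or.inr ⟨⟨⟨hab.1, hav⟩, Or.inr hab.2.1, hab.2.2⟩, fun h => hvR ?_⟩
          obtain ⟨-, rfl⟩ := Prod.mk.inj h
          exact hab.2.1
      have huv : (u, v) ∈ crossPairs H (S \ {v}) (insert v R) :=
        ⟨hu, Set.mem_insert _ _, hvu.symm⟩
      have hcard : (crossPairs H S R).ncard ≤
          (crossPairs H (S \ {v}) (insert v R)).ncard := by
        have h1 := Set.ncard_le_ncard hsub
        have h2 := Set.ncard_insert_le (v, w)
          (crossPairs H (S \ {v}) (insert v R) \ {(u, v)})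
        have h3 := Set.ncard_sdiff_singleton_add_one huv
        omega
      obtain ⟨X, hX, hXH, hXv, hconn, hle⟩ := ih H (S \ {v}) (insert v R) (by omega) (by
          rw [Set.disjoint_insert_right]
          exact ⟨by simp, hd.mono_left Set.sdiff_subset⟩) hSv (by
          rw [← Set.singleton_union]
          exact connected_induce_union (Preconnected.of_subsingleton) hR.preconnected
            (Set.mem_singleton v) hvw.2.1 hvw.2.2) ⟨_, huv⟩
      rw [hunion] at hXv hconn
      exact ⟨X, hX, hXH, hXv, hconn, by omega⟩
    · have heq : crossPairs H S R = crossPairs H (S \ {v}) R := by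
        ext ⟨a, b⟩
        refine ⟨fun h => ⟨⟨h.1, ?_⟩, h.2⟩, fun h => ⟨h.1.1, h.2⟩⟩
        rintro rfl
        exact hcross ⟨b, h⟩
      obtain ⟨X, hX, hXH, hXv, hconn, hle⟩ := ih H (S \ {v}) R (by omega)
        (hd.mono_left Set.sdiff_subset) hSv hR (heq ▸ hne)
      refine ⟨X, hX, hXH, fun e he x hx => (hXv e he x hx).imp_left And.left, ?_, heq ▸ hle⟩
      have hnX : s(v, u) ∉ X := by
        intro h
        rcases hXv _ h v (Sym2.mem_mk_left v u) with h | h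
        · exact h.2 rfl
        · exact hvR h
      have hunion : S ∪ R = {v} ∪ (S \ {v} ∪ R) := by
        ext a
        by_cases a = v <;> simp_all
      rw [hunion]
      exact connected_induce_union Preconnected.of_subsingleton hconn.preconnected
        (Set.mem_singleton v) (Or.inl hu) (deleteEdges_adj.2 ⟨hvu, hnX⟩)

theorem exists_pairable_of_induce_connected {V : Type*} [Finite V] {G : SimpleGraph V} {W : Set V}
    (hW : (G.induce W).Connected) :
    ∃ Y, Pairable Y ∧ Y ⊆ G.edgeSet ∧ (∀ e ∈ Y, ∀ v ∈ e, v ∈ W) ∧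
      ((G.deleteEdges Y).induce W).Connected ∧
      (G.induce W).edgeSet.ncard + 1 ≤ Y.ncard + xi (G.induce W) + W.ncard := by
  obtain ⟨X, hX, hXG, hconn, hle⟩ := exists_pairable_of_connected hW
  have hinj : Function.Injective (Sym2.map (Subtype.val : W → V)) :=
    Sym2.map.injective Subtype.val_injective
  refine ⟨_, hX.image Subtype.val_injective, ?_, ?_, hconn.mono ?_, ?_⟩
  · rintro _ ⟨e, he, rfl⟩
    have := hXG he
    induction e with
    | h u v => exact this
  · rintro _ ⟨e, -, rfl⟩ v hv
    obtain ⟨w, -, rfl⟩ := Sym2.mem_map.1 hv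
    exact w.2
  · intro u v huv
    obtain ⟨hadj, hm⟩ := deleteEdges_adj.1 huv
    refine deleteEdges_adj.2 ⟨hadj, ?_⟩
    rintro ⟨e, he, h⟩
    exact hm (hinj (a₁ := e) (a₂ := s(u, v)) h ▸ he)
  · rwa [Set.ncard_image_of_injective _ hinj, ← Nat.card_coe_set_eq W]

/-- If `A` is an edge-cut of the connected graph `G` such that `G - A`
has exactly two connected components `G₁` (induced on `S`) and `G₂` (induced on `Sᶜ`),
both upper-embeddable, then `β(G) - ξ(G) ≥ 2(⌊β(G)/2⌋ - 1)`; equivalently, by Xuong's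
theorem, `γ_M(G) ≥ ⌊β(G)/2⌋ - 1`. -/
theorem edge_cut_genus_lower_bound {V : Type*} [Finite V]
    (G : SimpleGraph V) (hG : G.Connected)
    (A : Set (Sym2 V)) (hA : A ⊆ G.edgeSet) (S : Set V)
    (hS : S.Nonempty) (hSc : Sᶜ.Nonempty)
    (hcross : ∀ e ∈ A, ∃ u v, e = s(u, v) ∧ u ∈ S ∧ v ∉ S)
    (hsplit : ∀ u v, (G.deleteEdges A).Adj u v → (u ∈ S ↔ v ∈ S))
    (hconn₁ : ((G.deleteEdges A).induce S).Connected)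
    (hconn₂ : ((G.deleteEdges A).induce Sᶜ).Connected)
    (hx₁ : xi ((G.deleteEdges A).induce S) ≤ 1)
    (hx₂ : xi ((G.deleteEdges A).induce Sᶜ) ≤ 1) :
    2 * (betti G / 2 - 1) ≤ betti G - xi G := by
  obtain ⟨Y₁, hY₁, hY₁G, hY₁S, hc₁, hle₁⟩ := exists_pairable_of_induce_connected hconn₁
  obtain ⟨Y₂, hY₂, hY₂G, hY₂S, hc₂, hle₂⟩ := exists_pairable_of_induce_connected hconn₂
  have hnot : ∀ u ∈ S, ∀ v ∈ Sᶜ, s(u, v) ∉ Y₁ ∪ Y₂ := by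
    rintro u hu v hv (h | h)
    · exact hv (hY₁S _ h v (Sym2.mem_mk_right u v))
    · exact hY₂S _ h u (Sym2.mem_mk_left u v) hu
  have hdisj : Disjoint Y₁ Y₂ := by
    rw [Set.disjoint_left]
    intro e h₁ h₂
    exact hY₂S e h₂ _ (Sym2.out_fst_mem e) (hY₁S e h₁ _ (Sym2.out_fst_mem e))
  set H := G.deleteEdges (Y₁ ∪ Y₂) with hH
  have hHS : (H.induce S).Connected := by
    refine (induce_deleteEdges_connected (Y := Y₂) hc₁ fun u hu v _ h =>
      hY₂S _ h u (Sym2.mem_mk_left u v) hu).mono (comap_monotone _ ?_)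
    rw [deleteEdges_deleteEdges]
    exact deleteEdges_mono (deleteEdges_le A)
  have hHSc : (H.induce Sᶜ).Connected := by
    refine (induce_deleteEdges_connected (Y := Y₁) hc₂ fun u hu v _ h =>
      hu (hY₁S _ h u (Sym2.mem_mk_left u v))).mono (comap_monotone _ ?_)
    rw [deleteEdges_deleteEdges, Set.union_comm]
    exact deleteEdges_mono (deleteEdges_le A)
  have hne : (crossPairs H S Sᶜ).Nonempty := by
    obtain ⟨u, hu⟩ := hS
    obtain ⟨v, hv⟩ := hSc
    obtain ⟨w⟩ := hG.preconnected u v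
    obtain ⟨d, -, hd₁, hd₂⟩ := w.exists_boundary_dart S hu hv
    exact ⟨(d.fst, d.snd), hd₁, hd₂, deleteEdges_adj.2 ⟨d.adj, hnot _ hd₁ _ hd₂⟩⟩
  obtain ⟨X, hX, hXH, -, hconn, hle⟩ := exists_pairable_of_crossPairs _ H S Sᶜ le_rfl
    disjoint_compl_right hHS hHSc hne
  rw [hH, edgeSet_deleteEdges] at hXH
  have hA_le : A.ncard ≤ (crossPairs H S Sᶜ).ncard := by
    refine (Set.ncard_le_ncard (t := (fun p : V × V => s(p.1, p.2)) '' crossPairs H S Sᶜ)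
      ?_).trans (Set.ncard_image_le)
    intro e he
    obtain ⟨u, v, rfl, hu, hv⟩ := hcross e he
    exact ⟨(u, v), ⟨hu, hv, deleteEdges_adj.2 ⟨hA he, hnot u hu v hv⟩⟩, rfl⟩
  have hE_le : G.edgeSet.ncard ≤ A.ncard + ((G.deleteEdges A).induce S).edgeSet.ncard +
      ((G.deleteEdges A).induce Sᶜ).edgeSet.ncard := by
    have hsub : G.edgeSet ⊆ A ∪ Sym2.map Subtype.val '' ((G.deleteEdges A).induce S).edgeSet ∪
        Sym2.map Subtype.val '' ((G.deleteEdges A).induce Sᶜ).edgeSet := by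
      intro e he
      induction e with
      | h u v =>
        by_cases hm : s(u, v) ∈ A
        · exact Or.inl (Or.inl hm)
        have hadj : (G.deleteEdges A).Adj u v := deleteEdges_adj.2 ⟨he, hm⟩
        by_cases hu : u ∈ S
        · exact Or.inl (Or.inr ⟨s(⟨u, hu⟩, ⟨v, (hsplit u v hadj).1 hu⟩), hadj, rfl⟩)
        · exact Or.inr ⟨s(⟨u, hu⟩, ⟨v, fun hv => hu ((hsplit u v hadj).2 hv)⟩), hadj, rfl⟩
    have h₁ := Set.ncard_le_ncard hsub
    have h₂ := Set.ncard_union_le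
      (A ∪ Sym2.map Subtype.val '' ((G.deleteEdges A).induce S).edgeSet)
      (Sym2.map Subtype.val '' ((G.deleteEdges A).induce Sᶜ).edgeSet)
    have h₃ := Set.ncard_union_le A
      (Sym2.map Subtype.val '' ((G.deleteEdges A).induce S).edgeSet)
    rw [Set.ncard_image_of_injective _ (Sym2.map.injective Subtype.val_injective)] at h₂ h₃
    omega
  have hdisj' : Disjoint (Y₁ ∪ Y₂) X := Set.disjoint_right.2 fun e he => (hXH he).2
  have hP := (hY₁.union hY₂ hdisj).union hX hdisj'
  have hcard : (Y₁ ∪ Y₂ ∪ X).ncard = Y₁.ncard + Y₂.ncard + X.ncard := by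
    rw [Set.ncard_union_eq hdisj', Set.ncard_union_eq hdisj]
  have hsub : Y₁ ∪ Y₂ ∪ X ⊆ G.edgeSet := by
    have hGA := edgeSet_mono (deleteEdges_le (G := G) A)
    exact Set.union_subset (Set.union_subset (hY₁G.trans hGA) (hY₂G.trans hGA))
      (hXH.trans Set.sdiff_subset)
  rw [Set.union_compl_self, hH, deleteEdges_deleteEdges] at hconn
  have hxi := xi_add_ncard_le hP hsub ((induceUnivIso _).connected_iff.1 hconn)
  have hV := Set.ncard_add_ncard_compl S
  obtain ⟨k, hk⟩ := hP.even_ncard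
  unfold betti
  omega
end

section
/- Let G be a finite connected simple graph and let A ⊆ E(G) be an edge-cut of G such that G − A has exactly two connected components G₁ and G₂ with ξ(G₁) ≤ 1 and ξ(G₂) ≤ 1. If β(G₁) ≡ 0 (mod 2) and β(G₂) ≡ 0 (mod 2), then ξ(G) ≤ 1; equivalently, G is upper-embeddable. -/
open SimpleGraph

/-- `TreeOn R E`: the edges `E` form a tree with vertex set `R`, built up by attaching leaves. -/
inductive TreeOn {V : Type*} [DecidableEq V] : Finset V → Finset (Sym2 V) → Prop
  | single (v : V) : TreeOn {v} ∅
  | attach {v u : V} {R : Finset V} {E : Finset (Sym2 V)} (h : TreeOn R E) (hu : u ∈ R)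
      (hv : v ∉ R) : TreeOn (insert v R) (insert s(v, u) E)

/-- A vertex set `C` is closed under `D` if no edge of `D` leaves `C`. -/
def ClosedUnder {V : Type*} (D : Finset (Sym2 V)) (C : Set V) : Prop :=
  ∀ e ∈ D, ∀ x ∈ e, ∀ y ∈ e, x ∈ C → y ∈ C

open scoped Classical in
/-- Every vertex set closed under `D` contains an even number of edges of `D`. -/
def EvenOnClosed {V : Type*} (D : Finset (Sym2 V)) : Prop :=
  ∀ C : Set V, ClosedUnder D C → Even (D.filter fun e => ∀ x ∈ e, x ∈ C).card

theorem ClosedUnder.mono {V : Type*} {D D' : Finset (Sym2 V)} {C : Set V}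
    (h : ClosedUnder D C) (hD : D' ⊆ D) : ClosedUnder D' C :=
  fun e he => h e (hD he)

theorem EvenOnClosed.union {V : Type*} [DecidableEq V] {D D' : Finset (Sym2 V)}
    (h : EvenOnClosed D) (h' : EvenOnClosed D') (hd : Disjoint D D') :
    EvenOnClosed (D ∪ D') := by
  classical
  intro C hC
  have h1 := (h C (hC.mono Finset.subset_union_left)).add
    (h' C (hC.mono Finset.subset_union_right))
  rw [← Finset.card_union_of_disjoint (Finset.disjoint_filter_filter hd)] at h1
  rwa [Finset.filter_union]

theorem evenOnClosed_star {V : Type*} {D : Finset (Sym2 V)} (s : V)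
    (hs : ∀ e ∈ D, s ∈ e) (hD : Even D.card) : EvenOnClosed D := by
  classical
  intro C hC
  by_cases h : s ∈ C
  · rwa [Finset.filter_true_of_mem fun e he x hx => hC e he s (hs e he) x hx h]
  · rw [Finset.filter_false_of_mem fun e he hx => h (hx s (hs e he))]
    simp

theorem evenOnClosed_image {W V : Type*} [DecidableEq V] {D : Finset (Sym2 W)}
    (h : EvenOnClosed D) {f : W → V} (hf : Function.Injective f) :
    EvenOnClosed (D.image (Sym2.map f)) := by
  classical
  intro C hC
  have hC' : ClosedUnder D (f ⁻¹' C) := fun e he x hx y hy hxC =>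
    hC _ (Finset.mem_image_of_mem _ he) (f x) (Sym2.mem_map.2 ⟨x, hx, rfl⟩) (f y)
      (Sym2.mem_map.2 ⟨y, hy, rfl⟩) hxC
  have h1 := h _ hC'
  rw [Finset.filter_image, Finset.card_image_of_injective _ (Sym2.map.injective hf)]
  convert h1 using 3
  simp [Sym2.mem_map]

namespace TreeOn

variable {V : Type*} [DecidableEq V] {R : Finset V} {E : Finset (Sym2 V)}

theorem mem_of_mem (h : TreeOn R E) {e : Sym2 V} (he : e ∈ E) {x : V} (hx : x ∈ e) :
    x ∈ R := by
  induction h with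
  | single v => simp at he
  | attach h hu hv ih =>
    rcases Finset.mem_insert.1 he with rfl | he
    · rcases Sym2.mem_iff.1 hx with rfl | rfl <;> simp [*]
    · exact Finset.mem_insert_of_mem (ih he)

theorem card_add_one (h : TreeOn R E) : E.card + 1 = R.card := by
  induction h with
  | single v => simp
  | attach h hu hv ih =>
    rw [Finset.card_insert_of_notMem hv, Finset.card_insert_of_notMem, ih]
    exact fun he => hv (h.mem_of_mem he (Sym2.mem_mk_left _ _))

theorem reachable (h : TreeOn R E) {T : SimpleGraph V} (hT : ↑E ⊆ T.edgeSet) {x y : V}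
    (hx : x ∈ R) (hy : y ∈ R) : T.Reachable x y := by
  induction h generalizing x y with
  | single v =>
    rw [Finset.mem_singleton.1 hx, Finset.mem_singleton.1 hy]
  | @attach v u R E h hu hv ih =>
    rw [Finset.coe_insert, Set.insert_subset_iff] at hT
    have key : ∀ z ∈ insert v R, T.Reachable z u := by
      intro z hz
      rcases Finset.mem_insert.1 hz with rfl | hz
      · exact SimpleGraph.Adj.reachable hT.1
      · exact ih hT.2 hz hu
    exact (key x hx).trans (key y hy).symm

theorem not_isDiag_of_mem (h : TreeOn R E) {e : Sym2 V} (he : e ∈ E) : ¬ e.IsDiag := by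
  induction h with
  | single v => simp at he
  | attach h hu hv ih =>
    rcases Finset.mem_insert.1 he with rfl | he
    · exact fun h => hv (Sym2.mk_isDiag_iff.1 h ▸ hu)
    · exact ih he

theorem edgeSet_fromEdgeSet (h : TreeOn R E) : (fromEdgeSet (E : Set (Sym2 V))).edgeSet = E := by
  rw [SimpleGraph.edgeSet_fromEdgeSet, sdiff_eq_left, Set.disjoint_left]
  exact fun e he => h.not_isDiag_of_mem he

theorem isTree [Fintype V] (h : TreeOn Finset.univ E) :
    (fromEdgeSet (E : Set (Sym2 V))).IsTree := by
  rw [isTree_iff_connected_and_card]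
  constructor
  · have : Nonempty V := by
      rw [← Fintype.card_pos_iff, ← Finset.card_univ, ← h.card_add_one]
      omega
    exact ⟨fun x y => h.reachable h.edgeSet_fromEdgeSet.ge (Finset.mem_univ x)
      (Finset.mem_univ y)⟩
  · rw [h.edgeSet_fromEdgeSet, Nat.card_eq_fintype_card]
    simpa using h.card_add_one

theorem image {W : Type*} [DecidableEq W] (h : TreeOn R E) {f : V → W}
    (hf : Function.Injective f) : TreeOn (R.image f) (E.image (Sym2.map f)) := by
  induction h with
  | single v => simpa using TreeOn.single (f v)
  | attach h hu hv ih =>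
    rw [Finset.image_insert, Finset.image_insert, Sym2.map_mk]
    exact ih.attach (Finset.mem_image_of_mem _ hu) (by simpa [hf.eq_iff] using hv)

/-- Joining two trees by an odd number of edges yields a graph with a spanning tree `E` whose
complement is even on closed sets. -/
theorem exists_join {S R : Finset V} {E₁ E₂ A : Finset (Sym2 V)} (h₁ : TreeOn S E₁)
    (h₂ : TreeOn R E₂) (hd : Disjoint S R) (hA : Odd A.card)
    (hAc : ∀ e ∈ A, ∃ x ∈ S, ∃ y ∈ R, e = s(x, y)) :
    ∃ E P, TreeOn (S ∪ R) E ∧ EvenOnClosed P ∧ Disjoint E P ∧ E ∪ P = E₁ ∪ E₂ ∪ A := by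
  induction h₁ generalizing R E₂ A with
  | single s =>
    have hs : s ∉ R := by simpa using hd
    have hsA : ∀ e ∈ A, s ∈ e := by
      intro e he
      obtain ⟨x, hx, y, -, rfl⟩ := hAc e he
      simp [Finset.mem_singleton.1 hx]
    obtain ⟨e, he⟩ := Finset.card_pos.1 hA.pos
    obtain ⟨x, hx, y, hy, rfl⟩ := hAc e he
    obtain rfl := Finset.mem_singleton.1 hx
    refine ⟨insert s(x, y) E₂, A.erase s(x, y), h₂.attach hy hs, evenOnClosed_star x
      (fun e he => hsA e (Finset.mem_of_mem_erase he)) ?_, ?_, ?_⟩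
    · rw [Finset.card_erase_of_mem he]
      exact Nat.Odd.sub_odd hA odd_one
    · rw [Finset.disjoint_left]
      intro e h hP
      rcases Finset.mem_insert.1 h with rfl | h
      · simp at hP
      · exact hs (h₂.mem_of_mem h (hsA e (Finset.mem_of_mem_erase hP)))
    · ext e
      by_cases h : e = s(x, y) <;> simp_all
  | @attach v u S E₁ h₁ hu hv ih =>
    obtain ⟨hvR, hd⟩ := Finset.disjoint_insert_left.1 hd
    have huR : u ∉ R := Finset.disjoint_left.1 hd hu
    set K := A.filter (v ∈ ·) with hK
    set A₀ := A.filter (v ∉ ·) with hA₀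
    have hcard : K.card + A₀.card = A.card := Finset.card_filter_add_card_filter_not _
    have hKA : K ∪ A₀ = A := Finset.filter_union_filter_not_eq _ _
    have hKv : ∀ e ∈ K, v ∈ e := fun e he => (Finset.mem_filter.1 he).2
    have hA₀v : ∀ e ∈ A₀, v ∉ e := fun e he => (Finset.mem_filter.1 he).2
    have hE₁v : ∀ e ∈ E₁, v ∉ e := fun e he h => hv (h₁.mem_of_mem he h)
    have hE₂v : ∀ e ∈ E₂, v ∉ e := fun e he h => hvR (h₂.mem_of_mem he h)
    have hKc : ∀ e ∈ K, ∃ y ∈ R, e = s(v, y) := by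
      intro e he
      obtain ⟨he, hve⟩ := Finset.mem_filter.1 he
      obtain ⟨x, hx, y, hy, rfl⟩ := hAc e he
      rcases Sym2.mem_iff.1 hve with rfl | rfl
      · exact ⟨y, hy, rfl⟩
      · exact absurd hy hvR
    have hA₀c : ∀ e ∈ A₀, ∃ x ∈ S, ∃ y ∈ R, e = s(x, y) := by
      intro e he
      obtain ⟨he, hve⟩ := Finset.mem_filter.1 he
      obtain ⟨x, hx, y, hy, rfl⟩ := hAc e he
      rcases Finset.mem_insert.1 hx with rfl | hx
      · simp at hve
      · exact ⟨x, hx, y, hy, rfl⟩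
    have huvK : s(v, u) ∉ K := by
      intro h
      obtain ⟨y, hy, h⟩ := hKc _ h
      rcases Sym2.eq_iff.1 h with ⟨-, rfl⟩ | ⟨rfl, -⟩
      · exact huR hy
      · exact hvR hy
    rcases Nat.even_or_odd K.card with hKe | hKo
    · obtain ⟨E, P, hE, hP, hEP, hu'⟩ := ih h₂ hd (A := A₀)
        (by rw [← hcard] at hA; exact (Nat.odd_add'.1 hA).2 hKe) hA₀c
      have hno : ∀ e ∈ E ∪ P, v ∉ e := by
        intro e he
        rw [hu', Finset.mem_union, Finset.mem_union] at he
        rcases he with (he | he) | he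
        exacts [hE₁v e he, hE₂v e he, hA₀v e he]
      have hKP : Disjoint P K := Finset.disjoint_left.2 fun e he h =>
        hno e (Finset.mem_union_right _ he) (hKv e h)
      refine ⟨insert s(v, u) E, P ∪ K, ?_, hP.union (evenOnClosed_star v hKv hKe) hKP, ?_, ?_⟩
      · rw [Finset.insert_union]
        exact hE.attach (Finset.mem_union_left _ hu) (by simp [hv, hvR])
      · rw [Finset.disjoint_insert_left, Finset.mem_union, Finset.disjoint_union_right]
        refine ⟨?_, hEP, ?_⟩
        · rintro (h | h)
          · exact hno _ (Finset.mem_union_right _ h) (Sym2.mem_mk_left _ _)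
          · exact huvK h
        · exact Finset.disjoint_left.2 fun e he h =>
            hno e (Finset.mem_union_left _ he) (hKv e h)
      · rw [← hKA, Finset.insert_union, ← Finset.union_assoc, hu']
        ext e
        simp only [Finset.mem_insert, Finset.mem_union]
        tauto
    · obtain ⟨e, he⟩ := Finset.card_pos.1 hKo.pos
      obtain ⟨y, hy, rfl⟩ := hKc e he
      have huvA₀ : s(v, u) ∉ A₀ := fun h => hA₀v _ h (Sym2.mem_mk_left _ _)
      obtain ⟨E, P, hE, hP, hEP, hu'⟩ := ih (h₂.attach hy hvR)
        (Finset.disjoint_insert_right.2 ⟨hv, hd⟩) (A := insert s(v, u) A₀)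
        (by
          rw [Finset.card_insert_of_notMem huvA₀]
          rw [← hcard] at hA
          exact ((Nat.odd_add.1 hA).1 hKo).add_one)
        (by
          intro e he
          rcases Finset.mem_insert.1 he with rfl | he
          · exact ⟨u, hu, v, Finset.mem_insert_self _ _, Sym2.eq_swap⟩
          · obtain ⟨x, hx, y, hy, rfl⟩ := hA₀c e he
            exact ⟨x, hx, y, Finset.mem_insert_of_mem hy, rfl⟩)
      have hno : ∀ e ∈ E ∪ P, e ∉ K.erase s(v, y) := by
        intro e he hKe
        obtain ⟨hne, hKe⟩ := Finset.mem_erase.1 hKe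
        simp only [hu', Finset.mem_union, Finset.mem_insert] at he
        rcases he with (he | he | he) | he | he
        · exact hE₁v e he (hKv e hKe)
        · exact hne he
        · exact hE₂v e he (hKv e hKe)
        · exact huvK (he ▸ hKe)
        · exact hA₀v e he (hKv e hKe)
      refine ⟨E, P ∪ K.erase s(v, y), ?_, hP.union (evenOnClosed_star v
        (fun e he => hKv e (Finset.mem_of_mem_erase he)) ?_) ?_, ?_, ?_⟩
      · rwa [Finset.insert_union, ← Finset.union_insert]
      · rw [Finset.card_erase_of_mem he]
        exact Nat.Odd.sub_odd hKo odd_one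
      · exact Finset.disjoint_left.2 fun e he => hno e (Finset.mem_union_right _ he)
      · exact Finset.disjoint_union_right.2
          ⟨hEP, Finset.disjoint_left.2 fun e he => hno e (Finset.mem_union_left _ he)⟩
      · rw [← hKA, ← Finset.union_assoc, hu']
        ext e
        by_cases h : e = s(v, y)
        · simp [h, he]
        · simp only [Finset.mem_insert, Finset.mem_union, Finset.mem_erase, h]
          tauto

end TreeOn

theorem SimpleGraph.IsTree.treeOn {V : Type*} [Fintype V] [DecidableEq V] {T : SimpleGraph V}
    [Fintype T.edgeSet] (hT : T.IsTree) : TreeOn Finset.univ T.edgeFinset := by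
  have step : ∀ n, n < Fintype.card V →
      ∃ R E, TreeOn R E ∧ E ⊆ T.edgeFinset ∧ R.card = n + 1 := by
    intro n hn
    induction n with
    | zero =>
      obtain ⟨v⟩ := hT.connected.nonempty
      exact ⟨{v}, ∅, .single v, by simp, by simp⟩
    | succ n ih =>
      obtain ⟨R, E, hR, hE, hc⟩ := ih (by omega)
      obtain ⟨a, ha⟩ := (Finset.card_pos (s := R)).1 (by omega)
      obtain ⟨b, hb⟩ : ∃ b, b ∉ R := by
        by_contra! h
        rw [Finset.eq_univ_iff_forall.2 h, Finset.card_univ] at hc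
        omega
      obtain ⟨p⟩ := hT.connected a b
      obtain ⟨d, -, hd, hd'⟩ := p.exists_boundary_dart (R : Set V) ha hb
      refine ⟨_, _, hR.attach (Finset.mem_coe.1 hd) (fun h => hd' (Finset.mem_coe.2 h)),
        Finset.insert_subset ?_ hE, ?_⟩
      · simpa using d.adj.symm
      · rw [Finset.card_insert_of_notMem (fun h => hd' (Finset.mem_coe.2 h)), hc]
  obtain ⟨v⟩ := hT.connected.nonempty
  have hpos : 0 < Fintype.card V := Fintype.card_pos_iff.2 ⟨v⟩
  obtain ⟨R, E, hR, hE, hc⟩ := step (Fintype.card V - 1) (by omega)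
  have hRu : R = Finset.univ := Finset.card_eq_iff_eq_univ R |>.1 (by omega)
  have h1 := hR.card_add_one
  have h2 := hT.card_edgeFinset
  rwa [← hRu, ← Finset.eq_of_subset_of_card_le hE (by omega)]

open scoped Classical in
theorem card_filter_closed_eq_sum {V : Type*} [Fintype V] (D : SimpleGraph V)
    [Fintype D.edgeSet] (C : Set V) (hC : ClosedUnder D.edgeFinset C) :
    (D.edgeFinset.filter fun e => ∀ x ∈ e, x ∈ C).card =
      ∑ c : D.ConnectedComponent with c.supp ⊆ C, compEdgeCount D c := by
  have hcl : ∀ x y, D.Reachable x y → x ∈ C → y ∈ C := by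
    rintro x y ⟨p⟩
    induction p with
    | nil => exact id
    | cons h p ih =>
      exact fun hx => ih (hC _ (mem_edgeFinset.2 h) _ (Sym2.mem_mk_left _ _) _
        (Sym2.mem_mk_right _ _) hx)
  have hcomp : ∀ e ∈ D.edgeSet, ∀ x ∈ e, ∀ y ∈ e,
      D.connectedComponentMk x = D.connectedComponentMk y := by
    intro e
    induction e with
    | h a b =>
      intro (hab : D.Adj a b)
      have := ConnectedComponent.connectedComponentMk_eq_of_adj hab
      have hx : ∀ x ∈ s(a, b), D.connectedComponentMk x = D.connectedComponentMk a := by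
        intro x hx
        rcases Sym2.mem_iff.1 hx with rfl | rfl
        exacts [rfl, this.symm]
      exact fun x h y h' => (hx x h).trans (hx y h').symm
  rw [Finset.card_eq_sum_card_fiberwise (f := fun e => D.connectedComponentMk e.out.1)
    (t := Finset.univ.filter fun c : D.ConnectedComponent => c.supp ⊆ C)]
  · refine Finset.sum_congr rfl fun c hc => ?_
    have hc := (Finset.mem_filter.1 hc).2
    rw [compEdgeCount, ← Set.ncard_coe_finset]
    congr 1
    ext e
    simp only [Finset.coe_filter, Finset.mem_filter, mem_edgeFinset, Set.mem_ofPred_eq]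
    constructor
    · rintro ⟨⟨he, -⟩, h⟩
      exact ⟨he, fun v hv => (hcomp e he v hv _ e.out_fst_mem).trans h⟩
    · rintro ⟨he, h⟩
      exact ⟨⟨he, fun x hx => hc (h x hx)⟩, h _ e.out_fst_mem⟩
  · intro e he
    simp only [Finset.coe_filter, mem_edgeFinset, Set.mem_ofPred_eq, Finset.mem_univ,
      true_and] at he ⊢
    intro x hx
    exact hcl _ _ (ConnectedComponent.exact hx).symm (he.2 _ e.out_fst_mem)

open scoped Classical in
theorem evenOnClosed_of_oddComps_le_one {V : Type*} [Fintype V] (D : SimpleGraph V)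
    [Fintype D.edgeSet] (h : oddComps D ≤ 1)
    (hD : Even D.edgeFinset.card) : EvenOnClosed D.edgeFinset := by
  have h1 := card_filter_closed_eq_sum D Set.univ (fun _ _ _ _ _ _ _ => trivial)
  simp only [Set.mem_univ, implies_true, Finset.filter_true, Set.subset_univ] at h1
  rw [h1, Finset.even_sum_iff_even_card_odd] at hD
  rw [oddComps, Set.ncard_eq_toFinset_card', Set.toFinset_ofPred] at h
  have h0 : (Finset.univ.filter fun c : D.ConnectedComponent => Odd (compEdgeCount D c)) = ∅ := by
    rw [← Finset.card_eq_zero]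
    obtain ⟨k, hk⟩ := hD
    omega
  intro C hC
  have heven : Even (∑ c : D.ConnectedComponent with c.supp ⊆ C, compEdgeCount D c) := by
    refine Finset.even_sum _ fun c _ => ?_
    rw [← Nat.not_odd_iff_even]
    intro hc
    exact Finset.filter_eq_empty_iff.1 h0 (Finset.mem_univ c) hc
  rw [← card_filter_closed_eq_sum D C hC] at heven
  convert heven

theorem oddComps_le_one {V : Type*} [Finite V] [DecidableEq V] (D : SimpleGraph V)
    {F P : Finset (Sym2 V)} (hD : D.edgeSet = ↑(F ∪ P))
    (hF : F.card ≤ 1) (hP : EvenOnClosed P) : oddComps D ≤ 1 := by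
  classical
  have key : ∀ c : D.ConnectedComponent, Odd (compEdgeCount D c) →
      ∃ e ∈ F, ∀ x ∈ e, D.connectedComponentMk x = c := by
    intro c hc
    by_contra! hno
    rw [← Nat.not_even_iff_odd] at hc
    apply hc
    have hcl : ClosedUnder P c.supp := by
      intro e he x hx y hy hxc
      have he : e ∈ D.edgeSet := by simp [hD, he]
      by_cases hxy : x = y
      · exact hxy ▸ hxc
      · rw [(Sym2.mem_and_mem_iff hxy).1 ⟨hx, hy⟩] at he
        exact (ConnectedComponent.connectedComponentMk_eq_of_adj he).symm.trans hxc
    have := hP _ hcl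
    rw [← Set.ncard_coe_finset] at this
    convert this
    rw [compEdgeCount]
    congr 1
    ext e
    simp only [hD, Finset.coe_union, Finset.coe_filter, Set.mem_union, Finset.mem_coe,
      Set.mem_ofPred_eq, ConnectedComponent.mem_supp_iff]
    constructor
    · rintro ⟨he | he, h⟩
      · obtain ⟨x, hx, hne⟩ := hno e he
        exact absurd (h x hx) hne
      · exact ⟨he, h⟩
    · exact fun h => ⟨.inr h.1, h.2⟩
  refine (Set.ncard_le_one_iff (Set.toFinite _)).2 fun {c c'} hc hc' => ?_
  obtain ⟨e, he, h⟩ := key c hc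
  obtain ⟨e', he', h'⟩ := key c' hc'
  obtain rfl := Finset.card_le_one.1 hF e he e' he'
  rw [← h _ e.out_fst_mem, h' _ e.out_fst_mem]

open scoped Classical in
theorem exists_spanningTree_evenOnClosed {V : Type*} [Fintype V] (G : SimpleGraph V)
    (hG : G.Connected) (hx : xi G ≤ 1) (hb : Even (betti G)) :
    ∃ T D, IsSpanningTree G T ∧ EvenOnClosed D ∧ ∀ e, e ∈ D ↔ e ∈ G.edgeSet ∧ e ∉ T.edgeSet := by
  obtain ⟨T₀, hT₀, hT₀'⟩ := hG.exists_isTree_le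
  obtain ⟨T, hT, hTx⟩ := Nat.sInf_mem (s := {n | ∃ T, IsSpanningTree G T ∧ xiT G T = n})
    ⟨_, T₀, ⟨hT₀, hT₀'⟩, rfl⟩
  refine ⟨T, G.edgeFinset \ T.edgeFinset, hT, ?_, by simp⟩
  have hle : xiT G T ≤ 1 := hTx.trans_le hx
  have hset : (fromEdgeSet (G.edgeSet \ T.edgeSet)).edgeFinset =
      G.edgeFinset \ T.edgeFinset := by
    ext e
    simp only [mem_edgeFinset, SimpleGraph.edgeSet_fromEdgeSet, Finset.mem_sdiff, Set.mem_sdiff]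
    exact ⟨And.left, fun h => ⟨h, G.not_isDiag_of_mem_edgeSet h.1⟩⟩
  rw [← hset]
  refine evenOnClosed_of_oddComps_le_one _ hle ?_
  have hsub : T.edgeFinset ⊆ G.edgeFinset := edgeFinset_mono hT.1
  have h1 := hT.2.card_edgeFinset
  rw [hset, Finset.card_sdiff_of_subset hsub]
  rw [betti, Nat.card_eq_fintype_card, ← coe_edgeFinset, Set.ncard_coe_finset, ← h1,
    Nat.add_sub_add_right] at hb
  exact hb

theorem xi_le_one_of_treeOn {V : Type*} [Fintype V] [DecidableEq V] (G : SimpleGraph V)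
    {E F P : Finset (Sym2 V)} (hE : TreeOn Finset.univ E) (hG : G.edgeSet = ↑(E ∪ (F ∪ P)))
    (hdE : Disjoint E (F ∪ P)) (hF : F.card ≤ 1) (hP : EvenOnClosed P) :
    xi G ≤ 1 := by
  have hT : IsSpanningTree G (fromEdgeSet (E : Set (Sym2 V))) := by
    refine ⟨?_, hE.isTree⟩
    rw [← edgeSet_subset_edgeSet, hE.edgeSet_fromEdgeSet, hG]
    exact_mod_cast Finset.subset_union_left
  have hle : xi G ≤ xiT G (fromEdgeSet (E : Set (Sym2 V))) := Nat.sInf_le ⟨_, hT, rfl⟩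
  refine hle.trans (oddComps_le_one _ ?_ hF hP)
  rw [SimpleGraph.edgeSet_fromEdgeSet, hE.edgeSet_fromEdgeSet, sdiff_eq_left.2]
  · rw [hG, ← Finset.coe_sdiff, Finset.union_sdiff_cancel_left hdE]
  · exact Set.disjoint_left.2 fun e he => G.not_isDiag_of_mem_edgeSet he.1

/-- The edges of an induced subgraph, viewed in the ambient vertex type, split into a tree on the
inducing set and a set that is even on closed sets. -/
theorem exists_treeOn_of_induce {V : Type*} [Fintype V] [DecidableEq V] (G : SimpleGraph V)
    (S : Set V) [DecidablePred (· ∈ S)] (hG : (G.induce S).Connected) (hx : xi (G.induce S) ≤ 1)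
    (hb : Even (betti (G.induce S))) :
    ∃ E D : Finset (Sym2 V), TreeOn S.toFinset E ∧ EvenOnClosed D ∧ Disjoint E D ∧
      ∀ e, e ∈ E ∪ D ↔ e ∈ G.edgeSet ∧ ∀ x ∈ e, x ∈ S := by
  classical
  obtain ⟨T, D, hT, hD, hDm⟩ := exists_spanningTree_evenOnClosed _ hG hx hb
  have hinj : Function.Injective (Subtype.val : S → V) := Subtype.val_injective
  refine ⟨T.edgeFinset.image (Sym2.map Subtype.val),
    D.image (Sym2.map Subtype.val), ?_,
    evenOnClosed_image hD hinj, ?_, ?_⟩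
  · convert hT.2.treeOn.image hinj
    ext x
    simp
  · rw [Finset.disjoint_image (Sym2.map.injective hinj)]
    exact Finset.disjoint_left.2 fun e he hD => ((hDm e).1 hD).2 (mem_edgeFinset.1 he)
  · intro e
    have hTD : ∀ e, e ∈ T.edgeFinset ∪ D ↔ e ∈ (G.induce S).edgeSet := fun e => by
      have : e ∈ T.edgeSet → e ∈ (G.induce S).edgeSet := fun h => edgeSet_mono hT.1 h
      rw [Finset.mem_union, mem_edgeFinset, hDm]
      tauto
    rw [← Finset.image_union]
    induction e with
    | h a b =>
      simp only [Finset.mem_image, hTD]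
      constructor
      · rintro ⟨e, he, h⟩
        induction e with
        | h c d =>
          rw [Sym2.map_mk] at h
          rw [← h]
          exact ⟨he, by simp⟩
      · rintro ⟨he, h⟩
        exact ⟨s(⟨a, h a (by simp)⟩, ⟨b, h b (by simp)⟩), he, rfl⟩

/-- If `A` is an edge-cut of the connected graph `G` such that `G - A`
has exactly two connected components `G₁` (induced on `S`) and `G₂` (induced on `Sᶜ`),
both upper-embeddable, and `β(G₁) ≡ β(G₂) ≡ 0 (mod 2)`, then `ξ(G) ≤ 1`, i.e. `G` is
upper-embeddable. -/
theorem edge_cut_upper_embeddable_of_even_betti {V : Type*} [Finite V]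
    (G : SimpleGraph V) (hG : G.Connected)
    (A : Set (Sym2 V)) (hA : A ⊆ G.edgeSet) (S : Set V)
    (hS : S.Nonempty) (hSc : Sᶜ.Nonempty)
    (hcross : ∀ e ∈ A, ∃ u v, e = s(u, v) ∧ u ∈ S ∧ v ∉ S)
    (hsplit : ∀ u v, (G.deleteEdges A).Adj u v → (u ∈ S ↔ v ∈ S))
    (hconn₁ : ((G.deleteEdges A).induce S).Connected)
    (hconn₂ : ((G.deleteEdges A).induce Sᶜ).Connected)
    (hx₁ : xi ((G.deleteEdges A).induce S) ≤ 1)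
    (hx₂ : xi ((G.deleteEdges A).induce Sᶜ) ≤ 1)
    (hb₁ : Even (betti ((G.deleteEdges A).induce S)))
    (hb₂ : Even (betti ((G.deleteEdges A).induce Sᶜ))) :
    xi G ≤ 1 := by
  classical
  have := Fintype.ofFinite V
  obtain ⟨E₁, D₁, hE₁, hD₁, hd₁, hm₁⟩ := exists_treeOn_of_induce _ S hconn₁ hx₁ hb₁
  obtain ⟨E₂, D₂, hE₂, hD₂, hd₂, hm₂⟩ := exists_treeOn_of_induce _ Sᶜ hconn₂ hx₂ hb₂
  simp only [edgeSet_deleteEdges, Set.mem_sdiff] at hm₁ hm₂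
  have hAne : A.toFinset.Nonempty := by
    rw [Set.toFinset_nonempty]
    obtain ⟨a, ha⟩ := hS
    obtain ⟨b, hb⟩ := hSc
    obtain ⟨p⟩ := hG a b
    obtain ⟨d, -, hd, hd'⟩ := p.exists_boundary_dart S ha hb
    by_contra hne
    have hadj : (G.deleteEdges A).Adj d.fst d.snd := by
      simp [Set.not_nonempty_iff_eq_empty.1 hne]
    exact hd' ((hsplit _ _ hadj).1 hd)
  obtain ⟨F, B, hFB, hdFB, hF, hB⟩ : ∃ F B : Finset (Sym2 V), F ∪ B = A.toFinset ∧
      Disjoint F B ∧ F.card ≤ 1 ∧ Odd B.card := by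
    rcases Nat.even_or_odd A.toFinset.card with h | h
    · obtain ⟨e, he⟩ := hAne
      refine ⟨{e}, A.toFinset.erase e, ?_, by simp, by simp, ?_⟩
      · rw [← Finset.insert_eq, Finset.insert_erase he]
      · rw [Finset.card_erase_of_mem he]
        exact Nat.Even.sub_odd (Finset.card_pos.2 ⟨e, he⟩) h odd_one
    · exact ⟨∅, A.toFinset, by simp, by simp, by simp, h⟩
  have hmA : ∀ e, e ∈ F ∪ B ↔ e ∈ A := fun e => by rw [hFB, Set.mem_toFinset]
  obtain ⟨E, P, hE, hP, hEP, hu⟩ := hE₁.exists_join hE₂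
    (by simp [Finset.disjoint_left]) hB (by
      intro e he
      obtain ⟨u, v, rfl, hu, hv⟩ := hcross e ((hmA e).1 (Finset.mem_union_right _ he))
      exact ⟨u, by simpa, v, by simpa, rfl⟩)
  have huniv : S.toFinset ∪ Sᶜ.toFinset = Finset.univ := by
    ext x
    simp
  rw [huniv] at hE
  have h12 : ∀ e : Sym2 V, (∀ x ∈ e, x ∈ S) → ¬ ∀ x ∈ e, x ∈ Sᶜ := fun e h h' =>
    h' _ e.out_fst_mem (h _ e.out_fst_mem)
  have hGe : ∀ e, e ∈ G.edgeSet ↔ e ∈ E₁ ∪ D₁ ∨ e ∈ E₂ ∪ D₂ ∨ e ∈ F ∪ B := by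
    intro e
    rw [hm₁, hm₂, hmA]
    constructor
    · intro he
      by_cases hA' : e ∈ A
      · exact .inr (.inr hA')
      · induction e with
        | h a b =>
          have := hsplit a b (by simpa [deleteEdges_adj] using ⟨he, hA'⟩)
          by_cases ha : a ∈ S
          · exact .inl ⟨⟨he, hA'⟩, by simp [ha, this.1 ha]⟩
          · exact .inr (.inl ⟨⟨he, hA'⟩, by simp [ha, mt this.2 ha]⟩)
    · rintro (h | h | h)
      exacts [h.1.1, h.1.1, hA h]
  simp only [Finset.mem_union] at hm₁ hm₂ hmA hGe
  simp only [Finset.ext_iff, Finset.mem_union] at hu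
  simp only [Finset.disjoint_left] at hd₁ hd₂ hdFB hEP
  have hD₁₂ : Disjoint D₁ D₂ := by
    rw [Finset.disjoint_left]
    intro e h h'
    exact h12 e ((hm₁ e).1 (.inr h)).2 ((hm₂ e).1 (.inr h')).2
  have hPD : Disjoint P (D₁ ∪ D₂) := by
    rw [Finset.disjoint_left]
    intro e
    have := h12 e
    grind
  refine xi_le_one_of_treeOn G (E := E) (F := F) (P := P ∪ (D₁ ∪ D₂)) hE ?_ ?_ hF
    (hP.union (hD₁.union hD₂ hD₁₂) hPD)
  · ext e
    simp only [hGe, Finset.coe_union, Set.mem_union, Finset.mem_coe]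
    grind
  · rw [Finset.disjoint_left]
    intro e
    have := h12 e
    grind
end

section
/- Let G be a finite connected simple graph and let A ⊆ E(G) be an edge-cut of G such that G − A has exactly two connected components G₁ and G₂ with ξ(G₁) ≤ 1 and ξ(G₂) ≤ 1. If |A| ≡ 1 (mod 2) and β(G₁) + β(G₂) ≡ 1 (mod 2), then ξ(G) ≤ 1; equivalently, G is upper-embeddable. -/
open SimpleGraph

/-- The edges in `E` can be assigned to endpoints so that the number of edges assigned to `v` is
congruent to `f v` modulo `2`, for every vertex `v`. -/
def HasParityAssignment {V : Type*} (E : Set (Sym2 V)) (f : V → ZMod 2) : Prop :=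
  ∃ h : Sym2 V → V, (∀ e, h e ∈ e) ∧ ∀ v, (({e ∈ E | h e = v}.ncard : ℕ) : ZMod 2) = f v

lemma sum_ncard_fiber {α β : Type*} [Finite α] (E : Set α) (h : α → β)
    (P : Finset β) :
    ∑ v ∈ P, {e ∈ E | h e = v}.ncard = {e ∈ E | h e ∈ P}.ncard := by
  classical
  have := Fintype.ofFinite α
  have key := Finset.card_eq_sum_card_fiberwise (f := h) (s := {e | e ∈ E ∧ h e ∈ P}.toFinset)
    (t := P) (by intro e he; simp at he; exact he.2)
  rw [Set.ncard_eq_toFinset_card', key]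
  refine Finset.sum_congr rfl fun v hv ↦ ?_
  rw [Set.ncard_eq_toFinset_card']
  congr 1
  ext e
  simp only [Set.mem_toFinset, Set.mem_ofPred_eq, Finset.mem_filter]
  grind

namespace HasParityAssignment

variable {V W : Type*}

lemma sum_eq [Fintype V] {E : Set (Sym2 V)} {f : V → ZMod 2} (hf : HasParityAssignment E f) :
    ∑ v, f v = E.ncard := by
  obtain ⟨h, -, hf⟩ := hf
  simp_rw [← hf]
  rw [← Nat.cast_sum, sum_ncard_fiber]
  simp

lemma add [Finite V] {E₁ E₂ : Set (Sym2 V)} {f₁ f₂ : V → ZMod 2} (hd : Disjoint E₁ E₂)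
    (h₁ : HasParityAssignment E₁ f₁) (h₂ : HasParityAssignment E₂ f₂) :
    HasParityAssignment (E₁ ∪ E₂) (f₁ + f₂) := by
  classical
  obtain ⟨a, ha, hf₁⟩ := h₁
  obtain ⟨b, hb, hf₂⟩ := h₂
  refine ⟨fun e ↦ if e ∈ E₁ then a e else b e, fun e ↦ ?_, fun v ↦ ?_⟩
  · dsimp only; split_ifs
    exacts [ha e, hb e]
  · have : {e ∈ E₁ ∪ E₂ | (if e ∈ E₁ then a e else b e) = v} =
        {e ∈ E₁ | a e = v} ∪ {e ∈ E₂ | b e = v} := by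
      ext e
      have : e ∈ E₁ → e ∉ E₂ := fun h ↦ Set.disjoint_left.1 hd h
      simp only [Set.mem_ofPred_eq, Set.mem_union]
      split_ifs <;> tauto
    rw [this, Set.ncard_union_eq, Nat.cast_add, hf₁, hf₂, Pi.add_apply]
    exact Set.disjoint_left.2 fun e h₁ h₂ ↦ Set.disjoint_left.1 hd h₁.1 h₂.1

lemma map {E : Set (Sym2 V)} {f : V → ZMod 2}
    (hf : HasParityAssignment E f) (φ : V ↪ W) :
    HasParityAssignment (Sym2.map φ '' E) (Function.extend φ f 0) := by
  obtain ⟨h, hh, hf⟩ := hf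
  have hinj := Sym2.map.injective φ.injective
  refine ⟨Function.extend (Sym2.map φ) (φ ∘ h) fun e ↦ e.out.1, fun e ↦ ?_, fun w ↦ ?_⟩
  · by_cases he : ∃ e₀, Sym2.map φ e₀ = e
    · obtain ⟨e₀, rfl⟩ := he
      rw [hinj.extend_apply]
      exact Sym2.mem_map.2 ⟨_, hh e₀, rfl⟩
    · rw [Function.extend_apply' _ _ _ he]
      exact Sym2.out_fst_mem e
  · by_cases hw : ∃ v, φ v = w
    · obtain ⟨v, rfl⟩ := hw
      rw [φ.injective.extend_apply, ← hf, ← Set.ncard_image_of_injective _ hinj]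
      congr 2
      ext e
      simp only [Set.mem_ofPred_eq, Set.mem_image]
      constructor
      · rintro ⟨⟨e₀, he₀, rfl⟩, he⟩
        rw [hinj.extend_apply] at he
        exact ⟨e₀, ⟨he₀, φ.injective he⟩, rfl⟩
      · rintro ⟨e₀, ⟨he₀, he⟩, rfl⟩
        exact ⟨⟨e₀, he₀, rfl⟩, by rw [hinj.extend_apply, Function.comp_apply, he]⟩
    · rw [Function.extend_apply' _ _ _ hw, Pi.zero_apply]
      convert Nat.cast_zero
      convert Set.ncard_empty (Sym2 W)
      ext e
      simp only [Set.mem_ofPred_eq, Set.mem_image, Set.mem_empty_iff_false, iff_false]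
      rintro ⟨⟨e₀, he₀, rfl⟩, he⟩
      rw [hinj.extend_apply] at he
      exact hw ⟨_, he⟩

lemma singleton [DecidableEq V] {u : V} {e : Sym2 V} (hu : u ∈ e) :
    HasParityAssignment {e} (Pi.single u 1) := by
  classical
  refine ⟨fun e' ↦ if e' = e then u else e'.out.1, fun e' ↦ ?_, fun v ↦ ?_⟩
  · dsimp only; split_ifs with h
    exacts [h ▸ hu, Sym2.out_fst_mem e']
  · by_cases hv : v = u
    · subst hv
      have : {e' ∈ ({e} : Set (Sym2 V)) | (if e' = e then v else e'.out.1) = v} = {e} := by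
        ext e'; simp; grind
      rw [this, Set.ncard_singleton, Pi.single_eq_same, Nat.cast_one]
    · have : {e' ∈ ({e} : Set (Sym2 V)) | (if e' = e then u else e'.out.1) = v} = ∅ := by
        ext e'; simp; grind
      rw [this, Set.ncard_empty, Pi.single_eq_of_ne hv, Nat.cast_zero]

lemma diff_singleton [Finite V] [DecidableEq V] {E : Set (Sym2 V)} {f : V → ZMod 2}
    (hf : HasParityAssignment E f) {e : Sym2 V} (he : e ∈ E) :
    ∃ u ∈ e, HasParityAssignment (E \ {e}) (f + Pi.single u 1) := by
  obtain ⟨h, hh, hf⟩ := hf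
  refine ⟨h e, hh e, h, hh, fun v ↦ ?_⟩
  rw [Pi.add_apply, ← hf]
  by_cases hv : v = h e
  · subst hv
    have : {e' ∈ E | h e' = h e} = insert e {e' ∈ E \ {e} | h e' = h e} := by
      ext e'; simp; grind
    rw [this, Set.ncard_insert_of_notMem (by simp)]
    simp [add_assoc, CharTwo.add_self_eq_zero]
  · have : {e' ∈ E | h e' = v} = {e' ∈ E \ {e} | h e' = v} := by
      ext e'; simp; grind
    rw [this]
    simp [hv]

lemma flip_edge [Finite V] [DecidableEq V] {E : Set (Sym2 V)} {f : V → ZMod 2}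
    (hf : HasParityAssignment E f) {x y : V} (he : s(x, y) ∈ E) :
    HasParityAssignment E (f + Pi.single x 1 + Pi.single y 1) := by
  obtain ⟨u, hu, h⟩ := hf.diff_singleton he
  have hE : E \ {s(x, y)} ∪ {s(x, y)} = E := by simpa using he
  have hd : Disjoint (E \ {s(x, y)}) {s(x, y)} := Set.disjoint_sdiff_left
  rcases Sym2.mem_iff.1 hu with rfl | rfl
  · simpa [hE] using h.add hd (singleton (Sym2.mem_mk_right u y))
  · have := h.add hd (singleton (Sym2.mem_mk_left x u))
    rwa [hE, add_right_comm] at this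

lemma flip_walk [Finite V] [DecidableEq V] {D : SimpleGraph V} {f : V → ZMod 2}
    (hf : HasParityAssignment D.edgeSet f) {x y : V} (p : D.Walk x y) :
    HasParityAssignment D.edgeSet (f + Pi.single x 1 + Pi.single y 1) := by
  induction p with
  | @nil a =>
    have h2 : (Pi.single a 1 + Pi.single a 1 : V → ZMod 2) = 0 :=
      funext fun v ↦ CharTwo.add_self_eq_zero _
    rwa [add_assoc, h2, add_zero]
  | @cons a b c hab p ih =>
    have := ih.flip_edge (x := a) (y := b) hab
    convert this using 1
    have h2 : (Pi.single b 1 + Pi.single b 1 : V → ZMod 2) = 0 :=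
      funext fun v ↦ CharTwo.add_self_eq_zero _
    linear_combination -h2

/-- Any target parities can be met by assigning the edges of `D` to endpoints, except at no more
than one vertex in each component. -/
lemma exists_of_target [Finite V] (D : SimpleGraph V) (g : V → ZMod 2) :
    ∃ f, HasParityAssignment D.edgeSet f ∧
      ∀ u v, f u ≠ g u → f v ≠ g v → D.Reachable u v → u = v := by
  classical
  have hne : ∃ f, HasParityAssignment D.edgeSet f :=
    ⟨_, fun e ↦ e.out.1, Sym2.out_fst_mem, fun _ ↦ rfl⟩
  obtain ⟨f, hf, hmin⟩ :=
    exists_minimalFor_of_wellFoundedLT (HasParityAssignment D.edgeSet)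
      (fun f ↦ {v | f v ≠ g v}.ncard) hne
  refine ⟨f, hf, fun u v hu hv ⟨p⟩ ↦ by_contra fun huv ↦ ?_⟩
  have hlt : {w | (f + Pi.single u 1 + Pi.single v 1 : V → ZMod 2) w ≠ g w}.ncard <
      {w | f w ≠ g w}.ncard := by
    refine Set.ncard_lt_ncard ⟨fun w hw ↦ ?_, fun hsub ↦ ?_⟩
    · by_cases h1 : w = u
      · exact h1 ▸ hu
      by_cases h2 : w = v
      · exact h2 ▸ hv
      simpa [h1, h2] using hw
    · have := hsub hu
      simp only [Set.mem_ofPred_eq, Pi.add_apply, Pi.single_eq_same, Pi.single_eq_of_ne huv,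
        add_zero] at this
      revert this hu
      generalize f u = a; generalize g u = b
      revert a b; decide
  exact hlt.not_ge (hmin (hf.flip_walk p) hlt.le)

lemma of_connected [Fintype V] {D : SimpleGraph V} (hD : D.Connected) {g : V → ZMod 2}
    (hg : ∑ v, g v = D.edgeSet.ncard) : HasParityAssignment D.edgeSet g := by
  obtain ⟨f, hf, h⟩ := exists_of_target D g
  suffices f = g from this ▸ hf
  by_contra hne
  obtain ⟨u, hu⟩ := Function.ne_iff.1 hne
  have hsum : ∑ v, (f v - g v) = 0 := by rw [Finset.sum_sub_distrib, hf.sum_eq, hg, sub_self]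
  rw [Finset.sum_eq_single u (fun v _ hv ↦ by_contra fun hv' ↦
    hv (h v u (sub_ne_zero.1 hv') hu (hD v u))) (by simp), sub_eq_zero] at hsum
  exact hu hsum

lemma compEdgeCount_eq [Fintype V] {D : SimpleGraph V} {f : V → ZMod 2}
    (hf : HasParityAssignment D.edgeSet f) (c : D.ConnectedComponent)
    [DecidablePred fun v ↦ D.connectedComponentMk v = c] :
    (compEdgeCount D c : ZMod 2) = ∑ v with D.connectedComponentMk v = c, f v := by
  obtain ⟨h, hh, hf⟩ := hf
  simp_rw [← hf]
  rw [← Nat.cast_sum, sum_ncard_fiber, compEdgeCount]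
  congr 2
  ext e
  simp only [Set.mem_ofPred_eq, Finset.mem_filter, Finset.mem_univ, true_and]
  refine and_congr_right fun he ↦ ⟨fun H ↦ H _ (hh e), fun H ↦ ?_⟩
  have h1 := hh e
  revert H h1
  generalize h e = z
  induction e with
  | h x y =>
    rintro rfl hz v hv
    have hxy : D.Reachable x y := Adj.reachable he
    rw [ConnectedComponent.eq]
    rcases Sym2.mem_iff.1 hz with rfl | rfl <;> rcases Sym2.mem_iff.1 hv with rfl | rfl
    exacts [.rfl, hxy.symm, hxy, .rfl]

lemma oddComps_le [Finite V] {D : SimpleGraph V} {f : V → ZMod 2}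
    (hf : HasParityAssignment D.edgeSet f) : oddComps D ≤ {v | f v ≠ 0}.ncard := by
  classical
  have := Fintype.ofFinite V
  refine (Set.ncard_le_ncard ?_).trans (Set.ncard_image_le (f := D.connectedComponentMk))
  intro c hc
  by_contra hcon
  have := hf.compEdgeCount_eq c
  rw [Finset.sum_eq_zero, ZMod.natCast_eq_zero_iff_even] at this
  · exact Nat.not_even_iff_odd.2 hc this
  · intro v hv
    by_contra hv'
    exact hcon ⟨v, hv', (Finset.mem_filter.1 hv).2⟩

lemma exists_ncard_le_oddComps [Finite V] (D : SimpleGraph V) :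
    ∃ f, HasParityAssignment D.edgeSet f ∧ {v | f v ≠ 0}.ncard ≤ oddComps D := by
  classical
  have := Fintype.ofFinite V
  obtain ⟨f, hf, h⟩ := exists_of_target D 0
  refine ⟨f, hf, ?_⟩
  refine Set.ncard_le_ncard_of_injOn D.connectedComponentMk (fun u hu ↦ ?_)
    fun u hu v hv huv ↦ h u v hu hv (ConnectedComponent.eq.1 huv)
  rw [Set.mem_ofPred_eq, ← Nat.not_even_iff_odd, ← ZMod.natCast_eq_zero_iff_even,
    hf.compEdgeCount_eq, Finset.sum_eq_single u]
  · exact hu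
  · intro v hv hvu
    by_contra hv'
    exact hvu (h v u hv' hu (ConnectedComponent.eq.1 (Finset.mem_filter.1 hv).2))
  · simp

end HasParityAssignment

lemma ncard_ne_zero_cast {V : Type*} [Fintype V] (f : V → ZMod 2) :
    (({v | f v ≠ 0}.ncard : ℕ) : ZMod 2) = ∑ v, f v := by
  classical
  rw [Set.ncard_eq_toFinset_card', Set.toFinset_ofPred, Finset.card_filter, Nat.cast_sum]
  refine Finset.sum_congr rfl fun v _ ↦ ?_
  generalize f v = a
  revert a; decide

lemma SimpleGraph.IsAcyclic.ncard_edgeSet_lt {V : Type*} [Finite V] [Nonempty V]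
    {F : SimpleGraph V} (hF : F.IsAcyclic) : F.edgeSet.ncard < Nat.card V := by
  obtain ⟨T, hFT, -, hT⟩ :=
    (connected_top (V := V)).exists_isTree_le_of_le_of_isAcyclic (H := F) le_top hF
  have h1 := (isTree_iff_connected_and_card.1 hT).2
  have h2 : F.edgeSet.ncard ≤ T.edgeSet.ncard := Set.ncard_le_ncard (edgeSet_mono hFT)
  rw [Nat.card_coe_set_eq] at h1
  omega

lemma SimpleGraph.IsAcyclic.ncard_edges_within_lt {V : Type*} [Finite V]
    {F : SimpleGraph V} (hF : F.IsAcyclic) {K : Set V} (hK : K.Nonempty) :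
    {e ∈ F.edgeSet | ∀ v ∈ e, v ∈ K}.ncard < K.ncard := by
  have := hK.to_subtype
  have h := (hF.induce K).ncard_edgeSet_lt
  rw [Nat.card_coe_set_eq] at h
  refine lt_of_le_of_lt ((Set.ncard_le_ncard ?_).trans
    (Set.ncard_image_le (f := Sym2.map (Subtype.val : K → V)))) h
  rintro e ⟨he, heK⟩
  induction e with
  | h x y =>
    exact ⟨s(⟨x, heK x (by simp)⟩, ⟨y, heK y (by simp)⟩), he, rfl⟩

lemma reachable_fromEdgeSet {V : Type*} {E : Set (Sym2 V)} {e : Sym2 V} (he : e ∈ E) {p q : V}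
    (hp : p ∈ e) (hq : q ∈ e) : (fromEdgeSet E).Reachable p q := by
  by_cases hpq : p = q
  · exact hpq ▸ .rfl
  · obtain rfl := (Sym2.mem_and_mem_iff hpq).1 ⟨hp, hq⟩
    exact Adj.reachable ((fromEdgeSet_adj _).2 ⟨he, hpq⟩)

lemma forall_mem_of_mem_image_map_val {V : Type*} {S : Set V} {E : Set (Sym2 S)} {e : Sym2 V}
    (he : e ∈ Sym2.map Subtype.val '' E) : ∀ v ∈ e, v ∈ S := by
  rintro v hv
  obtain ⟨e₀, -, rfl⟩ := he
  obtain ⟨x, -, rfl⟩ := Sym2.mem_map.1 hv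
  exact x.2

lemma HasParityAssignment.tree_union_cut {V : Type*} [Finite V] {S : Set V}
    {T : SimpleGraph S} (hT : T.IsTree) {A : Set (Sym2 V)}
    (hcross : ∀ e ∈ A, ∃ u v, e = s(u, v) ∧ u ∈ S ∧ v ∉ S) (hA : Odd A.ncard)
    [DecidablePred (· ∈ S)] :
    HasParityAssignment (Sym2.map Subtype.val '' T.edgeSet ∪ A)
      (fun v ↦ if v ∈ S then 1 else 0) := by
  classical
  have := Fintype.ofFinite V
  have hend : ∀ e : Sym2 V, ∃ v ∈ e, e ∈ A → v ∈ S := fun e ↦ by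
    by_cases he : e ∈ A
    · obtain ⟨u, v, rfl, hu, -⟩ := hcross e he
      exact ⟨u, by simp, fun _ ↦ hu⟩
    · exact ⟨e.out.1, Sym2.out_fst_mem e, fun h ↦ (he h).elim⟩
  choose h hh hS using hend
  set a : V → ZMod 2 := fun v ↦ ({e ∈ A | h e = v}.ncard : ℕ) with ha
  have hAa : HasParityAssignment A a := ⟨h, hh, fun _ ↦ rfl⟩
  have ha0 : ∀ v ∉ S, a v = 0 := fun v hv ↦ by
    have : {e ∈ A | h e = v} = ∅ :=
      Set.eq_empty_of_forall_notMem fun e he ↦ hv (he.2 ▸ hS e he.1)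
    simp only [ha, this, Set.ncard_empty, Nat.cast_zero]
  have hsum : ∑ v : S, (1 + a v) = T.edgeSet.ncard := by
    have h1 : ∑ v : S, a v = 1 := by
      rw [Finset.sum_set_coe S, Finset.sum_subset (Finset.subset_univ _), hAa.sum_eq]
      · exact ZMod.natCast_eq_one_iff_odd.2 hA
      · intro v _ hv
        exact ha0 v (by simpa using hv)
    have h2 := (isTree_iff_connected_and_card.1 hT).2
    rw [Nat.card_coe_set_eq] at h2
    have h3 : (1 + 1 : ZMod 2) = 0 := by decide
    rw [Finset.sum_add_distrib, h1, Finset.sum_const, Finset.card_univ, ← Nat.card_eq_fintype_card,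
      ← h2, nsmul_one, Nat.cast_add, Nat.cast_one, add_assoc, h3, add_zero]
  have hd : Disjoint (Sym2.map Subtype.val '' T.edgeSet) A := by
    refine Set.disjoint_left.2 fun e h₁ h₂ ↦ ?_
    obtain ⟨u, v, rfl, -, hv⟩ := hcross e h₂
    exact hv (forall_mem_of_mem_image_map_val h₁ v (by simp))
  convert ((of_connected hT.connected hsum).map (Function.Embedding.subtype _)).add hd hAa using 1
  ext v
  rw [Pi.add_apply]
  by_cases hv : v ∈ S
  · have := (Function.Embedding.subtype (· ∈ S)).injective.extend_apply
      (fun v : S ↦ 1 + a v) 0 ⟨v, hv⟩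
    rw [Function.Embedding.subtype_apply] at this
    simp only [hv, if_true]
    erw [this]
    rw [add_assoc, CharTwo.add_self_eq_zero, add_zero]
  · rw [Function.extend_apply', ha0 v hv]
    · simp [hv]
    · rintro ⟨x, rfl⟩
      exact hv x.2

/-- If an odd edge-cut joins two trees, then the resulting graph has a spanning tree containing the
second tree whose cotree edges can be assigned evenly to endpoints. -/
lemma exists_isTree_of_odd_cut {V : Type*} [Finite V] {S : Set V}
    {T₁ : SimpleGraph S} (hT₁ : T₁.IsTree) {T₂ : SimpleGraph ↥Sᶜ} (hT₂ : T₂.IsTree)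
    {A : Set (Sym2 V)} (hcross : ∀ e ∈ A, ∃ u v, e = s(u, v) ∧ u ∈ S ∧ v ∉ S)
    (hA : Odd A.ncard) :
    ∃ X ⊆ Sym2.map Subtype.val '' T₁.edgeSet ∪ A,
      (fromEdgeSet (X ∪ Sym2.map Subtype.val '' T₂.edgeSet)).IsTree ∧
      HasParityAssignment ((Sym2.map Subtype.val '' T₁.edgeSet ∪ A) \ X) 0 := by
  classical
  obtain ⟨h, hh, hodd⟩ := HasParityAssignment.tree_union_cut hT₁ hcross hA
  set E := Sym2.map Subtype.val '' T₁.edgeSet ∪ A with hE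
  have hout : ∀ v : S, ∃ e ∈ E, h e = v := fun v ↦ by
    by_contra! hcon
    have := hodd v
    have hempty : {e ∈ E | h e = v} = ∅ :=
      Set.eq_empty_of_forall_notMem fun e he ↦ hcon e he.1 he.2
    rw [hempty] at this
    simp at this
  choose out houtE hout using hout
  have houtinj : Function.Injective out := fun x y hxy ↦
    Subtype.ext (by rw [← hout x, ← hout y, hxy])
  refine ⟨Set.range out, Set.range_subset_iff.2 houtE, ?_, h, hh, fun v ↦ ?_⟩
  · set T := fromEdgeSet (Set.range out ∪ Sym2.map Subtype.val '' T₂.edgeSet) with hT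
    have hreach₂ : ∀ x y : ↥Sᶜ, T.Reachable x y := fun x y ↦ by
      let φ : T₂ →g T := ⟨Subtype.val, fun {a b} hab ↦ (fromEdgeSet_adj _).2
        ⟨Or.inr ⟨s(a, b), hab, rfl⟩, fun heq ↦ hab.ne (Subtype.ext heq)⟩⟩
      exact (hT₂.connected x y).map φ
    have hreach : ∀ v, ∃ w : ↥Sᶜ, T.Reachable v w := fun v ↦ by
      by_contra! hcon
      have hS : ∀ y, T.Reachable v y → y ∈ S := fun y hy ↦ by
        by_contra hyS
        exact hcon ⟨y, hyS⟩ hy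
      have hlt := hT₁.isAcyclic.ncard_edges_within_lt (K := {x : S | T.Reachable v x})
        ⟨⟨v, hS v .rfl⟩, .rfl⟩
      refine hlt.not_ge ?_
      rw [← Set.ncard_image_of_injective _ houtinj]
      refine (Set.ncard_le_ncard ?_).trans
        (Set.ncard_image_le (f := Sym2.map (Subtype.val : S → V)))
      rintro _ ⟨x, hx, rfl⟩
      have hmem : ∀ y ∈ out x, T.Reachable v y := fun y hy ↦
        hx.trans (reachable_fromEdgeSet (Or.inl ⟨x, rfl⟩) (by simpa [hout] using hh (out x)) hy)
      rcases houtE x with ⟨e, he, hex⟩ | hx'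
      · exact ⟨e, ⟨he, fun y hy ↦ hmem y (hex ▸ Sym2.mem_map.2 ⟨y, hy, rfl⟩)⟩, hex⟩
      · obtain ⟨u, w, huw, -, hw⟩ := hcross _ hx'
        exact (hw (hS w (hmem w (by simp [huw])))).elim
    have hconn : T.Connected := by
      have := hT₂.connected.nonempty
      refine { preconnected := fun x y ↦ ?_, nonempty := this.map Subtype.val }
      obtain ⟨x', hx⟩ := hreach x
      obtain ⟨y', hy⟩ := hreach y
      exact hx.trans ((hreach₂ x' y').trans hy.symm)
    refine isTree_iff_connected_and_card.2
      ⟨hconn, le_antisymm ?_ hconn.card_vert_le_card_edgeSet_add_one⟩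
    have h1 : T.edgeSet.ncard ≤ (Set.range out).ncard + T₂.edgeSet.ncard := by
      refine (Set.ncard_le_ncard ?_).trans ((Set.ncard_union_le _ _).trans
        (Nat.add_le_add_left (Set.ncard_image_le (f := Sym2.map Subtype.val)) _))
      rw [hT, edgeSet_fromEdgeSet]
      exact Set.sdiff_subset
    have h2 := (isTree_iff_connected_and_card.1 hT₂).2
    have h3 : (Set.range out).ncard = S.ncard := by
      rw [← Set.image_univ, Set.ncard_image_of_injective _ houtinj, Set.ncard_univ,
        Nat.card_coe_set_eq]
    have h4 := Set.ncard_add_ncard_compl S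
    rw [Nat.card_coe_set_eq, Nat.card_coe_set_eq] at h2
    rw [Nat.card_coe_set_eq]
    omega
  · have key := hodd v
    by_cases hv : v ∈ S
    · have : {e ∈ E | h e = v} = insert (out ⟨v, hv⟩) {e ∈ E \ Set.range out | h e = v} := by
        ext e
        simp only [Set.mem_ofPred_eq, Set.mem_insert_iff, Set.mem_sdiff]
        constructor
        · rintro ⟨he, rfl⟩
          by_cases hr : e ∈ Set.range out
          · obtain ⟨x, rfl⟩ := hr
            exact Or.inl (congrArg out (Subtype.ext (hout x).symm))
          · exact Or.inr ⟨⟨he, hr⟩, rfl⟩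
        · rintro (rfl | ⟨⟨he, -⟩, hev⟩)
          exacts [⟨houtE _, hout _⟩, ⟨he, hev⟩]
      rw [this, Set.ncard_insert_of_notMem fun hmem ↦ hmem.1.2 ⟨_, rfl⟩] at key
      simpa [hv] using key
    · have : {e ∈ E | h e = v} = {e ∈ E \ Set.range out | h e = v} := by
        ext e
        refine ⟨fun ⟨he, hev⟩ ↦ ⟨⟨he, ?_⟩, hev⟩, fun ⟨⟨he, _⟩, hev⟩ ↦ ⟨he, hev⟩⟩
        rintro ⟨x, rfl⟩
        exact hv (hev ▸ (hout x).symm ▸ x.2)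
      rw [← this]
      simpa [hv] using key

lemma edgeSet_fromEdgeSet_diff {V : Type*} (G : SimpleGraph V) (s : Set (Sym2 V)) :
    (fromEdgeSet (G.edgeSet \ s)).edgeSet = G.edgeSet \ s := by
  rw [edgeSet_fromEdgeSet]
  refine Set.Subset.antisymm Set.sdiff_subset fun e he ↦ ⟨he, ?_⟩
  exact G.not_isDiag_of_mem_edgeSet he.1

/-- A graph of Betti deficiency at most `1` has a spanning tree whose cotree edges can be assigned
evenly to endpoints, with the exception of at most one vertex. -/
lemma exists_isSpanningTree_of_xi_le_one {V : Type*} [Finite V] {G : SimpleGraph V}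
    (hG : G.Connected) (hx : xi G ≤ 1) :
    ∃ T f, IsSpanningTree G T ∧ HasParityAssignment (G.edgeSet \ T.edgeSet) f ∧
      {v | f v ≠ 0}.ncard ≤ 1 ∧ (Odd {v | f v ≠ 0}.ncard ↔ Odd (betti G)) := by
  have := Fintype.ofFinite V
  obtain ⟨T₀, hT₀, hT₀'⟩ := hG.exists_isTree_le
  obtain ⟨T, hT, hTx⟩ := Nat.sInf_mem
    (s := {n | ∃ T, IsSpanningTree G T ∧ xiT G T = n}) ⟨_, T₀, ⟨hT₀, hT₀'⟩, rfl⟩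
  obtain ⟨f, hf, hle⟩ := HasParityAssignment.exists_ncard_le_oddComps
    (fromEdgeSet (G.edgeSet \ T.edgeSet))
  rw [edgeSet_fromEdgeSet_diff] at hf
  refine ⟨T, f, hT, hf, hle.trans (hTx.trans_le hx), ?_⟩
  have h1 := (isTree_iff_connected_and_card.1 hT.2).2
  have h2 := Set.ncard_sdiff_add_ncard_of_subset (edgeSet_mono hT.1)
  rw [Nat.card_coe_set_eq] at h1
  have h3 : betti G = (G.edgeSet \ T.edgeSet).ncard := by
    unfold betti
    omega
  rw [h3, ← ZMod.natCast_eq_one_iff_odd, ← ZMod.natCast_eq_one_iff_odd, ncard_ne_zero_cast,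
    hf.sum_eq]

lemma setOf_extend_ne_zero_subset {α β M : Type*} [Zero M] (φ : α → β) (hφ : φ.Injective)
    (f : α → M) : {b | Function.extend φ f 0 b ≠ 0} ⊆ φ '' {a | f a ≠ 0} := by
  intro b hb
  by_cases h : ∃ a, φ a = b
  · obtain ⟨a, rfl⟩ := h
    exact ⟨a, by simpa [hφ.extend_apply] using hb, rfl⟩
  · exact (hb (by rw [Function.extend_apply' _ _ _ h]; rfl)).elim

lemma cotree_eq {α : Type*} {A T₁ C₁ T₂ C₂ X : Set α} (hX : X ⊆ T₁ ∪ A)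
    (h₁ : Disjoint C₁ T₁) (h₂ : Disjoint C₁ A) (h₃ : Disjoint C₂ T₂) (h₄ : Disjoint C₂ A)
    (h₅ : Disjoint T₂ A) (h₆ : Disjoint C₁ T₂) (h₇ : Disjoint T₁ T₂) (h₈ : Disjoint T₁ C₂) :
    (A ∪ (T₁ ∪ C₁) ∪ (T₂ ∪ C₂)) \ (X ∪ T₂) = C₁ ∪ C₂ ∪ ((T₁ ∪ A) \ X) := by
  simp only [Set.disjoint_left] at *
  ext e
  have h₉ := @hX e
  simp only [Set.mem_union, Set.mem_sdiff] at h₉ ⊢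
  grind

/-- If `A` is an edge-cut of the connected graph `G` such that `G - A`
has exactly two connected components `G₁` (induced on `S`) and `G₂` (induced on `Sᶜ`),
both upper-embeddable, `|A|` is odd and `β(G₁) + β(G₂)` is odd, then `ξ(G) ≤ 1`, i.e.
`G` is upper-embeddable. -/
theorem edge_cut_upper_embeddable_of_odd {V : Type*} [Finite V]
    (G : SimpleGraph V) (hG : G.Connected)
    (A : Set (Sym2 V)) (hA : A ⊆ G.edgeSet) (S : Set V)
    (hS : S.Nonempty) (hSc : Sᶜ.Nonempty)
    (hcross : ∀ e ∈ A, ∃ u v, e = s(u, v) ∧ u ∈ S ∧ v ∉ S)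
    (hsplit : ∀ u v, (G.deleteEdges A).Adj u v → (u ∈ S ↔ v ∈ S))
    (hconn₁ : ((G.deleteEdges A).induce S).Connected)
    (hconn₂ : ((G.deleteEdges A).induce Sᶜ).Connected)
    (hx₁ : xi ((G.deleteEdges A).induce S) ≤ 1)
    (hx₂ : xi ((G.deleteEdges A).induce Sᶜ) ≤ 1)
    (hAodd : Odd A.ncard)
    (hbodd : Odd (betti ((G.deleteEdges A).induce S) +
      betti ((G.deleteEdges A).induce Sᶜ))) :
    xi G ≤ 1 := by
  obtain ⟨T₁, f₁, hT₁, hf₁, hle₁, hodd₁⟩ := exists_isSpanningTree_of_xi_le_one hconn₁ hx₁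
  obtain ⟨T₂, f₂, hT₂, hf₂, hle₂, hodd₂⟩ := exists_isSpanningTree_of_xi_le_one hconn₂ hx₂
  obtain ⟨X, hX, hT, h0⟩ := exists_isTree_of_odd_cut hT₁.2 hT₂.2 hcross hAodd
  set G₁ := (G.deleteEdges A).induce S
  set G₂ := (G.deleteEdges A).induce Sᶜ
  set ι₁ : Sym2 S → Sym2 V := Sym2.map Subtype.val with hι₁
  set ι₂ : Sym2 ↥Sᶜ → Sym2 V := Sym2.map Subtype.val with hι₂
  have hinj₁ : ι₁.Injective := Sym2.map.injective Subtype.val_injective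
  have hinj₂ : ι₂.Injective := Sym2.map.injective Subtype.val_injective
  have hedges : G.edgeSet = A ∪ ι₁ '' G₁.edgeSet ∪ ι₂ '' G₂.edgeSet := by
    ext e
    constructor
    · intro he
      by_cases heA : e ∈ A
      · exact Or.inl (Or.inl heA)
      induction e with
      | h x y =>
        have hxy : (G.deleteEdges A).Adj x y := deleteEdges_adj.2 ⟨he, heA⟩
        by_cases hx : x ∈ S
        · exact Or.inl (Or.inr ⟨s(⟨x, hx⟩, ⟨y, (hsplit x y hxy).1 hx⟩), hxy, rfl⟩)
        · exact Or.inr ⟨s(⟨x, hx⟩, ⟨y, fun hy ↦ hx ((hsplit x y hxy).2 hy)⟩), hxy, rfl⟩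
    · rintro ((he | ⟨e, he, rfl⟩) | ⟨e, he, rfl⟩)
      · exact hA he
      all_goals
        induction e with
        | h x y => exact (deleteEdges_adj.1 he).1
  have hdA₁ : ∀ E, Disjoint (ι₁ '' E) A := fun E ↦ Set.disjoint_left.2 fun e h₁ h₂ ↦ by
    obtain ⟨u, v, rfl, -, hv⟩ := hcross e h₂
    exact hv (forall_mem_of_mem_image_map_val h₁ v (by simp))
  have hdA₂ : ∀ E, Disjoint (ι₂ '' E) A := fun E ↦ Set.disjoint_left.2 fun e h₁ h₂ ↦ by
    obtain ⟨u, v, rfl, hu, -⟩ := hcross e h₂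
    exact forall_mem_of_mem_image_map_val h₁ u (by simp) hu
  have hd₁₂ : ∀ E F, Disjoint (ι₁ '' E) (ι₂ '' F) := fun E F ↦
    Set.disjoint_left.2 fun e h₁ h₂ ↦
      forall_mem_of_mem_image_map_val h₂ _ (Sym2.out_fst_mem e)
        (forall_mem_of_mem_image_map_val h₁ _ (Sym2.out_fst_mem e))
  set C₁ := G₁.edgeSet \ T₁.edgeSet
  set C₂ := G₂.edgeSet \ T₂.edgeSet
  have hG₁ : ι₁ '' G₁.edgeSet = ι₁ '' T₁.edgeSet ∪ ι₁ '' C₁ := by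
    rw [← Set.image_union, Set.union_sdiff_cancel (edgeSet_mono hT₁.1)]
  have hG₂ : ι₂ '' G₂.edgeSet = ι₂ '' T₂.edgeSet ∪ ι₂ '' C₂ := by
    rw [← Set.image_union, Set.union_sdiff_cancel (edgeSet_mono hT₂.1)]
  have hd₁ : Disjoint (ι₁ '' C₁) (ι₁ '' T₁.edgeSet) :=
    (Set.disjoint_image_iff hinj₁).2 Set.disjoint_sdiff_left
  have hd₂ : Disjoint (ι₂ '' C₂) (ι₂ '' T₂.edgeSet) :=
    (Set.disjoint_image_iff hinj₂).2 Set.disjoint_sdiff_left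
  set T := fromEdgeSet (X ∪ ι₂ '' T₂.edgeSet) with hTdef
  have hXG : X ∪ ι₂ '' T₂.edgeSet ⊆ G.edgeSet := by
    rw [hedges, hG₁, hG₂]
    refine Set.union_subset (hX.trans ?_) ?_ <;> intro e he <;>
      simp only [Set.mem_union] at he ⊢ <;> tauto
  have hTE : T.edgeSet = X ∪ ι₂ '' T₂.edgeSet := by
    rw [hTdef, edgeSet_fromEdgeSet]
    exact Set.Subset.antisymm Set.sdiff_subset fun e he ↦
      ⟨he, G.not_isDiag_of_mem_edgeSet (hXG he)⟩
  have hTG : T ≤ G := by rwa [← edgeSet_subset_edgeSet, hTE]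
  have hcotree : G.edgeSet \ T.edgeSet =
      ι₁ '' C₁ ∪ ι₂ '' C₂ ∪ ((ι₁ '' T₁.edgeSet ∪ A) \ X) := by
    rw [hTE, hedges, hG₁, hG₂]
    exact cotree_eq hX hd₁ (hdA₁ _) hd₂ (hdA₂ _) (hdA₂ _) (hd₁₂ _ _) (hd₁₂ _ _) (hd₁₂ _ _)
  have hpar := ((hf₁.map (Function.Embedding.subtype _)).add (hd₁₂ C₁ C₂)
    (hf₂.map (Function.Embedding.subtype _))).add (Set.disjoint_union_left.2
      ⟨Set.disjoint_of_subset_right Set.sdiff_subset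
        (Set.disjoint_union_right.2 ⟨hd₁, hdA₁ C₁⟩),
      Set.disjoint_of_subset_right Set.sdiff_subset
        (Set.disjoint_union_right.2 ⟨(hd₁₂ _ _).symm, hdA₂ C₂⟩)⟩) h0
  change HasParityAssignment (ι₁ '' C₁ ∪ ι₂ '' C₂ ∪ ((ι₁ '' T₁.edgeSet ∪ A) \ X)) _ at hpar
  rw [← hcotree, ← edgeSet_fromEdgeSet_diff, add_zero] at hpar
  have hxi : xi G ≤ xiT G T := Nat.sInf_le ⟨T, ⟨hTG, hT⟩, rfl⟩
  refine hxi.trans (hpar.oddComps_le.trans ?_)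
  have hsupp : {v | f₁ v ≠ 0}.ncard + {v | f₂ v ≠ 0}.ncard ≤ 1 := by
    rw [Nat.odd_add, ← hodd₁, ← Nat.not_odd_iff_even, ← hodd₂] at hbodd
    have h₁ : {v | f₁ v ≠ 0}.ncard = 0 ∨ {v | f₁ v ≠ 0}.ncard = 1 := by omega
    have h₂ : {v | f₂ v ≠ 0}.ncard = 0 ∨ {v | f₂ v ≠ 0}.ncard = 1 := by omega
    rcases h₁ with h₁ | h₁ <;> rcases h₂ with h₂ | h₂ <;> simp [h₁, h₂] at hbodd ⊢
  refine le_trans (le_trans (Set.ncard_le_ncard (t := Subtype.val '' {v | f₁ v ≠ 0} ∪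
    Subtype.val '' {v | f₂ v ≠ 0}) fun v hv ↦ ?_) (Set.ncard_union_le _ _)) ((add_le_add
      (Set.ncard_image_le (f := Subtype.val)) (Set.ncard_image_le (f := Subtype.val))).trans hsupp)
  by_contra hcon
  have h₁ : Function.extend Subtype.val f₁ 0 v = 0 := by_contra fun h ↦ hcon
    (Or.inl (setOf_extend_ne_zero_subset _ Subtype.val_injective f₁ h))
  have h₂ : Function.extend Subtype.val f₂ 0 v = 0 := by_contra fun h ↦ hcon
    (Or.inr (setOf_extend_ne_zero_subset _ Subtype.val_injective f₂ h))
  exact hv ((congrArg₂ (· + ·) h₁ h₂).trans (add_zero 0))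
end
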